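/- arXiv:2504.00964 — 2 statements merged into one kernel-verified Lean document; each statement's English description precedes it below -/
import Mathlib

section
/- Let ε > 0 be a constant, and suppose p = p(n) ∈ (ε, 1−ε), θ = θ(n) ∈ [−1+ε, 1/2−ε], and integers r = r(n) are such that r(n)·log(1/p(n))/(2·log n) → 1 as n → ∞ and c₁·n^(1+θ(n)) ≤ μ_{r(n)} ≤ c₂·n^(1+θ(n)) for some constants c₂ ≥ c₁ > 0. Then there exist constants K, C, c > 0 and, for each n, a set 𝓖_n of r(n)-uniform hypergraphs on [n], with P(H_{r(n)}(G(n,p(n))) ∈ 𝓖_n) → 1 as n → ∞, such that for all sufficiently large n and every H ∈ 𝓖_n: P(H_{r(n)}(G(n,p(n))) = H) = π^(e(H)) · (1−π)^(C(n,r)−e(H)) · p^(−t(H)) · e^(−Λ'(n,r) + δ) for some real δ with |δ| ≤ K·((log n)^C · n^(θ(n)) + n^(−c)). -/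
open Finset
open scoped Classical

/-- All 2-element subsets of `Fin n`: the potential edges of a graph on `[n]`. -/
def pairsUniv (n : ℕ) : Finset (Finset (Fin n)) :=
  Finset.powersetCard 2 (Finset.univ : Finset (Fin n))

/-- The probability that the random graph `G(n,p)` (identified with its edge set,
a set of 2-element subsets of `Fin n`, each present independently with probability `p`)
lies in the family `A`. -/
noncomputable def gnpProb (n : ℕ) (p : ℝ) (A : Set (Finset (Finset (Fin n)))) : ℝ :=
  ∑ G ∈ (pairsUniv n).powerset.filter (· ∈ A),
    p ^ G.card * (1 - p) ^ ((pairsUniv n).card - G.card)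

/-- The expectation of `f (G(n,p))`. -/
noncomputable def gnpExpect (n : ℕ) (p : ℝ) (f : Finset (Finset (Fin n)) → ℝ) : ℝ :=
  ∑ G ∈ (pairsUniv n).powerset,
    p ^ G.card * (1 - p) ^ ((pairsUniv n).card - G.card) * f G

/-- The `r`-uniform hypergraph `H_r(G)` on `[n]` whose hyperedges are the `r`-element
vertex sets inducing a clique of the graph `G`. -/
def cliqueHyp (n r : ℕ) (G : Finset (Finset (Fin n))) : Finset (Finset (Fin n)) :=
  (Finset.powersetCard r (Finset.univ : Finset (Fin n))).filter
    (fun S => Finset.powersetCard 2 S ⊆ G)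

/-- The graph `G(H)` whose edges are the vertex pairs contained in some hyperedge of `H`. -/
def hypGraph (n : ℕ) (H : Finset (Finset (Fin n))) : Finset (Finset (Fin n)) :=
  (pairsUniv n).filter (fun e => ∃ h ∈ H, e ⊆ h)

/-- `t(H) = C(r,2)·e(H) − e(G(H))`. -/
def tHyp (n r : ℕ) (H : Finset (Finset (Fin n))) : ℤ :=
  (r.choose 2 : ℤ) * H.card - ((hypGraph n H).card : ℤ)

/-- `μ_r = C(n,r)·p^(C(r,2))`, the expected number of copies of `K_r` in `G(n,p)`. -/
noncomputable def muR (n r : ℕ) (p : ℝ) : ℝ := (n.choose r : ℝ) * p ^ r.choose 2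

/-- `Λ'(n,r)`: the `s = 2` term of `Λ(n,r)`. -/
noncomputable def LamP (n r : ℕ) (p : ℝ) : ℝ :=
  (1/2) * (n.choose r : ℝ) * (r.choose 2 : ℝ) * ((n - r).choose (r - 2) : ℝ) *
    p ^ (2 * r.choose 2) * (p⁻¹ - 1)



/-! ### Weighted sums over subsets of a ground set -/

/-- expectation over the random subset of `E`. -/
noncomputable def ex {α : Type*} (E : Finset α) (p : ℝ) (φ : Finset α → ℝ) : ℝ :=
  ∑ G ∈ E.powerset, p ^ G.card * (1 - p) ^ (E.card - G.card) * φ G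

section exlemmas
variable {α : Type*}

lemma ex_add (E : Finset α) (p : ℝ) (φ ψ : Finset α → ℝ) :
    ex E p (fun G => φ G + ψ G) = ex E p φ + ex E p ψ := by
  simp [ex, mul_add, Finset.sum_add_distrib]

lemma ex_sub (E : Finset α) (p : ℝ) (φ ψ : Finset α → ℝ) :
    ex E p (fun G => φ G - ψ G) = ex E p φ - ex E p ψ := by
  simp [ex, mul_sub, Finset.sum_sub_distrib]

lemma ex_mul (E : Finset α) (p c : ℝ) (φ : Finset α → ℝ) :
    ex E p (fun G => c * φ G) = c * ex E p φ := by
  simp only [ex, Finset.mul_sum]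
  exact Finset.sum_congr rfl fun _ _ => by ring

lemma ex_sum {ι : Type*} (E : Finset α) (p : ℝ) (s : Finset ι) (φ : ι → Finset α → ℝ) :
    ex E p (fun G => ∑ i ∈ s, φ i G) = ∑ i ∈ s, ex E p (φ i) := by
  simp only [ex, Finset.mul_sum]
  exact Finset.sum_comm

lemma ex_congr (E : Finset α) (p : ℝ) (φ ψ : Finset α → ℝ) (h : ∀ G, G ⊆ E → φ G = ψ G) :
    ex E p φ = ex E p ψ := by
  simp only [ex]
  exact Finset.sum_congr rfl fun G hG => by rw [h G (Finset.mem_powerset.1 hG)]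

lemma ex_mono (E : Finset α) {p : ℝ} (hp0 : 0 ≤ p) (hp1 : p ≤ 1) (φ ψ : Finset α → ℝ)
    (h : ∀ G, G ⊆ E → φ G ≤ ψ G) : ex E p φ ≤ ex E p ψ := by
  simp only [ex]
  refine Finset.sum_le_sum fun G hG => ?_
  have h1 : 0 ≤ 1 - p := by linarith
  exact mul_le_mul_of_nonneg_left (h G (Finset.mem_powerset.1 hG)) (by positivity)

lemma ex_nonneg (E : Finset α) {p : ℝ} (hp0 : 0 ≤ p) (hp1 : p ≤ 1) (φ : Finset α → ℝ)
    (h : ∀ G, G ⊆ E → 0 ≤ φ G) : 0 ≤ ex E p φ := by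
  simp only [ex]
  refine Finset.sum_nonneg fun G hG => ?_
  have h1 : 0 ≤ 1 - p := by linarith
  exact mul_nonneg (by positivity) (h G (Finset.mem_powerset.1 hG))

lemma ex_insert [DecidableEq α] (E : Finset α) (p : ℝ) (e : α) (he : e ∉ E) (φ : Finset α → ℝ) :
    ex (insert e E) p φ = (1 - p) * ex E p φ + p * ex E p (fun G => φ (insert e G)) := by
  simp only [ex, Finset.sum_powerset_insert he, Finset.mul_sum, Finset.card_insert_of_notMem he]
  congr 1
  · refine Finset.sum_congr rfl fun G hG => ?_
    have := Finset.card_le_card (Finset.mem_powerset.1 hG)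
    rw [Nat.succ_sub this, pow_succ]; ring
  · refine Finset.sum_congr rfl fun G hG => ?_
    have h1 : e ∉ G := fun h => he (Finset.mem_powerset.1 hG h)
    rw [Finset.card_insert_of_notMem h1, Nat.add_sub_add_right, pow_succ]; ring

lemma ex_one [DecidableEq α] (E : Finset α) (p : ℝ) : ex E p (fun _ => 1) = 1 := by
  induction E using Finset.induction_on with
  | empty => simp [ex]
  | insert e E he ih => rw [ex_insert E p e he, ih]; ring

lemma ex_const [DecidableEq α] (E : Finset α) (p c : ℝ) : ex E p (fun _ => c) = c := by
  have := ex_mul E p c (fun _ => 1)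
  simpa [ex_one] using this

lemma ex_mem [DecidableEq α] (E : Finset α) (p : ℝ) (e : α) (he : e ∈ E) (φ : Finset α → ℝ) :
    ex E p (fun G => if e ∈ G then φ G else 0) = p * ex E p (fun G => φ (insert e G)) := by
  obtain ⟨E', he', rfl⟩ : ∃ E', e ∉ E' ∧ E = insert e E' :=
    ⟨E.erase e, by simp, (Finset.insert_erase he).symm⟩
  rw [ex_insert _ _ _ he', ex_insert _ _ _ he']
  have h1 : ex E' p (fun G => if e ∈ G then φ G else 0) = 0 := by
    rw [ex_congr E' p _ (fun _ => 0), ex_const]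
    intro G hG
    have : e ∉ G := fun h => he' (hG h)
    simp [this]
  have h2 : ex E' p (fun G => φ (insert e (insert e G))) = ex E' p (fun G => φ (insert e G)) := by
    simp
  rw [h1, h2]
  simp only [Finset.mem_insert_self, if_true]
  ring

/-- planting a set `F`. -/
lemma ex_subset [DecidableEq α] (E : Finset α) (p : ℝ) (F : Finset α) (hF : F ⊆ E)
    (φ : Finset α → ℝ) :
    ex E p (fun G => if F ⊆ G then φ G else 0) = p ^ F.card * ex E p (fun G => φ (G ∪ F)) := by
  induction F using Finset.induction_on generalizing φ with
  | empty => simp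
  | insert e F he ih =>
    have hF' : F ⊆ E := fun x hx => hF (Finset.mem_insert_of_mem hx)
    have heE : e ∈ E := hF (Finset.mem_insert_self _ _)
    have h1 : ex E p (fun G => if insert e F ⊆ G then φ G else 0)
        = ex E p (fun G => if F ⊆ G then (if e ∈ G then φ G else 0) else 0) := by
      apply ex_congr
      intro G _
      by_cases h1 : e ∈ G <;> by_cases h2 : F ⊆ G <;> simp [h1, h2, Finset.insert_subset_iff]
    rw [h1, ih hF' (fun G => if e ∈ G then φ G else 0), Finset.card_insert_of_notMem he]
    have h2 : ex E p (fun G => if e ∈ G ∪ F then φ (G ∪ F) else 0)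
        = ex E p (fun G => if e ∈ G then φ (G ∪ F) else 0) := by
      apply ex_congr
      intro G _
      simp [he]
    rw [h2, ex_mem E p e heE (fun G => φ (G ∪ F)), pow_succ, mul_assoc]
    congr 3
    funext G
    congr 1
    ext x; simp only [Finset.mem_union, Finset.mem_insert]; tauto

lemma ex_subset_one [DecidableEq α] (E : Finset α) (p : ℝ) (F : Finset α) (hF : F ⊆ E) :
    ex E p (fun G => if F ⊆ G then 1 else 0) = p ^ F.card := by
  rw [ex_subset E p F hF (fun _ => 1), ex_one, mul_one]

/-! ### Second order Janson inequality -/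

/-- indicator of no set of the family contained in G. -/
noncomputable def noA {ι : Type*} (f : ι → Finset α) (s : Finset ι) (G : Finset α) : ℝ :=
  if ∀ j ∈ s, ¬ f j ⊆ G then 1 else 0

lemma noA_nonneg {ι : Type*} (f : ι → Finset α) (s : Finset ι) (G : Finset α) :
    0 ≤ noA f s G := by unfold noA; split_ifs <;> norm_num

lemma noA_anti {ι : Type*} (f : ι → Finset α) (s : Finset ι) {G G' : Finset α} (h : G ⊆ G') :
    noA f s G' ≤ noA f s G := by
  unfold noA
  split_ifs with h1 h2 <;> try norm_num
  exact h2 fun j hj hh => h1 j hj (hh.trans h)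

/-- pair weight -/
noncomputable def cW [DecidableEq α] {ι : Type*} (f : ι → Finset α) (p y : ℝ) (i j : ι) : ℝ :=
  if (f i ∩ f j).card = 0 then 0
  else if (f i ∩ f j).card = 1 then p ^ (f i ∪ f j).card * (1 - p + p * y)
  else p ^ (f i ∪ f j).card

lemma cW_symm [DecidableEq α] {ι : Type*} (f : ι → Finset α) (p y : ℝ) (i j : ι) :
    cW f p y i j = cW f p y j i := by
  unfold cW; rw [Finset.inter_comm, Finset.union_comm]

lemma noA_union_lower [DecidableEq α] {ι : Type*} (f : ι → Finset α) (s : Finset ι)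
    (G F : Finset α) :
    noA f s G - ∑ j ∈ s, (if f j ⊆ G ∪ F then noA f s G else 0) ≤ noA f s (G ∪ F) := by
  by_cases h : ∀ j ∈ s, ¬ f j ⊆ G ∪ F
  · have : noA f s (G ∪ F) = 1 := by unfold noA; rw [if_pos h]
    rw [this]
    have h2 : noA f s G ≤ 1 := by unfold noA; split_ifs <;> norm_num
    have h3 : 0 ≤ ∑ j ∈ s, (if f j ⊆ G ∪ F then noA f s G else 0) :=
      Finset.sum_nonneg fun j _ => by split_ifs; exacts [noA_nonneg _ _ _, le_rfl]
    linarith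
  · push Not at h
    obtain ⟨j, hj, hjs⟩ := h
    have h1 : noA f s G ≤ ∑ j ∈ s, (if f j ⊆ G ∪ F then noA f s G else 0) := by
      have := Finset.single_le_sum (s := s) (f := fun j => if f j ⊆ G ∪ F then noA f s G else 0)
        (fun j _ => by split_ifs; exacts [noA_nonneg _ _ _, le_rfl]) hj
      simpa [hjs] using this
    have := noA_nonneg f s (G ∪ F)
    linarith

lemma ex_noA_plant_le [DecidableEq α] {ι : Type*} (E : Finset α) {p : ℝ} (hp0 : 0 < p)
    (hp1 : p < 1) (f : ι → Finset α) (s : Finset ι) (F : Finset α) (hF : F ⊆ E) :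
    ex E p (fun G => if F ⊆ G then noA f s G else 0) ≤ p ^ F.card * ex E p (noA f s) := by
  rw [ex_subset E p F hF]
  refine mul_le_mul_of_nonneg_left ?_ (by positivity)
  exact ex_mono E hp0.le hp1.le _ _ fun G _ => noA_anti f s Finset.subset_union_left

/-- P(e not in G, NoA) ≤ (1-p+py) P(NoA). -/
lemma ex_notMem_le [DecidableEq α] {ι : Type*} (E : Finset α) {p : ℝ} (hp0 : 0 < p)
    (hp1 : p < 1) (f : ι → Finset α) (s : Finset ι) (hf : ∀ j ∈ s, f j ⊆ E) (y : ℝ)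
    (e : α) (he : e ∈ E)
    (hy : ∑ j ∈ s with e ∈ f j, p ^ ((f j).card - 1) ≤ y) :
    ex E p (fun G => if e ∉ G then noA f s G else 0) ≤ (1 - p + p * y) * ex E p (noA f s) := by
  have hQ : 0 ≤ ex E p (noA f s) := ex_nonneg E hp0.le hp1.le _ fun G _ => noA_nonneg _ _ _
  have h1 : ex E p (noA f s) = ex E p (fun G => if e ∉ G then noA f s G else 0)
      + ex E p (fun G => if e ∈ G then noA f s G else 0) := by
    rw [← ex_add]; apply ex_congr; intro G _; by_cases h : e ∈ G <;> simp [h]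
  have h2 := ex_mem E p e he (noA f s)
  have h3 : ex E p (noA f s) - ∑ j ∈ s with e ∈ f j, p ^ ((f j).card - 1) * ex E p (noA f s)
      ≤ ex E p (fun G => noA f s (insert e G)) := by
    calc _ ≤ ex E p (fun G => noA f s G - ∑ j ∈ s, (if f j ⊆ G ∪ {e} then noA f s G else 0)) := by
          rw [ex_sub, ex_sum]
          refine sub_le_sub_left ?_ _
          rw [Finset.sum_filter]
          refine Finset.sum_le_sum fun j hj => ?_
          by_cases hej : e ∈ f j
          · rw [if_pos hej]
            have := ex_noA_plant_le E hp0 hp1 f s ((f j).erase e)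
              ((Finset.erase_subset _ _).trans (hf j hj))
            rw [Finset.card_erase_of_mem hej] at this
            refine le_trans (ex_mono E hp0.le hp1.le _ _ fun G _ => ?_) this
            by_cases hh : f j ⊆ G ∪ {e}
            · have : (f j).erase e ⊆ G := by
                intro x hx
                have := hh (Finset.mem_of_mem_erase hx)
                have h3 := Finset.ne_of_mem_erase hx
                simpa [h3] using this
              rw [if_pos hh, if_pos this]
            · rw [if_neg hh]; split_ifs; exacts [noA_nonneg _ _ _, le_rfl]
          · rw [if_neg hej, ex_congr E p _ (fun _ => 0), ex_const]
            intro G _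
            by_cases hh : f j ⊆ G ∪ {e}
            · rw [if_pos hh]
              have : f j ⊆ G := by
                intro x hx
                have h4 := hh hx
                have h5 : x ≠ e := by rintro rfl; exact hej hx
                simpa [h5] using h4
              unfold noA
              rw [if_neg]
              intro h; exact h j hj this
            · rw [if_neg hh]
      _ ≤ _ := by
          refine ex_mono E hp0.le hp1.le _ _ fun G _ => ?_
          have := noA_union_lower f s G {e}
          have h9 : G ∪ {e} = insert e G := by rw [Finset.union_comm, Finset.insert_eq]
          rw [h9] at this ⊢
          exact this
  rw [← Finset.sum_mul] at h3
  have h4 := mul_le_mul_of_nonneg_right hy hQ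
  nlinarith

/-- one step -/
lemma janson_step [DecidableEq α] {ι : Type*} [DecidableEq ι] (E : Finset α) {p : ℝ} (hp0 : 0 < p)
    (hp1 : p < 1) (f : ι → Finset α) (s : Finset ι) (a : ι)
    (hf : ∀ j ∈ s, f j ⊆ E) (hfa : f a ⊆ E) (y : ℝ)
    (hy : ∀ e ∈ E, ∑ j ∈ s with e ∈ f j, p ^ ((f j).card - 1) ≤ y) :
    ex E p (noA f (insert a s)) ≤
      ex E p (noA f s) * Real.exp (- p ^ (f a).card + ∑ j ∈ s, cW f p y a j) := by
  have hQ : 0 ≤ ex E p (noA f s) := ex_nonneg E hp0.le hp1.le _ fun G _ => noA_nonneg _ _ _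
  have h1 : ex E p (noA f (insert a s)) = ex E p (noA f s)
      - ex E p (fun G => if f a ⊆ G then noA f s G else 0) := by
    rw [← ex_sub]; apply ex_congr; intro G _
    unfold noA
    by_cases h : f a ⊆ G <;> simp [h]
  have h2 := ex_subset E p (f a) hfa (noA f s)
  have h3 : p ^ (f a).card * ex E p (noA f s) - ∑ j ∈ s, cW f p y a j * ex E p (noA f s)
      ≤ p ^ (f a).card * ex E p (fun G => noA f s (G ∪ f a)) := by
    have h30 : ∀ j ∈ s, p ^ (f a).card * ex E p (fun G => if f j ⊆ G ∪ f a then noA f s G else 0)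
        ≤ cW f p y a j * ex E p (noA f s) := by
      intro j hj
      have hcard : (f a ∪ f j).card = (f a).card + (f j \ f a).card := by
        rw [← Finset.union_sdiff_self_eq_union, Finset.card_union_of_disjoint Finset.disjoint_sdiff]
      have hsub : ∀ G, f j ⊆ G ∪ f a → f j \ f a ⊆ G := by
        intro G hh x hx
        rw [Finset.mem_sdiff] at hx
        have := hh hx.1
        simpa [hx.2] using this
      unfold cW
      split_ifs with hc0 hc1
      · rw [ex_congr E p _ (fun _ => 0), ex_const]; · simp
        intro G _
        by_cases hh : f j ⊆ G ∪ f a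
        · rw [if_pos hh]
          have : f j ⊆ G := by
            have h4 := hsub G hh
            rw [Finset.card_eq_zero, Finset.inter_comm] at hc0
            rwa [Finset.sdiff_eq_self_iff_disjoint.2 (Finset.disjoint_iff_inter_eq_empty.2 hc0)] at h4
          unfold noA
          rw [if_neg]
          intro h; exact h j hj this
        · rw [if_neg hh]
      · obtain ⟨e, he⟩ := Finset.card_eq_one.1 hc1
        have hea : e ∈ f a ∧ e ∈ f j := by
          have : e ∈ f a ∩ f j := by rw [he]; simp
          simpa using this
        have heE : e ∈ E := hfa hea.1
        have h5 := ex_notMem_le E hp0 hp1 f s hf y e heE (hy e heE)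
        have h6 : ex E p (fun G => if f j ⊆ G ∪ f a then noA f s G else 0)
            ≤ ex E p (fun G => if f j \ f a ⊆ G then (if e ∉ G then noA f s G else 0) else 0) := by
          refine ex_mono E hp0.le hp1.le _ _ fun G _ => ?_
          by_cases hh : f j ⊆ G ∪ f a
          · rw [if_pos hh, if_pos (hsub G hh)]
            by_cases heG : e ∈ G
            · have : f j ⊆ G := by
                intro x hx
                by_cases hxa : x ∈ f a
                · have : x ∈ f a ∩ f j := Finset.mem_inter.2 ⟨hxa, hx⟩
                  rw [he, Finset.mem_singleton] at this
                  rwa [this]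
                · exact hsub G hh (Finset.mem_sdiff.2 ⟨hx, hxa⟩)
              have : noA f s G = 0 := by
                unfold noA
                rw [if_neg]
                intro h; exact h j hj this
              simp [this]
            · simp [heG]
          · rw [if_neg hh]
            split_ifs
            exacts [le_rfl, noA_nonneg _ _ _, le_rfl]
        rw [ex_subset E p (f j \ f a) (Finset.sdiff_subset.trans (hf j hj))] at h6
        have h7 : ex E p (fun G => if e ∉ G ∪ f j \ f a then noA f s (G ∪ f j \ f a) else 0)
            ≤ ex E p (fun G => if e ∉ G then noA f s G else 0) := by
          refine ex_mono E hp0.le hp1.le _ _ fun G _ => ?_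
          have : e ∈ G ∪ f j \ f a ↔ e ∈ G := by simp [hea.1]
          simp only [this]
          split_ifs
          exacts [le_rfl, noA_anti f s Finset.subset_union_left]
        rw [hcard, pow_add]
        calc _ ≤ p ^ (f a).card * (p ^ (f j \ f a).card * ((1 - p + p * y) * ex E p (noA f s))) := by
              refine mul_le_mul_of_nonneg_left (h6.trans ?_) (by positivity)
              exact mul_le_mul_of_nonneg_left (h7.trans h5) (by positivity)
          _ = _ := by ring
      · have h5 := ex_noA_plant_le E hp0 hp1 f s (f j \ f a)
          (Finset.sdiff_subset.trans (hf j hj))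
        rw [hcard, pow_add, mul_assoc]
        refine mul_le_mul_of_nonneg_left (le_trans (ex_mono E hp0.le hp1.le _ _ fun G _ => ?_) h5)
          (by positivity)
        by_cases hh : f j ⊆ G ∪ f a
        · rw [if_pos hh, if_pos (hsub G hh)]
        · rw [if_neg hh]; split_ifs; exacts [noA_nonneg _ _ _, le_rfl]
    calc _ ≤ p ^ (f a).card * ex E p (fun G => noA f s G
            - ∑ j ∈ s, (if f j ⊆ G ∪ f a then noA f s G else 0)) := by
          rw [ex_sub, ex_sum, mul_sub, Finset.mul_sum]
          exact sub_le_sub_left (Finset.sum_le_sum h30) _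
      _ ≤ _ := by
          refine mul_le_mul_of_nonneg_left ?_ (by positivity)
          exact ex_mono E hp0.le hp1.le _ _ fun G _ => noA_union_lower f s G (f a)
  rw [← Finset.sum_mul] at h3
  have h4 := Real.add_one_le_exp (- p ^ (f a).card + ∑ j ∈ s, cW f p y a j)
  have h5 := mul_le_mul_of_nonneg_left h4 hQ
  rw [h1, h2]
  linarith

lemma janson [DecidableEq α] {ι : Type*} [DecidableEq ι] (E : Finset α) {p : ℝ} (hp0 : 0 < p)
    (hp1 : p < 1) (f : ι → Finset α) (s : Finset ι)
    (hf : ∀ j ∈ s, f j ⊆ E) (y : ℝ)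
    (hy : ∀ e ∈ E, ∑ j ∈ s with e ∈ f j, p ^ ((f j).card - 1) ≤ y) :
    ex E p (noA f s) ≤ Real.exp (- ∑ i ∈ s, p ^ (f i).card
      + (1/2) * ∑ i ∈ s, ∑ j ∈ s.erase i, cW f p y i j) := by
  induction s using Finset.induction_on with
  | empty =>
    have : noA f ∅ = fun _ => (1 : ℝ) := by funext G; simp [noA]
    simp [this, ex_one]
  | insert a s ha ih =>
    have hf' : ∀ j ∈ s, f j ⊆ E := fun j hj => hf j (Finset.mem_insert_of_mem hj)
    have hy' : ∀ e ∈ E, ∑ j ∈ s with e ∈ f j, p ^ ((f j).card - 1) ≤ y := by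
      intro e he
      refine le_trans ?_ (hy e he)
      refine Finset.sum_le_sum_of_subset_of_nonneg ?_ fun _ _ _ => by positivity
      exact Finset.filter_subset_filter _ (Finset.subset_insert _ _)
    have h1 := janson_step E hp0 hp1 f s a hf' (hf a (Finset.mem_insert_self _ _)) y hy'
    refine h1.trans ?_
    refine (mul_le_mul_of_nonneg_right (ih hf' hy') (Real.exp_pos _).le).trans ?_
    rw [← Real.exp_add]
    refine le_of_eq ?_
    congr 1
    rw [Finset.sum_insert ha, Finset.sum_insert ha, Finset.erase_insert ha]
    have h2 : ∑ i ∈ s, ∑ j ∈ (insert a s).erase i, cW f p y i j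
        = ∑ i ∈ s, ∑ j ∈ s.erase i, cW f p y i j + ∑ j ∈ s, cW f p y a j := by
      rw [← Finset.sum_add_distrib]
      refine Finset.sum_congr rfl fun i hi => ?_
      have hia : i ≠ a := by rintro rfl; exact ha hi
      rw [Finset.erase_insert_of_ne hia.symm, Finset.sum_insert (by simp [ha]), cW_symm f p y a i]
      ring
    rw [h2]; ring

end exlemmas


/-! ### Combinatorics of r-sets -/

/-- the r-subsets -/
def rsets (n r : ℕ) : Finset (Finset (Fin n)) := Finset.powersetCard r Finset.univ

/-- pairs within S -/
def ed {n : ℕ} (S : Finset (Fin n)) : Finset (Finset (Fin n)) := Finset.powersetCard 2 S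

lemma mem_rsets {n r : ℕ} {S : Finset (Fin n)} : S ∈ rsets n r ↔ S.card = r := by
  simp [rsets]

lemma card_rsets (n r : ℕ) : (rsets n r).card = n.choose r := by
  simp [rsets]

lemma ed_sub {n : ℕ} (S : Finset (Fin n)) : ed S ⊆ pairsUniv n := by
  intro e he
  simp only [ed, pairsUniv, Finset.mem_powersetCard] at he ⊢
  exact ⟨Finset.subset_univ _, he.2⟩

lemma card_ed {n : ℕ} (S : Finset (Fin n)) : (ed S).card = S.card.choose 2 := by
  simp [ed]

lemma ed_inter {n : ℕ} (S T : Finset (Fin n)) : ed S ∩ ed T = ed (S ∩ T) := by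
  ext e
  simp only [ed, Finset.mem_inter, Finset.mem_powersetCard, Finset.subset_inter_iff]
  tauto

lemma card_ed_union {n : ℕ} (S T : Finset (Fin n)) :
    (ed S ∪ ed T).card + (S ∩ T).card.choose 2 = S.card.choose 2 + T.card.choose 2 := by
  rw [← card_ed S, ← card_ed T, ← card_ed (S ∩ T), ← ed_inter, Finset.card_union_add_card_inter]

lemma mem_cliqueHyp {n r : ℕ} {G : Finset (Finset (Fin n))} {S : Finset (Fin n)} :
    S ∈ cliqueHyp n r G ↔ S ∈ rsets n r ∧ ed S ⊆ G := by
  simp [cliqueHyp, rsets, ed]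

lemma cliqueHyp_sub (n r : ℕ) (G : Finset (Finset (Fin n))) : cliqueHyp n r G ⊆ rsets n r :=
  fun _ h => (mem_cliqueHyp.1 h).1

lemma card_inter_eq {n r : ℕ} (S : Finset (Fin n)) (hS : S ∈ rsets n r) (s : ℕ) (hs : s ≤ r) :
    ((rsets n r).filter (fun T => (S ∩ T).card = s)).card
      = r.choose s * (n - r).choose (r - s) := by
  rw [mem_rsets] at hS
  have hc : Sᶜ.card = n - r := by rw [Finset.card_compl, Fintype.card_fin, hS]
  rw [← hS, ← Finset.card_powersetCard s S, hS, ← hc, ← Finset.card_powersetCard (r - s) Sᶜ,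
    ← Finset.card_product]
  refine Finset.card_bij' (fun T _ => (S ∩ T, Sᶜ ∩ T)) (fun q _ => q.1 ∪ q.2) ?_ ?_ ?_ ?_
  · intro T hT
    simp only [Finset.mem_filter, mem_rsets] at hT
    simp only [Finset.mem_product, Finset.mem_powersetCard]
    refine ⟨⟨Finset.inter_subset_left, hT.2⟩, Finset.inter_subset_left, ?_⟩
    have : (S ∩ T).card + (Sᶜ ∩ T).card = T.card := by
      rw [← Finset.card_union_of_disjoint]
      · congr 1; rw [← Finset.union_inter_distrib_right]; simp
      · exact Finset.disjoint_of_subset_left Finset.inter_subset_left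
          (Finset.disjoint_of_subset_right Finset.inter_subset_left disjoint_compl_right)
    omega
  · intro q hq
    simp only [Finset.mem_product, Finset.mem_powersetCard] at hq
    obtain ⟨⟨h1, h2⟩, h3, h4⟩ := hq
    have hd : Disjoint q.1 q.2 := Finset.disjoint_of_subset_left h1
      (Finset.disjoint_of_subset_right h3 disjoint_compl_right)
    simp only [Finset.mem_filter, mem_rsets]
    refine ⟨by rw [Finset.card_union_of_disjoint hd]; omega, ?_⟩
    rw [Finset.inter_union_distrib_left, Finset.inter_eq_right.2 h1,
      Finset.disjoint_iff_inter_eq_empty.1 (Finset.disjoint_of_subset_right h3 disjoint_compl_right),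
      Finset.union_empty, h2]
  · intro T _
    rw [← Finset.union_inter_distrib_right]; simp
  · intro q hq
    simp only [Finset.mem_product, Finset.mem_powersetCard] at hq
    obtain ⟨⟨h1, h2⟩, h3, h4⟩ := hq
    ext x
    · simp only [Finset.mem_inter, Finset.mem_union]
      constructor
      · rintro ⟨ha, hb | hb⟩
        · exact hb
        · exact absurd ha (Finset.mem_compl.1 (h3 hb))
      · intro hx; exact ⟨h1 hx, Or.inl hx⟩
    · simp only [Finset.mem_inter, Finset.mem_union, Finset.mem_compl]
      constructor
      · rintro ⟨ha, hb | hb⟩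
        · exact absurd (h1 hb) ha
        · exact hb
      · intro hx; exact ⟨Finset.mem_compl.1 (h3 hx), Or.inr hx⟩

lemma card_supset {n r : ℕ} (A : Finset (Fin n)) (hA : A.card ≤ r) :
    ((rsets n r).filter (fun T => A ⊆ T)).card = (n - A.card).choose (r - A.card) := by
  have hc : Aᶜ.card = n - A.card := by rw [Finset.card_compl, Fintype.card_fin]
  rw [← hc, ← Finset.card_powersetCard (r - A.card) Aᶜ]
  refine Finset.card_bij' (fun T _ => T \ A) (fun q _ => q ∪ A) ?_ ?_ ?_ ?_
  · intro T hT
    simp only [Finset.mem_filter, mem_rsets] at hT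
    simp only [Finset.mem_powersetCard]
    refine ⟨fun x hx => by simpa using (Finset.mem_sdiff.1 hx).2, ?_⟩
    rw [Finset.card_sdiff_of_subset hT.2, hT.1]
  · intro q hq
    simp only [Finset.mem_powersetCard] at hq
    simp only [Finset.mem_filter, mem_rsets]
    have hd : Disjoint q A := Finset.disjoint_of_subset_left hq.1 disjoint_compl_left
    refine ⟨by rw [Finset.card_union_of_disjoint hd]; omega, Finset.subset_union_right⟩
  · intro T hT
    simp only [Finset.mem_filter, mem_rsets] at hT
    exact Finset.sdiff_union_of_subset hT.2
  · intro q hq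
    simp only [Finset.mem_powersetCard] at hq
    have hd : Disjoint q A := Finset.disjoint_of_subset_left hq.1 disjoint_compl_left
    exact Finset.union_sdiff_cancel_right hd

lemma card_three {n r : ℕ} (S : Finset (Fin n)) (hS : S ∈ rsets n r) (hr : 3 ≤ r) :
    ((rsets n r).filter (fun T => 3 ≤ (T ∩ S).card)).card
      ≤ r.choose 3 * (n - 3).choose (r - 3) := by
  rw [mem_rsets] at hS
  have : (rsets n r).filter (fun T => 3 ≤ (T ∩ S).card) ⊆
      (Finset.powersetCard 3 S).biUnion (fun A => (rsets n r).filter (fun T => A ⊆ T)) := by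
    intro T hT
    rw [Finset.mem_filter] at hT
    obtain ⟨A, hA, hA3⟩ := Finset.exists_subset_card_eq hT.2
    rw [Finset.mem_biUnion]
    refine ⟨A, ?_, ?_⟩
    · rw [Finset.mem_powersetCard]; exact ⟨hA.trans Finset.inter_subset_right, hA3⟩
    · rw [Finset.mem_filter]; exact ⟨hT.1, hA.trans Finset.inter_subset_left⟩
  refine (Finset.card_le_card this).trans ?_
  refine Finset.card_biUnion_le.trans ?_
  rw [← hS, ← Finset.card_powersetCard 3 S, hS, ← smul_eq_mul]
  refine Finset.sum_le_card_nsmul _ _ _ ?_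
  intro A hA
  rw [Finset.mem_powersetCard] at hA
  rw [card_supset A (by omega), hA.2]

/-! ### parameters -/

/-- π -/
noncomputable def PI (r : ℕ) (p : ℝ) : ℝ := p ^ r.choose 2

/-- number of r-sets sharing exactly 2 vertices with a given one -/
noncomputable def N2 (n r : ℕ) : ℝ := (r.choose 2 : ℝ) * ((n - r).choose (r - 2) : ℝ)

/-- bound for number of r-sets sharing at least 3 vertices with a given one -/
noncomputable def N3 (n r : ℕ) : ℝ := (r.choose 3 : ℝ) * ((n - 3).choose (r - 3) : ℝ)

noncomputable def lam (n r : ℕ) (p : ℝ) : ℝ := PI r p * N2 n r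

lemma LamP_eq (n r : ℕ) (p : ℝ) : LamP n r p = (1/2) * muR n r p * lam n r p * (p⁻¹ - 1) := by
  unfold LamP muR lam N2 PI
  rw [two_mul, pow_add]; ring

/-- expected number of ordered pairs sharing at least three vertices -/
noncomputable def Del3 (n r : ℕ) (p : ℝ) : ℝ :=
  ∑ S ∈ rsets n r, ∑ T ∈ rsets n r,
    if T ≠ S ∧ 3 ≤ (S ∩ T).card then p ^ (ed S ∪ ed T).card else 0

lemma sum_N2 {n r : ℕ} (hr : 2 ≤ r) (S : Finset (Fin n)) (hS : S ∈ rsets n r) (c : ℝ) :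
    ∑ T ∈ rsets n r, (if (S ∩ T).card = 2 then c else 0) = N2 n r * c := by
  rw [← Finset.sum_filter, Finset.sum_const, card_inter_eq S hS 2 hr, N2, nsmul_eq_mul]
  push_cast; ring

/-- number of elements of H sharing exactly two vertices with S -/
noncomputable def dH {n : ℕ} (H : Finset (Finset (Fin n))) (S : Finset (Fin n)) : ℝ :=
  ∑ h ∈ H, if (S ∩ h).card = 2 then 1 else 0

/-- ordered pairs of elements of H both sharing exactly two vertices with S -/
noncomputable def triH {n : ℕ} (H : Finset (Finset (Fin n))) (S : Finset (Fin n)) : ℝ :=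
  ∑ h ∈ H, ∑ h' ∈ H, if h ≠ h' ∧ (S ∩ h).card = 2 ∧ (S ∩ h').card = 2 then 1 else 0

lemma dH_eq {n : ℕ} (H : Finset (Finset (Fin n))) (S : Finset (Fin n)) :
    dH H S = ((H.filter (fun h => (S ∩ h).card = 2)).card : ℝ) := by
  simp [dH]

lemma dH_nonneg {n : ℕ} (H : Finset (Finset (Fin n))) (S : Finset (Fin n)) : 0 ≤ dH H S := by
  rw [dH_eq]; positivity

lemma triH_nonneg {n : ℕ} (H : Finset (Finset (Fin n))) (S : Finset (Fin n)) : 0 ≤ triH H S := by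
  unfold triH
  exact Finset.sum_nonneg fun _ _ => Finset.sum_nonneg fun _ _ => by split_ifs <;> norm_num

lemma triH_eq {n : ℕ} (H : Finset (Finset (Fin n))) (S : Finset (Fin n)) :
    triH H S = dH H S * (dH H S - 1) := by
  have h1 : ∀ h ∈ H, (∑ h' ∈ H, if h ≠ h' ∧ (S ∩ h).card = 2 ∧ (S ∩ h').card = 2 then (1:ℝ) else 0)
      = (if (S ∩ h).card = 2 then 1 else 0) * (dH H S - 1) := by
    intro h hh
    split_ifs with h2
    · rw [one_mul, dH, ← Finset.add_sum_erase H (fun h => if (S ∩ h).card = 2 then (1:ℝ) else 0) hh,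
        ← Finset.add_sum_erase H (fun h' => if h ≠ h' ∧ (S ∩ h).card = 2 ∧ (S ∩ h').card = 2
          then (1:ℝ) else 0) hh]
      simp only [ne_eq, not_true_eq_false, false_and, if_false, zero_add, h2, if_true, add_sub_cancel_left]
      refine Finset.sum_congr rfl fun h' hh' => ?_
      have := Finset.ne_of_mem_erase hh'
      simp [this.symm]
    · simp [h2]
  unfold triH
  rw [Finset.sum_congr rfl h1, ← Finset.sum_mul]
  rfl

lemma sum_dH {n r : ℕ} (hr : 2 ≤ r) (H : Finset (Finset (Fin n))) (hH : H ⊆ rsets n r) :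
    ∑ S ∈ rsets n r, dH H S = H.card * N2 n r := by
  unfold dH
  rw [Finset.sum_comm]
  rw [Finset.sum_congr rfl (g := fun _ => N2 n r)]
  · simp
  · intro h hh
    have := sum_N2 hr h (hH hh) 1
    rw [mul_one] at this
    rw [← this]
    exact Finset.sum_congr rfl fun T _ => by rw [Finset.inter_comm]


lemma gnpProb_eq_ex (n : ℕ) (p : ℝ) (A : Set (Finset (Finset (Fin n)))) :
    gnpProb n p A = ex (pairsUniv n) p (fun G => if G ∈ A then 1 else 0) := by
  unfold gnpProb ex
  rw [Finset.sum_filter]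
  exact Finset.sum_congr rfl fun G _ => by by_cases h : G ∈ A <;> simp [h]

lemma mem_hypGraph {n : ℕ} {H : Finset (Finset (Fin n))} {e : Finset (Fin n)} :
    e ∈ hypGraph n H ↔ e ∈ pairsUniv n ∧ ∃ h ∈ H, e ⊆ h := by
  simp [hypGraph]

lemma mem_ed {n : ℕ} {S e : Finset (Fin n)} : e ∈ ed S ↔ e ⊆ S ∧ e.card = 2 := by
  simp [ed]

lemma mem_pairs {n : ℕ} {e : Finset (Fin n)} : e ∈ pairsUniv n ↔ e.card = 2 := by
  simp [pairsUniv]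

lemma good_inter {n : ℕ} (H : Finset (Finset (Fin n))) (S : Finset (Fin n))
    (h2 : ∀ h ∈ H, (S ∩ h).card ≤ 2) (hd : dH H S ≤ 1) :
    ((ed S ∩ hypGraph n H).card : ℝ) = dH H S := by
  rw [dH_eq] at hd ⊢
  have hd' : (H.filter (fun h => (S ∩ h).card = 2)).card ≤ 1 := by exact_mod_cast hd
  congr 1
  rcases Nat.lt_or_ge (H.filter (fun h => (S ∩ h).card = 2)).card 1 with hlt | hge
  · have h0 : (H.filter (fun h => (S ∩ h).card = 2)).card = 0 := by omega
    rw [h0, Finset.card_eq_zero, Finset.eq_empty_iff_forall_notMem]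
    rw [Finset.card_eq_zero] at h0
    intro e he
    rw [Finset.mem_inter, mem_ed, mem_hypGraph] at he
    obtain ⟨⟨he1, he2⟩, -, h, hh, heh⟩ := he
    have h3 : e ⊆ S ∩ h := Finset.subset_inter he1 heh
    have h4 := Finset.card_le_card h3
    have h5 := h2 h hh
    have : h ∈ H.filter (fun h => (S ∩ h).card = 2) := Finset.mem_filter.2 ⟨hh, by omega⟩
    rw [h0] at this
    simp at this
  · have h1 : (H.filter (fun h => (S ∩ h).card = 2)).card = 1 := by omega
    rw [h1]
    obtain ⟨h0, hh0⟩ := Finset.card_eq_one.1 h1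
    have hm : h0 ∈ H.filter (fun h => (S ∩ h).card = 2) := by rw [hh0]; simp
    rw [Finset.mem_filter] at hm
    have : ed S ∩ hypGraph n H = {S ∩ h0} := by
      ext e
      rw [Finset.mem_inter, mem_ed, mem_hypGraph, Finset.mem_singleton, mem_pairs]
      constructor
      · rintro ⟨⟨he1, he2⟩, -, h, hh, heh⟩
        have h3 : e ⊆ S ∩ h := Finset.subset_inter he1 heh
        have h4 := Finset.card_le_card h3
        have h5 := h2 h hh
        have h6 : h ∈ H.filter (fun h => (S ∩ h).card = 2) := Finset.mem_filter.2 ⟨hh, by omega⟩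
        rw [hh0, Finset.mem_singleton] at h6
        subst h6
        exact Finset.eq_of_subset_of_card_le h3 (by omega)
      · rintro rfl
        exact ⟨⟨Finset.inter_subset_left, hm.2⟩, hm.2, h0, hm.1, Finset.inter_subset_right⟩
    rw [this]; simp

lemma dH_zero_or_one {n : ℕ} (H : Finset (Finset (Fin n))) (S : Finset (Fin n)) (hd : dH H S ≤ 1) :
    dH H S = 0 ∨ dH H S = 1 := by
  rw [dH_eq] at hd ⊢
  have hd' : (H.filter (fun h => (S ∩ h).card = 2)).card ≤ 1 := by exact_mod_cast hd
  interval_cases (H.filter (fun h => (S ∩ h).card = 2)).card <;> simp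

lemma good_pow {n r : ℕ} {p : ℝ} (hp0 : 0 < p) (H : Finset (Finset (Fin n))) (S : Finset (Fin n))
    (hS : S ∈ rsets n r)
    (h2 : ∀ h ∈ H, (S ∩ h).card ≤ 2) (hd : dH H S ≤ 1) :
    p ^ (ed S \ hypGraph n H).card = PI r p * (1 + (p⁻¹ - 1) * dH H S) := by
  have h3 := good_inter H S h2 hd
  have h4 := Finset.card_sdiff_add_card_inter (ed S) (hypGraph n H)
  rw [card_ed, mem_rsets.1 hS] at h4
  unfold PI
  rw [← h4, pow_add]
  rcases dH_zero_or_one H S hd with h5 | h5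
  · rw [h5] at h3 ⊢
    have : (ed S ∩ hypGraph n H).card = 0 := by exact_mod_cast h3
    rw [this]; simp
  · rw [h5] at h3 ⊢
    have : (ed S ∩ hypGraph n H).card = 1 := by exact_mod_cast h3
    rw [this]; field_simp; ring

/-- the good family -/
noncomputable def goodF (n r : ℕ) (H : Finset (Finset (Fin n))) : Finset (Finset (Fin n)) :=
  (rsets n r).filter (fun S => (∀ h ∈ H, (S ∩ h).card ≤ 2) ∧ dH H S ≤ 1)

noncomputable def yy (n r : ℕ) (p : ℝ) : ℝ := (p⁻¹)^2 * PI r p * ((n - 2).choose (r - 2) : ℝ)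

noncomputable def E1 (n r : ℕ) (p : ℝ) (H : Finset (Finset (Fin n))) : ℝ :=
  2 * p⁻¹ * (H.card * (PI r p * N3 n r) + PI r p * ∑ S ∈ rsets n r, triH H S)
    + (1/2) * yy n r p * muR n r p * lam n r p
    + (p⁻¹ + yy n r p) * (p⁻¹)^2 * (lam n r p)^2 * H.card
    + (1/2) * (1 + yy n r p) * (p⁻¹)^2 * Del3 n r p

lemma PI_pos {r : ℕ} {p : ℝ} (hp0 : 0 < p) : 0 < PI r p := by unfold PI; positivity

lemma yy_nonneg {n r : ℕ} {p : ℝ} (hp0 : 0 < p) : 0 ≤ yy n r p := by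
  have := PI_pos (r := r) hp0
  unfold yy; positivity

lemma sum_good_lower {n r : ℕ} {p : ℝ} (hp0 : 0 < p) (hp1 : p < 1) (hr : 3 ≤ r)
    (H : Finset (Finset (Fin n))) (hH : H ⊆ rsets n r) :
    muR n r p + (p⁻¹ - 1) * lam n r p * H.card
      - 2 * p⁻¹ * (H.card * (PI r p * N3 n r) + PI r p * ∑ S ∈ rsets n r, triH H S)
      ≤ ∑ S ∈ goodF n r H, PI r p * (1 + (p⁻¹ - 1) * dH H S) := by
  have hπ := PI_pos (r := r) hp0
  have hu : 1 ≤ p⁻¹ := (one_le_inv₀ hp0).2 hp1.le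
  have hall : ∑ S ∈ rsets n r, PI r p * (1 + (p⁻¹ - 1) * dH H S)
      = muR n r p + (p⁻¹ - 1) * lam n r p * H.card := by
    rw [← Finset.mul_sum, Finset.sum_add_distrib, ← Finset.mul_sum, sum_dH (by omega) H hH]
    simp only [Finset.sum_const, card_rsets, nsmul_eq_mul, muR, lam]
    unfold PI; ring
  have hsplit := Finset.sum_filter_add_sum_filter_not (rsets n r)
    (fun S => (∀ h ∈ H, (S ∩ h).card ≤ 2) ∧ dH H S ≤ 1)
    (fun S => PI r p * (1 + (p⁻¹ - 1) * dH H S))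
  have hbad : ∑ S ∈ rsets n r with ¬ ((∀ h ∈ H, (S ∩ h).card ≤ 2) ∧ dH H S ≤ 1),
      PI r p * (1 + (p⁻¹ - 1) * dH H S)
      ≤ ∑ S ∈ rsets n r, 2 * p⁻¹ * PI r p * ((∑ h ∈ H, if 3 ≤ (S ∩ h).card then (1:ℝ) else 0)
        + triH H S) := by
    have hnn : ∀ S, 0 ≤ (∑ h ∈ H, if 3 ≤ (S ∩ h).card then (1:ℝ) else 0) := fun S =>
      Finset.sum_nonneg fun _ _ => by split_ifs <;> norm_num
    refine le_trans (Finset.sum_le_sum (g := fun S => 2 * p⁻¹ * PI r p *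
        ((∑ h ∈ H, if 3 ≤ (S ∩ h).card then (1:ℝ) else 0) + triH H S)) ?_)
      (Finset.sum_le_sum_of_subset_of_nonneg (Finset.filter_subset _ _) fun S _ _ => ?_)
    · intro S hS
      rw [Finset.mem_filter] at hS
      have hd0 := dH_nonneg H S
      have h1 : PI r p * (1 + (p⁻¹ - 1) * dH H S) ≤ p⁻¹ * PI r p * (1 + dH H S) := by
        have : 1 + (p⁻¹ - 1) * dH H S ≤ p⁻¹ * (1 + dH H S) := by nlinarith
        calc _ ≤ PI r p * (p⁻¹ * (1 + dH H S)) := mul_le_mul_of_nonneg_left this hπ.le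
          _ = _ := by ring
      have h2 : 1 + dH H S ≤ 2 * ((∑ h ∈ H, if 3 ≤ (S ∩ h).card then (1:ℝ) else 0) + triH H S) := by
        by_cases hd : dH H S ≤ 1
        · have : ∃ h ∈ H, 3 ≤ (S ∩ h).card := by
            by_contra hcon
            push Not at hcon
            exact hS.2 ⟨fun h hh => by have := hcon h hh; omega, hd⟩
          obtain ⟨h, hh, h3⟩ := this
          have h4 : (1:ℝ) ≤ ∑ h ∈ H, if 3 ≤ (S ∩ h).card then (1:ℝ) else 0 := by
            have := Finset.single_le_sum (s := H)
              (f := fun h => if 3 ≤ (S ∩ h).card then (1:ℝ) else 0)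
              (fun _ _ => by split_ifs <;> norm_num) hh
            simpa [h3] using this
          have := triH_nonneg H S
          linarith
        · have : (2:ℝ) ≤ dH H S := by
            rw [dH_eq] at hd ⊢
            have : 1 < (H.filter (fun h => (S ∩ h).card = 2)).card := by
              by_contra h; exact hd (by exact_mod_cast not_lt.1 h)
            exact_mod_cast this
          rw [triH_eq]
          have := hnn S
          nlinarith
      calc _ ≤ _ := h1
        _ ≤ p⁻¹ * PI r p * (2 * ((∑ h ∈ H, if 3 ≤ (S ∩ h).card then (1:ℝ) else 0) + triH H S)) :=
            mul_le_mul_of_nonneg_left h2 (by positivity)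
        _ = _ := by ring
    · have := hnn S; have := triH_nonneg H S
      positivity
  have h3 : ∑ S ∈ rsets n r, (∑ h ∈ H, if 3 ≤ (S ∩ h).card then (1:ℝ) else 0)
      ≤ H.card * N3 n r := by
    rw [Finset.sum_comm, ← nsmul_eq_mul]
    refine Finset.sum_le_card_nsmul _ _ _ fun h hh => ?_
    rw [← Finset.sum_filter, Finset.sum_const, nsmul_eq_mul, mul_one]
    have := card_three h (hH hh) hr
    unfold N3
    exact_mod_cast this
  have hre : ∑ S ∈ rsets n r, 2 * p⁻¹ * PI r p * ((∑ h ∈ H, if 3 ≤ (S ∩ h).card then (1:ℝ) else 0)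
        + triH H S) = 2 * p⁻¹ * PI r p * (∑ S ∈ rsets n r, (∑ h ∈ H, if 3 ≤ (S ∩ h).card then (1:ℝ) else 0)) + 2 * p⁻¹ * PI r p * ∑ S ∈ rsets n r, triH H S := by
    rw [← Finset.mul_sum, Finset.sum_add_distrib]; ring
  rw [hre] at hbad
  have h4 : 2 * p⁻¹ * PI r p * (∑ S ∈ rsets n r, (∑ h ∈ H, if 3 ≤ (S ∩ h).card then (1:ℝ) else 0))
      ≤ 2 * p⁻¹ * PI r p * (H.card * N3 n r) := mul_le_mul_of_nonneg_left h3 (by positivity)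
  rw [hall] at hsplit
  unfold goodF
  linarith

lemma pair_bound {n r : ℕ} {p : ℝ} (hp0 : 0 < p) (hp1 : p < 1)
    (H : Finset (Finset (Fin n))) (i j : Finset (Fin n))
    (hi : i ∈ goodF n r H) (hj : j ∈ goodF n r H) :
    cW (fun S => ed S \ hypGraph n H) p (yy n r p) i j ≤
      (if (i ∩ j).card = 2 then
        (PI r p)^2 * (p⁻¹ - 1 + yy n r p) * (1 + (p⁻¹)^2 * (dH H i + dH H j)) else 0)
      + (if 3 ≤ (i ∩ j).card then
        (1 + yy n r p) * (p⁻¹)^2 * p ^ (ed i ∪ ed j).card else 0) := by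
  have hπ := PI_pos (r := r) hp0
  have hy := yy_nonneg (n := n) (r := r) hp0
  have hu : 1 ≤ p⁻¹ := (one_le_inv₀ hp0).2 hp1.le
  unfold goodF at hi hj
  rw [Finset.mem_filter] at hi hj
  have hpi := good_pow hp0 H i hi.1 hi.2.1 hi.2.2
  have hpj := good_pow hp0 H j hj.1 hj.2.1 hj.2.2
  have hii := good_inter H i hi.2.1 hi.2.2
  have hij := good_inter H j hj.2.1 hj.2.2
  have hdi := dH_nonneg H i
  have hdj := dH_nonneg H j
  set Γ := hypGraph n H with hΓ
  have hsub : (ed i \ Γ) ∩ (ed j \ Γ) ⊆ ed (i ∩ j) := by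
    rw [← ed_inter]
    exact Finset.inter_subset_inter Finset.sdiff_subset Finset.sdiff_subset
  have hcs := Finset.card_le_card hsub
  rw [card_ed] at hcs
  rcases Nat.lt_trichotomy (i ∩ j).card 2 with hlt | heq | hgt
  · have : (i ∩ j).card.choose 2 = 0 := Nat.choose_eq_zero_of_lt hlt
    have h0 : ((ed i \ Γ) ∩ (ed j \ Γ)).card = 0 := by omega
    unfold cW
    rw [if_pos h0, if_neg (by omega), if_neg (by omega)]
    simp
  · rw [if_pos heq, if_neg (by omega), add_zero]
    rw [heq] at hcs
    have hcs' : ((ed i \ Γ) ∩ (ed j \ Γ)).card ≤ 1 := by simpa using hcs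
    have hnn : 0 ≤ (PI r p)^2 * (p⁻¹ - 1 + yy n r p) * (1 + (p⁻¹)^2 * (dH H i + dH H j)) := by
      have : 0 ≤ p⁻¹ - 1 + yy n r p := by linarith
      positivity
    unfold cW
    split_ifs with h0 h1
    · exact hnn
    · have hcu := Finset.card_union_add_card_inter (ed i \ Γ) (ed j \ Γ)
      rw [h1] at hcu
      have h2 : p ^ ((ed i \ Γ) ∪ (ed j \ Γ)).card = p⁻¹ * (p ^ (ed i \ Γ).card * p ^ (ed j \ Γ).card) := by
        rw [← pow_add, ← hcu, pow_succ]; field_simp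
      rw [h2, hpi, hpj]
      have h3 : (1 + (p⁻¹ - 1) * dH H i) * (1 + (p⁻¹ - 1) * dH H j)
          ≤ 1 + (p⁻¹)^2 * (dH H i + dH H j) := by
        have h4 : dH H i * dH H j ≤ dH H i := mul_le_of_le_one_right hdi hj.2.2
        have h5 : (p⁻¹ - 1)^2 * (dH H i * dH H j) ≤ (p⁻¹ - 1)^2 * (dH H i + dH H j) :=
          mul_le_mul_of_nonneg_left (by linarith) (sq_nonneg _)
        have h6 : (p⁻¹ - 1) + (p⁻¹ - 1)^2 ≤ (p⁻¹)^2 := by nlinarith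
        have h7 := mul_le_mul_of_nonneg_right h6 (add_nonneg hdi hdj)
        nlinarith
      have h4 : p⁻¹ * (1 - p + p * yy n r p) = p⁻¹ - 1 + yy n r p := by field_simp
      calc p⁻¹ * (PI r p * (1 + (p⁻¹ - 1) * dH H i) * (PI r p * (1 + (p⁻¹ - 1) * dH H j)))
            * (1 - p + p * yy n r p)
          = (PI r p)^2 * (p⁻¹ * (1 - p + p * yy n r p)) * ((1 + (p⁻¹ - 1) * dH H i) * (1 + (p⁻¹ - 1) * dH H j)) := by ring
        _ ≤ _ := by
          rw [h4]
          refine mul_le_mul_of_nonneg_left h3 ?_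
          have : 0 ≤ p⁻¹ - 1 + yy n r p := by linarith
          positivity
    · beta_reduce at h0 h1
      omega
  · rw [if_neg (by omega), if_pos (by omega), zero_add]
    have h1 : cW (fun S => ed S \ Γ) p (yy n r p) i j
        ≤ (1 + yy n r p) * p ^ ((ed i \ Γ) ∪ (ed j \ Γ)).card := by
      have hq : 0 < p ^ ((ed i \ Γ) ∪ (ed j \ Γ)).card := by positivity
      unfold cW
      split_ifs
      · positivity
      · rw [mul_comm]
        refine mul_le_mul_of_nonneg_right ?_ hq.le
        nlinarith
      · nlinarith
    refine h1.trans ?_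
    rw [mul_assoc]
    refine mul_le_mul_of_nonneg_left ?_ (by linarith)
    have h2 : (ed i ∪ ed j).card ≤ ((ed i \ Γ) ∪ (ed j \ Γ)).card + 2 := by
      have ha : (ed i ∩ Γ).card ≤ 1 := by
        have : ((ed i ∩ Γ).card : ℝ) ≤ 1 := by rw [hii]; exact hi.2.2
        exact_mod_cast this
      have hb : (ed j ∩ Γ).card ≤ 1 := by
        have : ((ed j ∩ Γ).card : ℝ) ≤ 1 := by rw [hij]; exact hj.2.2
        exact_mod_cast this
      have hc : ed i ∪ ed j ⊆ ((ed i \ Γ) ∪ (ed j \ Γ)) ∪ ((ed i ∩ Γ) ∪ (ed j ∩ Γ)) := by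
        intro x hx
        simp only [Finset.mem_union, Finset.mem_sdiff, Finset.mem_inter] at hx ⊢
        tauto
      have hd := Finset.card_le_card hc
      have he := Finset.card_union_le ((ed i \ Γ) ∪ (ed j \ Γ)) ((ed i ∩ Γ) ∪ (ed j ∩ Γ))
      have hf := Finset.card_union_le (ed i ∩ Γ) (ed j ∩ Γ)
      omega
    have h3 : p ^ (((ed i \ Γ) ∪ (ed j \ Γ)).card + 2) ≤ p ^ (ed i ∪ ed j).card :=
      pow_le_pow_of_le_one hp0.le hp1.le h2
    calc p ^ ((ed i \ Γ) ∪ (ed j \ Γ)).card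
        = (p⁻¹)^2 * p ^ (((ed i \ Γ) ∪ (ed j \ Γ)).card + 2) := by rw [pow_add]; field_simp
      _ ≤ _ := mul_le_mul_of_nonneg_left h3 (by positivity)

lemma goodF_sub (n r : ℕ) (H : Finset (Finset (Fin n))) : goodF n r H ⊆ rsets n r :=
  Finset.filter_subset _ _

lemma upper {n r : ℕ} {p : ℝ} (hp0 : 0 < p) (hp1 : p < 1) (hr : 3 ≤ r)
    (H : Finset (Finset (Fin n))) (hH : H ⊆ rsets n r) :
    gnpProb n p {G | cliqueHyp n r G = H} ≤ p ^ (hypGraph n H).card *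
      Real.exp (- muR n r p - (p⁻¹ - 1) * lam n r p * H.card + LamP n r p + E1 n r p H) := by
  have hπ := PI_pos (r := r) hp0
  have hy := yy_nonneg (n := n) (r := r) hp0
  have hu : 1 ≤ p⁻¹ := (one_le_inv₀ hp0).2 hp1.le
  set f : Finset (Fin n) → Finset (Finset (Fin n)) := fun S => ed S \ hypGraph n H with hf
  have hΓ : hypGraph n H ⊆ pairsUniv n := Finset.filter_subset _ _
  have step1 : gnpProb n p {G | cliqueHyp n r G = H} ≤
      p ^ (hypGraph n H).card * ex (pairsUniv n) p (noA f (goodF n r H)) := by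
    rw [gnpProb_eq_ex]
    have h1 := ex_subset (pairsUniv n) p (hypGraph n H) hΓ (noA ed (goodF n r H))
    have h2 : (fun G => noA ed (goodF n r H) (G ∪ hypGraph n H)) = noA f (goodF n r H) := by
      funext G
      have key : ∀ j : Finset (Fin n), ed j ⊆ G ∪ hypGraph n H ↔ f j ⊆ G := by
        intro j
        constructor
        · intro h x hx
          have hx' := Finset.mem_sdiff.1 hx
          exact (Finset.mem_union.1 (h hx'.1)).resolve_right hx'.2
        · intro h x hx
          by_cases hx' : x ∈ hypGraph n H
          · exact Finset.mem_union_right _ hx'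
          · exact Finset.mem_union_left _ (h (Finset.mem_sdiff.2 ⟨hx, hx'⟩))
      unfold noA
      simp only [key]
      congr
    rw [h2] at h1
    rw [← h1]
    refine ex_mono _ hp0.le hp1.le _ _ fun G _ => ?_
    by_cases hG : cliqueHyp n r G = H
    · have h3 : hypGraph n H ⊆ G := by
        intro e he
        rw [mem_hypGraph, mem_pairs] at he
        obtain ⟨he2, h, hh, heh⟩ := he
        rw [← hG, mem_cliqueHyp] at hh
        exact hh.2 (mem_ed.2 ⟨heh, he2⟩)
      have h4 : noA ed (goodF n r H) G = 1 := by
        unfold noA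
        rw [if_pos]
        intro j hj hjG
        unfold goodF at hj
        rw [Finset.mem_filter] at hj
        have : j ∈ H := by rw [← hG, mem_cliqueHyp]; exact ⟨hj.1, hjG⟩
        have h5 := hj.2.1 j this
        rw [Finset.inter_self, mem_rsets.1 hj.1] at h5
        omega
      rw [if_pos h3, h4]
      split_ifs <;> norm_num
    · have : G ∉ {G | cliqueHyp n r G = H} := hG
      rw [if_neg this]
      split_ifs
      exacts [noA_nonneg _ _ _, le_rfl]
  have step2 := janson (pairsUniv n) hp0 hp1 f (goodF n r H)
    (fun j _ => Finset.sdiff_subset.trans (ed_sub j)) (yy n r p) (by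
      intro e he
      rw [mem_pairs] at he
      have h1 : ∀ j ∈ (goodF n r H).filter (fun j => e ∈ f j),
          p ^ ((f j).card - 1) ≤ (p⁻¹)^2 * PI r p := by
        intro j hj
        rw [Finset.mem_filter] at hj
        have h2 : 1 ≤ (f j).card := Finset.card_pos.2 ⟨e, hj.2⟩
        have hj1 := hj.1
        unfold goodF at hj1
        rw [Finset.mem_filter] at hj1
        have h3 : p ^ (f j).card ≤ p⁻¹ * PI r p := by
          have := good_pow hp0 H j hj1.1 hj1.2.1 hj1.2.2
          rw [hf]; dsimp only; rw [this, mul_comm]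
          refine mul_le_mul_of_nonneg_right ?_ hπ.le
          have := dH_nonneg H j
          nlinarith [hj1.2.2]
        have h4 : p ^ ((f j).card - 1) = p⁻¹ * p ^ (f j).card := by
          obtain ⟨k, hk⟩ : ∃ k, (f j).card = k + 1 := ⟨(f j).card - 1, by omega⟩
          rw [hk, pow_succ]; simp; field_simp
        rw [h4]
        calc _ ≤ p⁻¹ * (p⁻¹ * PI r p) := mul_le_mul_of_nonneg_left h3 (by positivity)
          _ = _ := by ring
      refine (Finset.sum_le_card_nsmul _ _ _ h1).trans ?_
      have h2 : ((goodF n r H).filter (fun j => e ∈ f j)).card ≤ (n - 2).choose (r - 2) := by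
        rw [← he, ← card_supset e (by omega)]
        refine Finset.card_le_card fun j hj => ?_
        rw [Finset.mem_filter] at hj ⊢
        refine ⟨goodF_sub _ _ _ hj.1, ?_⟩
        have := (Finset.mem_sdiff.1 hj.2).1
        exact (mem_ed.1 this).1
      rw [nsmul_eq_mul, yy, mul_comm]
      refine mul_le_mul_of_nonneg_left ?_ (by positivity)
      exact_mod_cast h2)
  refine step1.trans (mul_le_mul_of_nonneg_left (step2.trans (Real.exp_le_exp.2 ?_)) (by positivity))
  have h1 := sum_good_lower hp0 hp1 hr H hH
  have h2 : ∑ i ∈ goodF n r H, p ^ (f i).card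
      = ∑ S ∈ goodF n r H, PI r p * (1 + (p⁻¹ - 1) * dH H S) := by
    refine Finset.sum_congr rfl fun i hi => ?_
    unfold goodF at hi
    rw [Finset.mem_filter] at hi
    exact good_pow hp0 H i hi.1 hi.2.1 hi.2.2
  set A : Finset (Fin n) → Finset (Fin n) → ℝ := fun i j => (if (i ∩ j).card = 2 then
        (PI r p)^2 * (p⁻¹ - 1 + yy n r p) * (1 + (p⁻¹)^2 * (dH H i + dH H j)) else 0) with hA
  set B : Finset (Fin n) → Finset (Fin n) → ℝ := fun i j => (if j ≠ i ∧ 3 ≤ (i ∩ j).card then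
        (1 + yy n r p) * (p⁻¹)^2 * p ^ (ed i ∪ ed j).card else 0) with hB
  have hAnn : ∀ i j, 0 ≤ A i j := by
    intro i j
    have h3 := dH_nonneg H i
    have h4 := dH_nonneg H j
    have : 0 ≤ p⁻¹ - 1 + yy n r p := by linarith
    simp only [hA]; split_ifs <;> positivity
  have hBnn : ∀ i j, 0 ≤ B i j := by
    intro i j
    simp only [hB]; split_ifs <;> positivity
  have h3 : ∑ i ∈ goodF n r H, ∑ j ∈ (goodF n r H).erase i, cW f p (yy n r p) i j
      ≤ ∑ i ∈ rsets n r, ∑ j ∈ rsets n r, (A i j + B i j) := by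
    have h31 : ∀ i ∈ goodF n r H, ∑ j ∈ (goodF n r H).erase i, cW f p (yy n r p) i j
        ≤ ∑ j ∈ rsets n r, (A i j + B i j) := by
      intro i hi
      refine le_trans (Finset.sum_le_sum (g := fun j => A i j + B i j) fun j hj => ?_)
        (Finset.sum_le_sum_of_subset_of_nonneg ((Finset.erase_subset _ _).trans (goodF_sub _ _ _))
          fun j _ _ => add_nonneg (hAnn i j) (hBnn i j))
      have h5 := pair_bound hp0 hp1 H i j hi (Finset.mem_of_mem_erase hj)
      have h6 := Finset.ne_of_mem_erase hj
      simp only [hA, hB, h6, ne_eq, not_false_eq_true, true_and]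
      exact h5
    refine (Finset.sum_le_sum h31).trans ?_
    refine Finset.sum_le_sum_of_subset_of_nonneg (goodF_sub _ _ _) fun i _ _ =>
      Finset.sum_nonneg fun j _ => add_nonneg (hAnn i j) (hBnn i j)
  have h4 : ∑ i ∈ rsets n r, ∑ j ∈ rsets n r, B i j
      = (1 + yy n r p) * (p⁻¹)^2 * Del3 n r p := by
    unfold Del3
    simp only [hB, Finset.mul_sum, mul_ite, mul_zero]
  have h5 : ∑ i ∈ rsets n r, ∑ j ∈ rsets n r, A i j
      = (p⁻¹ - 1 + yy n r p) * (muR n r p * lam n r p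
        + 2 * (p⁻¹)^2 * (lam n r p)^2 * H.card) := by
    have h51 : ∀ i j, A i j = (if (i ∩ j).card = 2 then
          (PI r p)^2 * (p⁻¹ - 1 + yy n r p) * (1 + (p⁻¹)^2 * dH H i) else 0)
        + (if (j ∩ i).card = 2 then
          (PI r p)^2 * (p⁻¹ - 1 + yy n r p) * ((p⁻¹)^2 * dH H j) else 0) := by
      intro i j
      simp only [hA, Finset.inter_comm j i]
      split_ifs
      · ring
      · simp
    simp only [h51, Finset.sum_add_distrib]
    rw [Finset.sum_comm (f := fun i j => (if (j ∩ i).card = 2 then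
          (PI r p)^2 * (p⁻¹ - 1 + yy n r p) * ((p⁻¹)^2 * dH H j) else 0))]
    rw [Finset.sum_congr rfl fun i hi => sum_N2 (by omega) i hi
      ((PI r p)^2 * (p⁻¹ - 1 + yy n r p) * (1 + (p⁻¹)^2 * dH H i)),
      Finset.sum_congr rfl fun i hi => sum_N2 (by omega) i hi
      ((PI r p)^2 * (p⁻¹ - 1 + yy n r p) * ((p⁻¹)^2 * dH H i))]
    rw [← Finset.mul_sum, ← Finset.mul_sum, ← Finset.mul_sum, ← Finset.mul_sum,
      Finset.sum_add_distrib, ← Finset.mul_sum, sum_dH (by omega) H hH]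
    simp only [Finset.sum_const, card_rsets, nsmul_eq_mul, muR, lam]
    unfold PI; ring
  simp only [Finset.sum_add_distrib] at h3
  rw [h4, h5] at h3
  rw [h2, LamP_eq]
  unfold E1
  have h6 : 0 ≤ (p⁻¹)^2 * (lam n r p)^2 * H.card := by positivity
  nlinarith


section seqsum
variable {ι : Type*}

/-- elements of H of smaller key than i -/
noncomputable def below (k : ι → ℕ) (H : Finset ι) (i : ι) : Finset ι := H.filter (fun h => k h < k i)

lemma below_insert [DecidableEq ι] (k : ι → ℕ) (H : Finset ι) (a i : ι) (h : k i ≤ k a) :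
    below k (insert a H) i = below k H i := by
  unfold below
  rw [Finset.filter_insert, if_neg (by omega)]

lemma below_self (k : ι → ℕ) (hk : Function.Injective k) (s H : Finset ι) (a : ι) (ha : a ∉ s)
    (hm : ∀ x ∈ s, k x ≤ k a) (hH : H ⊆ s) : below k H a = H := by
  unfold below
  rw [Finset.filter_eq_self]
  intro x hx
  have h1 := hm x (hH hx)
  have h2 : k x ≠ k a := fun h => ha (by rw [← hk h]; exact hH hx)
  omega

lemma seq_sum (k : ι → ℕ) (hk : Function.Injective k) (w : Finset ι → ι → ℝ) (π : ℝ)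
    (hπ0 : 0 ≤ π) (hw : ∀ H i, 1 ≤ w H i) (s : Finset ι) :
    ∑ H ∈ s.powerset, ∏ i ∈ s, ((if i ∈ H then π * w (below k H i) i else 1 - π)
      / (1 + π * (w (below k H i) i - 1))) = 1 := by
  induction s using Finset.induction_on_max_value k with
  | empty => simp
  | insert a s ha hm ih =>
    rw [Finset.sum_powerset_insert ha, ← Finset.sum_add_distrib]
    refine Eq.trans ?_ ih
    refine Finset.sum_congr rfl fun H hH => ?_
    rw [Finset.mem_powerset] at hH
    have haH : a ∉ H := fun h => ha (hH h)
    rw [Finset.prod_insert ha, Finset.prod_insert ha]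
    have h1 : ∀ i ∈ s, ((if i ∈ insert a H then π * w (below k (insert a H) i) i else 1 - π)
        / (1 + π * (w (below k (insert a H) i) i - 1))) = ((if i ∈ H then π * w (below k H i) i else 1 - π)
      / (1 + π * (w (below k H i) i - 1))) := by
      intro i hi
      rw [below_insert k H a i (hm i hi)]
      have : i ≠ a := fun h => ha (h ▸ hi)
      simp [this]
    rw [Finset.prod_congr rfl h1, below_insert k H a a le_rfl, below_self k hk s H a ha hm hH]
    rw [if_neg haH, if_pos (Finset.mem_insert_self _ _)]
    have h2 : 0 < 1 + π * (w H a - 1) := by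
      have := hw H a
      nlinarith [mul_nonneg hπ0 (sub_nonneg.2 this)]
    rw [← add_mul, ← add_div]
    have h3 : 1 - π + π * w H a = 1 + π * (w H a - 1) := by ring
    rw [h3, div_self h2.ne', one_mul]

lemma seq_sum_le (k : ι → ℕ) (hk : Function.Injective k) (w : Finset ι → ι → ℝ) (π : ℝ)
    (hπ0 : 0 ≤ π) (hπ1 : π ≤ 1) (hw : ∀ H i, 1 ≤ w H i) (s : Finset ι) :
    ∑ H ∈ s.powerset, π ^ H.card * (1 - π) ^ (s.card - H.card) * (∏ i ∈ H, w (below k H i) i)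
      * Real.exp (- ∑ i ∈ s, π * (w (below k H i) i - 1)) ≤ 1 := by
  refine le_of_le_of_eq ?_ (seq_sum k hk w π hπ0 hw s)
  refine Finset.sum_le_sum fun H hH => ?_
  rw [Finset.mem_powerset] at hH
  rw [Finset.prod_div_distrib, div_eq_mul_inv]
  have h1 : ∏ i ∈ s, (if i ∈ H then π * w (below k H i) i else 1 - π)
      = π ^ H.card * (1 - π) ^ (s.card - H.card) * (∏ i ∈ H, w (below k H i) i) := by
    rw [Finset.prod_ite]
    have h2 : s.filter (· ∈ H) = H := by
      ext x; simp only [Finset.mem_filter]; exact ⟨fun h => h.2, fun h => ⟨hH h, h⟩⟩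
    have h3 : s.filter (· ∉ H) = s \ H := by
      ext x; simp
    rw [h2, h3, Finset.prod_mul_distrib, Finset.prod_const, Finset.prod_const,
      Finset.card_sdiff_of_subset hH]
    ring
  rw [h1]
  have hnn : 0 ≤ π ^ H.card * (1 - π) ^ (s.card - H.card) * (∏ i ∈ H, w (below k H i) i) := by
    have h4 : 0 ≤ 1 - π := by linarith
    have h5 : 0 ≤ ∏ i ∈ H, w (below k H i) i :=
      Finset.prod_nonneg fun i _ => zero_le_one.trans (hw _ _)
    positivity
  refine mul_le_mul_of_nonneg_left ?_ hnn
  rw [Real.exp_neg]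
  have hpos : ∀ i, 0 < 1 + π * (w (below k H i) i - 1) := fun i => by
    have := mul_nonneg hπ0 (sub_nonneg.2 (hw (below k H i) i)); linarith
  refine inv_anti₀ (Finset.prod_pos fun i _ => hpos i) ?_
  rw [Real.exp_sum]
  refine Finset.prod_le_prod (fun i _ => (hpos i).le) fun i _ => ?_
  have := Real.add_one_le_exp (π * (w (below k H i) i - 1))
  linarith

end seqsum

/-- badness of i in H -/
noncomputable def badI {n : ℕ} (H : Finset (Finset (Fin n))) (i : Finset (Fin n)) : ℝ :=
  (∑ h ∈ H, if h ≠ i ∧ 3 ≤ (i ∩ h).card then 1 else 0) + triH H i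

noncomputable def badT {n : ℕ} (H : Finset (Finset (Fin n))) : ℝ := ∑ i ∈ H, badI H i

lemma badI_nonneg {n : ℕ} (H : Finset (Finset (Fin n))) (i : Finset (Fin n)) : 0 ≤ badI H i := by
  unfold badI
  exact add_nonneg (Finset.sum_nonneg fun _ _ => by split_ifs <;> norm_num) (triH_nonneg _ _)

lemma badI_mono {n : ℕ} {H H' : Finset (Finset (Fin n))} (hs : H ⊆ H') (i : Finset (Fin n)) :
    badI H i ≤ badI H' i := by
  unfold badI triH
  refine add_le_add (Finset.sum_le_sum_of_subset_of_nonneg hs fun _ _ _ => by split_ifs <;> norm_num) ?_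
  refine (Finset.sum_le_sum_of_subset_of_nonneg hs fun _ _ _ =>
    Finset.sum_nonneg fun _ _ => by split_ifs <;> norm_num).trans ?_
  exact Finset.sum_le_sum fun _ _ =>
    Finset.sum_le_sum_of_subset_of_nonneg hs fun _ _ _ => by split_ifs <;> norm_num

lemma badI_good {n : ℕ} (H : Finset (Finset (Fin n))) (i : Finset (Fin n)) (hi : i ∉ H)
    (h : badI H i < 1) : (∀ h ∈ H, (i ∩ h).card ≤ 2) ∧ dH H i ≤ 1 := by
  have hnn : ∀ h ∈ H, (0:ℝ) ≤ if h ≠ i ∧ 3 ≤ (i ∩ h).card then 1 else 0 := fun _ _ => by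
    split_ifs <;> norm_num
  have ht := triH_nonneg H i
  have hs := Finset.sum_nonneg hnn
  unfold badI at h
  constructor
  · intro h' hh'
    by_contra hcon
    have h1 := Finset.single_le_sum hnn hh'
    have h2 : h' ≠ i := fun h => hi (h ▸ hh')
    rw [if_pos ⟨h2, by omega⟩] at h1
    linarith
  · by_contra hd
    have h2 : (2:ℝ) ≤ dH H i := by
      rw [dH_eq] at hd ⊢
      have : 1 < (H.filter (fun h => (i ∩ h).card = 2)).card := by
        by_contra h; exact hd (by exact_mod_cast not_lt.1 h)
      exact_mod_cast this
    rw [triH_eq] at h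
    nlinarith

lemma hypGraph_insert {n : ℕ} (H : Finset (Finset (Fin n))) (a : Finset (Fin n)) :
    hypGraph n (insert a H) = hypGraph n H ∪ (ed a \ hypGraph n H) := by
  ext e
  simp only [Finset.mem_union, Finset.mem_sdiff, mem_hypGraph, mem_ed, mem_pairs,
    Finset.mem_insert, exists_eq_or_imp]
  by_cases h1 : e.card = 2 <;> by_cases h2 : ∃ h ∈ H, e ⊆ h <;> simp only [h1, h2] <;> tauto

lemma graph_le {n r : ℕ} {p : ℝ} (hp0 : 0 < p) (hp1 : p < 1)
    (k : Finset (Fin n) → ℕ) (hk : Function.Injective k)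
    (H : Finset (Finset (Fin n))) (hH : H ⊆ rsets n r) :
    p ^ (hypGraph n H).card ≤ PI r p ^ H.card *
      (∏ i ∈ H, (1 + (p⁻¹ - 1) * dH (below k H i) i)) * Real.exp (- Real.log (PI r p) * badT H) := by
  have hπ := PI_pos (r := r) hp0
  have hu : 1 ≤ p⁻¹ := (one_le_inv₀ hp0).2 hp1.le
  have hπ1 : PI r p ≤ 1 := pow_le_one₀ hp0.le hp1.le
  have hL : 0 ≤ - Real.log (PI r p) := by
    have := Real.log_nonpos hπ.le hπ1; linarith
  have hw : ∀ H (i : Finset (Fin n)), 1 ≤ 1 + (p⁻¹ - 1) * dH H i := fun H i => by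
    have := mul_nonneg (sub_nonneg.2 hu) (dH_nonneg H i); linarith
  induction H using Finset.induction_on_max_value k with
  | empty => simp [hypGraph, badT]
  | insert a s ha hm ih =>
    have ih' := ih ((Finset.subset_insert _ _).trans hH)
    have har : a ∈ rsets n r := hH (Finset.mem_insert_self _ _)
    rw [hypGraph_insert, Finset.card_union_of_disjoint Finset.disjoint_sdiff, pow_add,
      Finset.card_insert_of_notMem ha, Finset.prod_insert ha, below_insert k s a a le_rfl,
      below_self k hk s s a ha hm (Finset.Subset.refl _)]
    have h1 : ∏ i ∈ s, (1 + (p⁻¹ - 1) * dH (below k (insert a s) i) i)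
        = ∏ i ∈ s, (1 + (p⁻¹ - 1) * dH (below k s i) i) :=
      Finset.prod_congr rfl fun i hi => by rw [below_insert k s a i (hm i hi)]
    rw [h1]
    have h2 : p ^ (ed a \ hypGraph n s).card ≤ PI r p * (1 + (p⁻¹ - 1) * dH s a)
        * Real.exp (- Real.log (PI r p) * badI s a) := by
      by_cases hb : badI s a < 1
      · obtain ⟨h3, h4⟩ := badI_good s a ha hb
        rw [good_pow hp0 s a har h3 h4]
        refine le_mul_of_one_le_right (mul_nonneg hπ.le (zero_le_one.trans (hw _ _))) ?_
        exact Real.one_le_exp (mul_nonneg hL (badI_nonneg _ _))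
      · push Not at hb
        calc p ^ (ed a \ hypGraph n s).card ≤ 1 := pow_le_one₀ hp0.le hp1.le
          _ = PI r p * 1 * Real.exp (- Real.log (PI r p) * 1) := by
            rw [mul_one, mul_one, Real.exp_neg, Real.exp_log hπ, mul_inv_cancel₀ hπ.ne']
          _ ≤ _ := by
            have h4 := hw s a
            have h5 : - Real.log (PI r p) * 1 ≤ - Real.log (PI r p) * badI s a :=
              mul_le_mul_of_nonneg_left hb hL
            have h6 := Real.exp_le_exp.2 h5
            gcongr
    have h3 : badT s + badI s a ≤ badT (insert a s) := by
      unfold badT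
      rw [Finset.sum_insert ha, add_comm]
      exact add_le_add (badI_mono (Finset.subset_insert _ _) _)
        (Finset.sum_le_sum fun i _ => badI_mono (Finset.subset_insert _ _) _)
    have hpn : 0 ≤ ∏ i ∈ s, (1 + (p⁻¹ - 1) * dH (below k s i) i) :=
      Finset.prod_nonneg fun i _ => zero_le_one.trans (hw _ _)
    calc p ^ (hypGraph n s).card * p ^ (ed a \ hypGraph n s).card
        ≤ (PI r p ^ s.card * (∏ i ∈ s, (1 + (p⁻¹ - 1) * dH (below k s i) i))
            * Real.exp (- Real.log (PI r p) * badT s)) * (PI r p * (1 + (p⁻¹ - 1) * dH s a)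
            * Real.exp (- Real.log (PI r p) * badI s a)) := by
          refine mul_le_mul ih' h2 (by positivity) (by positivity)
      _ = PI r p ^ (s.card + 1) * ((1 + (p⁻¹ - 1) * dH s a) *
            ∏ i ∈ s, (1 + (p⁻¹ - 1) * dH (below k s i) i)) *
            Real.exp (- Real.log (PI r p) * (badT s + badI s a)) := by
          rw [mul_add (- Real.log (PI r p)), Real.exp_add]; ring
      _ ≤ _ := by
          have h7 := Real.exp_le_exp.2 (mul_le_mul_of_nonneg_left h3 hL)
          refine mul_le_mul_of_nonneg_left h7 ?_
          have := hw s a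
          positivity

/-- a fixed injective key -/
noncomputable def kk {n : ℕ} (S : Finset (Fin n)) : ℕ := (Fintype.equivFin (Finset (Fin n)) S).val

lemma kk_inj {n : ℕ} : Function.Injective (kk (n := n)) := by
  intro a b h
  exact (Fintype.equivFin (Finset (Fin n))).injective (Fin.ext h)

noncomputable def aW (n r : ℕ) (p : ℝ) (h : Finset (Fin n)) : ℝ :=
  PI r p * (p⁻¹ - 1) * ∑ S ∈ rsets n r, if kk h < kk S ∧ (S ∩ h).card = 2 then 1 else 0

noncomputable def ZZ (n r : ℕ) (p : ℝ) (H : Finset (Finset (Fin n))) : ℝ := ∑ h ∈ H, aW n r p h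

lemma ZZ_eq (n r : ℕ) (p : ℝ) (H : Finset (Finset (Fin n))) :
    ∑ i ∈ rsets n r, PI r p * ((1 + (p⁻¹ - 1) * dH (below kk H i) i) - 1) = ZZ n r p H := by
  unfold ZZ aW dH below
  simp only [Finset.sum_filter, add_sub_cancel_left, Finset.mul_sum]
  rw [Finset.sum_comm]
  refine Finset.sum_congr rfl fun h _ => Finset.sum_congr rfl fun S _ => ?_
  by_cases h1 : kk h < kk S <;> by_cases h2 : (S ∩ h).card = 2 <;> simp [h1, h2]

lemma aW_nonneg {n r : ℕ} {p : ℝ} (hp0 : 0 < p) (hp1 : p < 1) (h : Finset (Fin n)) :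
    0 ≤ aW n r p h := by
  have hu : 1 ≤ p⁻¹ := (one_le_inv₀ hp0).2 hp1.le
  have hπ := PI_pos (r := r) hp0
  unfold aW
  refine mul_nonneg (mul_nonneg hπ.le (by linarith)) (Finset.sum_nonneg fun _ _ => ?_)
  split_ifs <;> norm_num

lemma aW_le {n r : ℕ} {p : ℝ} (hp0 : 0 < p) (hp1 : p < 1) (hr : 2 ≤ r) (h : Finset (Fin n))
    (hh : h ∈ rsets n r) :
    aW n r p h ≤ (p⁻¹ - 1) * lam n r p := by
  have hu : 1 ≤ p⁻¹ := (one_le_inv₀ hp0).2 hp1.le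
  have hπ := PI_pos (r := r) hp0
  have h1 := sum_N2 hr h hh 1
  unfold aW lam
  have h2 : ∑ S ∈ rsets n r, (if kk h < kk S ∧ (S ∩ h).card = 2 then (1:ℝ) else 0) ≤ N2 n r := by
    rw [mul_one] at h1
    rw [← h1]
    refine Finset.sum_le_sum fun S _ => ?_
    rw [Finset.inter_comm h S]
    split_ifs <;> simp_all
  have h3 : 0 ≤ PI r p * (p⁻¹ - 1) := mul_nonneg hπ.le (by linarith)
  calc _ ≤ PI r p * (p⁻¹ - 1) * N2 n r := mul_le_mul_of_nonneg_left h2 h3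
    _ = _ := by ring

lemma sum_aW {n r : ℕ} {p : ℝ} (hr : 3 ≤ r) :
    PI r p * ∑ h ∈ rsets n r, aW n r p h = LamP n r p := by
  rw [LamP_eq]
  unfold aW
  rw [← Finset.mul_sum]
  set X := ∑ h ∈ rsets n r, ∑ S ∈ rsets n r, (if kk h < kk S ∧ (S ∩ h).card = 2 then (1:ℝ) else 0)
    with hX
  have h1 : X + X = (n.choose r : ℝ) * N2 n r := by
    have h2 : X = ∑ h ∈ rsets n r, ∑ S ∈ rsets n r,
        (if kk S < kk h ∧ (h ∩ S).card = 2 then (1:ℝ) else 0) := by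
      rw [hX, Finset.sum_comm]
    have h3 : X + X = ∑ h ∈ rsets n r, ∑ S ∈ rsets n r,
        (if (h ∩ S).card = 2 then (1:ℝ) else 0) := by
      nth_rewrite 2 [h2]
      rw [hX, ← Finset.sum_add_distrib]
      refine Finset.sum_congr rfl fun h hh => ?_
      rw [← Finset.sum_add_distrib]
      refine Finset.sum_congr rfl fun S hS => ?_
      rw [Finset.inter_comm S h]
      by_cases h4 : (h ∩ S).card = 2
      · have h5 : h ≠ S := by
          rintro rfl
          rw [Finset.inter_self, mem_rsets.1 hh] at h4
          omega
        have h6 : kk h ≠ kk S := fun h => h5 (kk_inj h)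
        rcases lt_or_gt_of_ne h6 with h7 | h7
        · simp [h4, h7, h7.le]
        · simp [h4, h7, h7.le]
      · simp [h4]
    rw [h3, Finset.sum_congr rfl fun h hh => sum_N2 (by omega) h hh 1]
    simp [card_rsets]
  unfold muR lam
  have : X = (1/2) * ((n.choose r : ℝ) * N2 n r) := by linarith
  rw [this]; unfold PI; ring

lemma lower_sum {n r : ℕ} {p : ℝ} (hp0 : 0 < p) (hp1 : p < 1)
    (T : Finset (Finset (Finset (Fin n)))) (hT : ∀ H ∈ T, H ⊆ rsets n r) (η : ℝ)
    (hη : ∀ H ∈ T, - Real.log (PI r p) * badT H + ZZ n r p H ≤ LamP n r p + η) :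
    ∑ H ∈ T, p ^ (hypGraph n H).card * (1 - PI r p) ^ (n.choose r - H.card)
      * Real.exp (- LamP n r p) ≤ Real.exp η := by
  have hu : 1 ≤ p⁻¹ := (one_le_inv₀ hp0).2 hp1.le
  have hπ := PI_pos (r := r) hp0
  have hπ1 : PI r p ≤ 1 := pow_le_one₀ hp0.le hp1.le
  have hw : ∀ H (i : Finset (Fin n)), 1 ≤ 1 + (p⁻¹ - 1) * dH H i := fun H i => by
    have := mul_nonneg (sub_nonneg.2 hu) (dH_nonneg H i); linarith
  have h1 := seq_sum_le (kk (n := n)) kk_inj (fun H i => 1 + (p⁻¹ - 1) * dH H i) (PI r p) hπ.le hπ1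
    hw (rsets n r)
  simp only [ZZ_eq, card_rsets] at h1
  have h1π : 0 ≤ 1 - PI r p := by linarith
  have hpn : ∀ H : Finset (Finset (Fin n)), 0 ≤ ∏ i ∈ H, (1 + (p⁻¹ - 1) * dH (below kk H i) i) :=
    fun H => Finset.prod_nonneg fun i _ => zero_le_one.trans (hw _ _)
  calc _ ≤ ∑ H ∈ T, (PI r p ^ H.card * (1 - PI r p) ^ (n.choose r - H.card) *
        (∏ i ∈ H, (1 + (p⁻¹ - 1) * dH (below kk H i) i)) * Real.exp (- ZZ n r p H)) * Real.exp η := by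
        refine Finset.sum_le_sum fun H hH => ?_
        have h2 := graph_le hp0 hp1 kk kk_inj H (hT H hH)
        have h3 := hη H hH
        have h4 : Real.exp (- Real.log (PI r p) * badT H) * Real.exp (- LamP n r p)
            ≤ Real.exp (- ZZ n r p H) * Real.exp η := by
          rw [← Real.exp_add, ← Real.exp_add]
          exact Real.exp_le_exp.2 (by linarith)
        have h5 := hpn H
        calc _ ≤ (PI r p ^ H.card *
            (∏ i ∈ H, (1 + (p⁻¹ - 1) * dH (below kk H i) i)) * Real.exp (- Real.log (PI r p) * badT H))
              * (1 - PI r p) ^ (n.choose r - H.card) * Real.exp (- LamP n r p) := by gcongr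
          _ = (PI r p ^ H.card * (1 - PI r p) ^ (n.choose r - H.card) *
            (∏ i ∈ H, (1 + (p⁻¹ - 1) * dH (below kk H i) i))) * (Real.exp (- Real.log (PI r p) * badT H) * Real.exp (- LamP n r p)) := by ring
          _ ≤ (PI r p ^ H.card * (1 - PI r p) ^ (n.choose r - H.card) *
            (∏ i ∈ H, (1 + (p⁻¹ - 1) * dH (below kk H i) i))) * (Real.exp (- ZZ n r p H) * Real.exp η) := by
              gcongr
          _ = _ := by ring
    _ ≤ 1 * Real.exp η := by
        rw [← Finset.sum_mul]
        refine mul_le_mul_of_nonneg_right (le_trans ?_ h1) (Real.exp_pos _).le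
        refine Finset.sum_le_sum_of_subset_of_nonneg (fun H hH => Finset.mem_powerset.2 (hT H hH)) ?_
        intro H _ _
        have := hpn H
        positivity
    _ = _ := one_mul _


/-- expectation over `G(n,p)` -/
noncomputable abbrev EX (n : ℕ) (p : ℝ) (φ : Finset (Finset (Fin n)) → ℝ) : ℝ := ex (pairsUniv n) p φ

lemma sum_cliqueHyp {n r : ℕ} (G : Finset (Finset (Fin n))) (a : Finset (Fin n) → ℝ) :
    ∑ h ∈ cliqueHyp n r G, a h = ∑ h ∈ rsets n r, a h * (if ed h ⊆ G then 1 else 0) := by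
  have : cliqueHyp n r G = (rsets n r).filter (fun h => ed h ⊆ G) := by
    ext h; rw [mem_cliqueHyp, Finset.mem_filter]
  rw [this, Finset.sum_filter]
  refine Finset.sum_congr rfl fun h _ => ?_
  split_ifs <;> simp

lemma EX_hyp1 (n r : ℕ) (p : ℝ) (a : Finset (Fin n) → ℝ) :
    EX n p (fun G => ∑ h ∈ cliqueHyp n r G, a h) = PI r p * ∑ h ∈ rsets n r, a h := by
  simp only [sum_cliqueHyp, EX]
  rw [ex_sum, Finset.mul_sum]
  refine Finset.sum_congr rfl fun h hh => ?_
  rw [ex_mul, ex_subset_one _ _ _ (ed_sub h), card_ed, mem_rsets.1 hh, PI, mul_comm]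

lemma EX_hyp2 (n r : ℕ) (p : ℝ) (b : Finset (Fin n) → Finset (Fin n) → ℝ) :
    EX n p (fun G => ∑ h ∈ cliqueHyp n r G, ∑ h' ∈ cliqueHyp n r G, b h h')
      = ∑ h ∈ rsets n r, ∑ h' ∈ rsets n r, b h h' * p ^ (ed h ∪ ed h').card := by
  simp only [sum_cliqueHyp, EX, Finset.sum_mul]
  rw [ex_sum]
  refine Finset.sum_congr rfl fun h hh => ?_
  rw [ex_sum]
  refine Finset.sum_congr rfl fun h' hh' => ?_
  rw [← ex_subset_one _ _ _ (Finset.union_subset (ed_sub h) (ed_sub h')), ← ex_mul]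
  refine ex_congr _ _ _ _ fun G _ => ?_
  by_cases h1 : ed h ⊆ G <;> by_cases h2 : ed h' ⊆ G <;> simp [h1, h2, Finset.union_subset_iff]

lemma EX_hyp3 (n r : ℕ) (p : ℝ) (b : Finset (Fin n) → Finset (Fin n) → Finset (Fin n) → ℝ) :
    EX n p (fun G => ∑ i ∈ cliqueHyp n r G, ∑ h ∈ cliqueHyp n r G, ∑ h' ∈ cliqueHyp n r G, b i h h')
      = ∑ i ∈ rsets n r, ∑ h ∈ rsets n r, ∑ h' ∈ rsets n r,
          b i h h' * p ^ (ed i ∪ (ed h ∪ ed h')).card := by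
  simp only [sum_cliqueHyp, EX, Finset.sum_mul]
  rw [ex_sum]
  refine Finset.sum_congr rfl fun i hi => ?_
  rw [ex_sum]
  refine Finset.sum_congr rfl fun h hh => ?_
  rw [ex_sum]
  refine Finset.sum_congr rfl fun h' hh' => ?_
  rw [← ex_subset_one _ _ _ (Finset.union_subset (ed_sub i) (Finset.union_subset (ed_sub h) (ed_sub h'))),
    ← ex_mul]
  refine ex_congr _ _ _ _ fun G _ => ?_
  by_cases h0 : ed i ⊆ G <;> by_cases h1 : ed h ⊆ G <;> by_cases h2 : ed h' ⊆ G <;>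
    simp [h0, h1, h2, Finset.union_subset_iff]

/-- excess of pair probability over independence -/
noncomputable def Dx (r : ℕ) (p : ℝ) {n : ℕ} (h h' : Finset (Fin n)) : ℝ :=
  (if (h ∩ h').card = 2 then PI r p ^ 2 * p⁻¹ else 0)
    + (if h' ≠ h ∧ 3 ≤ (h ∩ h').card then p ^ (ed h ∪ ed h').card else 0)

noncomputable def DD (n r : ℕ) (p : ℝ) : ℝ := muR n r p * lam n r p * p⁻¹ + Del3 n r p

lemma Dx_nonneg {n r : ℕ} {p : ℝ} (hp0 : 0 < p) (h h' : Finset (Fin n)) : 0 ≤ Dx r p h h' := by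
  unfold Dx
  have := PI_pos (r := r) hp0
  refine add_nonneg ?_ ?_ <;> split_ifs <;> positivity

lemma sum_Dx {n r : ℕ} {p : ℝ} (hr : 2 ≤ r) :
    ∑ h ∈ rsets n r, ∑ h' ∈ rsets n r, Dx r p h h' = DD n r p := by
  unfold Dx DD
  simp only [Finset.sum_add_distrib]
  rw [Finset.sum_congr rfl fun h hh => sum_N2 hr h hh (PI r p ^ 2 * p⁻¹)]
  congr 1
  simp only [Finset.sum_const, card_rsets, nsmul_eq_mul, muR, lam]
  unfold PI; ring

lemma q_le {n r : ℕ} {p : ℝ} (hp0 : 0 < p) (h h' : Finset (Fin n))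
    (hh : h ∈ rsets n r) (hh' : h' ∈ rsets n r) (hne : h ≠ h') :
    p ^ (ed h ∪ ed h').card ≤ PI r p ^ 2 + Dx r p h h' := by
  have hπ := PI_pos (r := r) hp0
  have hc := card_ed_union h h'
  rw [mem_rsets.1 hh, mem_rsets.1 hh'] at hc
  unfold Dx
  rcases Nat.lt_trichotomy (h ∩ h').card 2 with h1 | h1 | h1
  · rw [if_neg (by omega), if_neg (by omega)]
    rw [Nat.choose_eq_zero_of_lt h1, add_zero] at hc
    rw [hc, pow_add, PI]
    nlinarith
  · rw [if_pos h1, if_neg (by omega), add_zero]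
    rw [h1] at hc
    have : p ^ (ed h ∪ ed h').card = PI r p ^ 2 * p⁻¹ := by
      unfold PI
      rw [pow_two, ← pow_add, ← hc, pow_add]; simp; field_simp
    rw [this]; nlinarith
  · rw [if_neg (by omega), if_pos ⟨hne.symm, h1⟩, zero_add]
    nlinarith

lemma q_le' {n r : ℕ} {p : ℝ} (hp0 : 0 < p) (h h' : Finset (Fin n))
    (hh : h ∈ rsets n r) (hh' : h' ∈ rsets n r) :
    p ^ (ed h ∪ ed h').card - PI r p ^ 2 ≤ (if h = h' then PI r p else 0) + Dx r p h h' := by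
  have hπ := PI_pos (r := r) hp0
  have hD := Dx_nonneg (r := r) hp0 h h'
  by_cases hne : h = h'
  · subst hne
    rw [if_pos rfl, Finset.union_self, card_ed, mem_rsets.1 hh]
    unfold PI at *
    nlinarith
  · rw [if_neg hne]
    have := q_le hp0 h h' hh hh' hne
    linarith

lemma second_moment {n r : ℕ} {p : ℝ} (hp0 : 0 < p) (hr : 2 ≤ r)
    (a : Finset (Fin n) → ℝ) (A : ℝ) (ha0 : ∀ h ∈ rsets n r, 0 ≤ a h) (ha1 : ∀ h ∈ rsets n r, a h ≤ A)
    (hA : 0 ≤ A) :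
    EX n p (fun G => (∑ h ∈ cliqueHyp n r G, a h - PI r p * ∑ h ∈ rsets n r, a h) ^ 2)
      ≤ A ^ 2 * (muR n r p + DD n r p) := by
  have hπ := PI_pos (r := r) hp0
  set c := PI r p * ∑ h ∈ rsets n r, a h with hc
  have h1 : EX n p (fun G => (∑ h ∈ cliqueHyp n r G, a h - c) ^ 2)
      = EX n p (fun G => ∑ h ∈ cliqueHyp n r G, ∑ h' ∈ cliqueHyp n r G, a h * a h') - c ^ 2 := by
    have h2 : ∀ G, (∑ h ∈ cliqueHyp n r G, a h - c) ^ 2 =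
        (∑ h ∈ cliqueHyp n r G, ∑ h' ∈ cliqueHyp n r G, a h * a h')
          - ((2 * c) * (∑ h ∈ cliqueHyp n r G, a h) - c ^ 2) := by
      intro G
      rw [← Finset.sum_mul_sum]; ring
    simp only [h2]
    unfold EX
    rw [ex_sub, ex_sub, ex_mul, ex_const]
    have := EX_hyp1 n r p a
    unfold EX at this
    rw [this, ← hc]; ring
  rw [h1, EX_hyp2]
  have h3 : c ^ 2 = ∑ h ∈ rsets n r, ∑ h' ∈ rsets n r, a h * a h' * PI r p ^ 2 := by
    rw [hc, mul_pow, pow_two (∑ h ∈ rsets n r, a h), Finset.sum_mul_sum, Finset.mul_sum]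
    refine Finset.sum_congr rfl fun h _ => ?_
    rw [Finset.mul_sum]
    refine Finset.sum_congr rfl fun h _ => by ring
  rw [h3, ← Finset.sum_sub_distrib]
  have h4 : ∀ h ∈ rsets n r, (∑ h' ∈ rsets n r, a h * a h' * p ^ (ed h ∪ ed h').card)
      - (∑ h' ∈ rsets n r, a h * a h' * PI r p ^ 2)
      ≤ ∑ h' ∈ rsets n r, A ^ 2 * ((if h = h' then PI r p else 0) + Dx r p h h') := by
    intro h hh
    rw [← Finset.sum_sub_distrib]
    refine Finset.sum_le_sum fun h' hh' => ?_
    have h5 := q_le' hp0 h h' hh hh'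
    have h6 : 0 ≤ a h * a h' := mul_nonneg (ha0 h hh) (ha0 h' hh')
    have h7 : a h * a h' ≤ A ^ 2 := by
      rw [pow_two]; exact mul_le_mul (ha1 h hh) (ha1 h' hh') (ha0 h' hh') hA
    have h8 : 0 ≤ (if h = h' then PI r p else 0) + Dx r p h h' :=
      add_nonneg (by split_ifs <;> linarith) (Dx_nonneg hp0 h h')
    calc _ = a h * a h' * (p ^ (ed h ∪ ed h').card - PI r p ^ 2) := by ring
      _ ≤ a h * a h' * ((if h = h' then PI r p else 0) + Dx r p h h') := mul_le_mul_of_nonneg_left h5 h6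
      _ ≤ _ := mul_le_mul_of_nonneg_right h7 h8
  refine (Finset.sum_le_sum h4).trans (le_of_eq ?_)
  simp only [← Finset.mul_sum, Finset.sum_add_distrib]
  rw [sum_Dx hr]
  congr 2
  rw [Finset.sum_congr rfl (g := fun _ => PI r p) fun h hh => by simp [hh]]
  simp [card_rsets, muR, PI]

lemma tri_sum {n r : ℕ} {p : ℝ} (hp0 : 0 < p) (hr : 2 ≤ r) :
    PI r p * ∑ S ∈ rsets n r, ∑ h ∈ rsets n r, ∑ h' ∈ rsets n r,
      (if h ≠ h' ∧ (S ∩ h).card = 2 ∧ (S ∩ h').card = 2 then 1 else 0) * p ^ (ed h ∪ ed h').card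
      ≤ muR n r p * lam n r p ^ 2 + DD n r p * lam n r p := by
  have hπ := PI_pos (r := r) hp0
  have h1 : ∀ S ∈ rsets n r, ∀ h ∈ rsets n r, ∀ h' ∈ rsets n r,
      (if h ≠ h' ∧ (S ∩ h).card = 2 ∧ (S ∩ h').card = 2 then 1 else 0) * p ^ (ed h ∪ ed h').card
      ≤ (if (S ∩ h).card = 2 then 1 else 0) * (if (S ∩ h').card = 2 then PI r p ^ 2 else 0)
        + (if (h ∩ S).card = 2 then Dx r p h h' else 0) := by
    intro S hS h hh h' hh'
    have hD := Dx_nonneg (r := r) hp0 h h'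
    rw [Finset.inter_comm h S]
    by_cases h2 : (S ∩ h).card = 2 <;> by_cases h3 : (S ∩ h').card = 2 <;> by_cases h4 : h = h'
    all_goals simp only [h2, h3, h4, ne_eq, not_true_eq_false, not_false_eq_true, true_and, and_true,
      and_false, false_and, if_true, if_false, one_mul, zero_mul, mul_zero, zero_add]
    all_goals try positivity
    all_goals first
      | exact le_rfl
      | exact hD
      | exact q_le hp0 h h' hh hh' h4
      | (subst h4; exact add_nonneg (by positivity) hD)
  have h2 := Finset.sum_le_sum fun S hS => Finset.sum_le_sum fun h hh => Finset.sum_le_sum fun h' hh' =>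
    h1 S hS h hh h' hh'
  have h3 : ∑ S ∈ rsets n r, ∑ h ∈ rsets n r, ∑ h' ∈ rsets n r,
      ((if (S ∩ h).card = 2 then 1 else 0) * (if (S ∩ h').card = 2 then PI r p ^ 2 else 0)
        + (if (h ∩ S).card = 2 then Dx r p h h' else 0))
      = n.choose r * (N2 n r * (N2 n r * PI r p ^ 2)) + N2 n r * DD n r p := by
    simp only [Finset.sum_add_distrib]
    congr 1
    · rw [Finset.sum_congr rfl (g := fun _ => N2 n r * (N2 n r * PI r p ^ 2))]
      · simp [card_rsets]
      · intro S hS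
        rw [← Finset.sum_mul_sum, sum_N2 hr S hS, sum_N2 hr S hS, mul_one]
    · rw [Finset.sum_comm, ← sum_Dx hr, Finset.mul_sum]
      refine Finset.sum_congr rfl fun h hh => ?_
      rw [Finset.sum_comm, Finset.mul_sum]
      exact Finset.sum_congr rfl fun h' hh' => sum_N2 hr h hh _
  rw [h3] at h2
  refine (mul_le_mul_of_nonneg_left h2 hπ.le).trans (le_of_eq ?_)
  unfold muR lam PI; ring

lemma EX_tri {n r : ℕ} {p : ℝ} (hp0 : 0 < p) (hr : 2 ≤ r) :
    EX n p (fun G => PI r p * ∑ S ∈ rsets n r, triH (cliqueHyp n r G) S)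
      ≤ muR n r p * lam n r p ^ 2 + DD n r p * lam n r p := by
  refine le_trans (le_of_eq ?_) (tri_sum (n := n) hp0 hr)
  unfold EX triH
  rw [ex_mul, ex_sum]
  congr 1
  refine Finset.sum_congr rfl fun S _ => ?_
  exact EX_hyp2 n r p _

lemma EX_bad {n r : ℕ} {p : ℝ} (hp0 : 0 < p) (hp1 : p < 1) (hr : 2 ≤ r) :
    EX n p (fun G => badT (cliqueHyp n r G))
      ≤ Del3 n r p + (p⁻¹)^2 * (muR n r p * lam n r p ^ 2 + DD n r p * lam n r p) := by
  have hπ := PI_pos (r := r) hp0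
  unfold badT badI EX
  simp only [Finset.sum_add_distrib]
  rw [ex_add]
  refine add_le_add (le_of_eq ?_) ?_
  · have := EX_hyp2 n r p (fun i h => if h ≠ i ∧ 3 ≤ (i ∩ h).card then 1 else 0)
    unfold EX at this
    rw [this, Del3]
    simp only [ite_mul, one_mul, zero_mul]
  · unfold triH
    have := EX_hyp3 n r p (fun S h h' => if h ≠ h' ∧ (S ∩ h).card = 2 ∧ (S ∩ h').card = 2 then 1 else 0)
    unfold EX at this
    rw [this]
    refine le_trans ?_ (mul_le_mul_of_nonneg_left (tri_sum (n := n) hp0 hr) (by positivity))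
    simp only [Finset.mul_sum]
    refine Finset.sum_le_sum fun i hi => Finset.sum_le_sum fun h hh => Finset.sum_le_sum fun h' hh' => ?_
    split_ifs with h1
    · rw [one_mul, one_mul]
      have h2 : (ed h ∪ ed h').card + r.choose 2 ≤ (ed i ∪ (ed h ∪ ed h')).card + 2 := by
        have h3 := Finset.card_union_add_card_inter (ed i) (ed h ∪ ed h')
        rw [card_ed i, mem_rsets.1 hi] at h3
        have h4 : (ed i ∩ (ed h ∪ ed h')).card ≤ 2 := by
          rw [Finset.inter_union_distrib_left, ed_inter, ed_inter]
          refine (Finset.card_union_le _ _).trans ?_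
          rw [card_ed, card_ed, h1.2.1, h1.2.2]; decide
        omega
      have h3 : p ^ ((ed i ∪ (ed h ∪ ed h')).card + 2) ≤ p ^ ((ed h ∪ ed h').card + r.choose 2) :=
        pow_le_pow_of_le_one hp0.le hp1.le h2
      calc p ^ (ed i ∪ (ed h ∪ ed h')).card = (p⁻¹)^2 * p ^ ((ed i ∪ (ed h ∪ ed h')).card + 2) := by
            rw [pow_add]; field_simp
        _ ≤ (p⁻¹)^2 * p ^ ((ed h ∪ ed h').card + r.choose 2) := mul_le_mul_of_nonneg_left h3 (by positivity)
        _ = _ := by rw [pow_add, PI]; ring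
    · simp

/-- Markov / Chebyshev -/
lemma markov {n : ℕ} {p : ℝ} (hp0 : 0 < p) (hp1 : p < 1) (A : Set (Finset (Finset (Fin n))))
    (X : Finset (Finset (Fin n)) → ℝ) (hX : ∀ G, 0 ≤ X G) (t : ℝ) (ht : 0 < t)
    (hA : ∀ G ∈ A, t ≤ X G) : gnpProb n p A ≤ EX n p X / t := by
  rw [gnpProb_eq_ex, div_eq_inv_mul, EX, ← ex_mul]
  refine ex_mono _ hp0.le hp1.le _ _ fun G _ => ?_
  have := hX G
  split_ifs with h
  · have := hA G h
    rw [← div_eq_inv_mul, le_div_iff₀ ht]; linarith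
  · positivity

lemma gnp_mono {n : ℕ} {p : ℝ} (hp0 : 0 < p) (hp1 : p < 1) {A B : Set (Finset (Finset (Fin n)))}
    (h : A ⊆ B) : gnpProb n p A ≤ gnpProb n p B := by
  rw [gnpProb_eq_ex, gnpProb_eq_ex]
  refine ex_mono _ hp0.le hp1.le _ _ fun G _ => ?_
  split_ifs with h1 h2 <;> try norm_num
  exact h2 (h h1)

lemma gnp_union {n : ℕ} {p : ℝ} (hp0 : 0 < p) (hp1 : p < 1) (A B : Set (Finset (Finset (Fin n)))) :
    gnpProb n p (A ∪ B) ≤ gnpProb n p A + gnpProb n p B := by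
  rw [gnpProb_eq_ex, gnpProb_eq_ex, gnpProb_eq_ex, ← ex_add]
  refine ex_mono _ hp0.le hp1.le _ _ fun G _ => ?_
  by_cases h1 : G ∈ A <;> by_cases h2 : G ∈ B <;> simp [h1, h2]

lemma gnp_compl {n : ℕ} {p : ℝ} (A : Set (Finset (Finset (Fin n)))) :
    gnpProb n p A = 1 - gnpProb n p Aᶜ := by
  rw [gnpProb_eq_ex, gnpProb_eq_ex, ← ex_one (pairsUniv n) p, ← ex_sub]
  refine ex_congr _ _ _ _ fun G _ => ?_
  by_cases h1 : G ∈ A <;> simp [h1, ex_one]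

lemma gnp_nonneg {n : ℕ} {p : ℝ} (hp0 : 0 < p) (hp1 : p < 1) (A : Set (Finset (Finset (Fin n)))) :
    0 ≤ gnpProb n p A := by
  rw [gnpProb_eq_ex]
  exact ex_nonneg _ hp0.le hp1.le _ fun G _ => by split_ifs <;> norm_num

lemma gnp_fiber {n r : ℕ} {p : ℝ} (T : Finset (Finset (Finset (Fin n)))) :
    gnpProb n p {G | cliqueHyp n r G ∈ T} = ∑ H ∈ T, gnpProb n p {G | cliqueHyp n r G = H} := by
  simp only [gnpProb_eq_ex]
  rw [← ex_sum]
  refine ex_congr _ _ _ _ fun G _ => ?_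
  by_cases h : cliqueHyp n r G ∈ T
  · rw [Finset.sum_eq_single (cliqueHyp n r G)]
    · simp [h]
    · intro b _ hb
      simp [Ne.symm hb]
    · intro h'; exact absurd h h'
  · rw [Finset.sum_eq_zero]
    · simp [h]
    · intro b hb
      have : cliqueHyp n r G ≠ b := fun h' => h (h' ▸ hb)
      simp [this]


/-- the target probability, with δ = 0 -/
noncomputable def FF (n r : ℕ) (p : ℝ) (H : Finset (Finset (Fin n))) : ℝ :=
  p ^ (hypGraph n H).card * (1 - PI r p) ^ (n.choose r - H.card) * Real.exp (- LamP n r p)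

lemma FF_eq {n r : ℕ} {p : ℝ} (hp0 : 0 < p) (H : Finset (Finset (Fin n))) (δ : ℝ) :
    (p ^ r.choose 2) ^ H.card * (1 - p ^ r.choose 2) ^ (n.choose r - H.card) *
      p ^ (-(tHyp n r H)) * Real.exp (-(LamP n r p) + δ) = FF n r p H * Real.exp δ := by
  unfold FF PI
  have h1 : (p ^ r.choose 2) ^ H.card * p ^ (-(tHyp n r H)) = p ^ (hypGraph n H).card := by
    rw [← pow_mul, ← zpow_natCast, ← zpow_natCast, ← zpow_add₀ hp0.ne']
    congr 1
    unfold tHyp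
    push_cast
    ring
  rw [Real.exp_add, ← h1]
  ring

noncomputable def PH (n r : ℕ) (p : ℝ) (H : Finset (Finset (Fin n))) : ℝ :=
  gnpProb n p {G | cliqueHyp n r G = H}

lemma combine {n r : ℕ} {p : ℝ} (hp0 : 0 < p) (hp1 : p < 1)
    (T : Finset (Finset (Finset (Fin n)))) (τ η l : ℝ) (hη : 0 < η) (hl : 1 ≤ l)
    (hup : ∀ H ∈ T, PH n r p H ≤ FF n r p H * Real.exp η)
    (hsum : ∑ H ∈ T, FF n r p H ≤ Real.exp η)
    (hτ : 1 - τ ≤ gnpProb n p {G | cliqueHyp n r G ∈ T}) (hτη : τ ≤ η) (hτ0 : 0 ≤ τ) :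
    1 - τ - 3 / l ≤ gnpProb n p {G | cliqueHyp n r G ∈
      T.filter (fun H => FF n r p H * Real.exp (- (l * η)) ≤ PH n r p H)} := by
  rw [gnp_fiber] at hτ ⊢
  change 1 - τ ≤ ∑ H ∈ T, PH n r p H at hτ
  change _ ≤ ∑ H ∈ _, PH n r p H
  have hsplit := Finset.sum_filter_add_sum_filter_not T
    (fun H => FF n r p H * Real.exp (- (l * η)) ≤ PH n r p H) (PH n r p)
  have hsplitF := Finset.sum_filter_add_sum_filter_not T
    (fun H => FF n r p H * Real.exp (- (l * η)) ≤ PH n r p H) (FF n r p)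
  set X := ∑ H ∈ T with FF n r p H * Real.exp (- (l * η)) ≤ PH n r p H, PH n r p H with hX
  set Y := ∑ H ∈ T with ¬ FF n r p H * Real.exp (- (l * η)) ≤ PH n r p H, PH n r p H with hY
  have hY0 : 0 ≤ Y := Finset.sum_nonneg fun H _ => gnp_nonneg hp0 hp1 _
  have h1 : Real.exp (-η) * X ≤
      ∑ H ∈ T with FF n r p H * Real.exp (- (l * η)) ≤ PH n r p H, FF n r p H := by
    rw [hX, Finset.mul_sum]
    refine Finset.sum_le_sum fun H hH => ?_
    have h2 := hup H (Finset.mem_filter.1 hH).1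
    rw [Real.exp_neg, ← div_eq_inv_mul, div_le_iff₀ (Real.exp_pos _)]
    exact h2
  have h2 : Real.exp (l * η) * Y ≤
      ∑ H ∈ T with ¬ FF n r p H * Real.exp (- (l * η)) ≤ PH n r p H, FF n r p H := by
    rw [hY, Finset.mul_sum]
    refine Finset.sum_le_sum fun H hH => ?_
    have h3 := (Finset.mem_filter.1 hH).2
    push Not at h3
    rw [Real.exp_neg, ← div_eq_mul_inv, lt_div_iff₀ (Real.exp_pos _)] at h3
    linarith
  have h3 : Real.exp (-η) * X + Real.exp (l * η) * Y ≤ Real.exp η := by linarith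
  have h4 : X + Real.exp ((l + 1) * η) * Y ≤ Real.exp (2 * η) := by
    have h5 := mul_le_mul_of_nonneg_left h3 (Real.exp_pos η).le
    have h6 : Real.exp η * (Real.exp (-η) * X + Real.exp (l * η) * Y)
        = X + Real.exp ((l + 1) * η) * Y := by
      have h7 : Real.exp η * Real.exp (-η) = 1 := by rw [← Real.exp_add]; simp
      have h8 : Real.exp ((l + 1) * η) = Real.exp η * Real.exp (l * η) := by
        rw [← Real.exp_add]; ring_nf
      rw [h8]
      linear_combination X * h7
    have h9 : Real.exp η * Real.exp η = Real.exp (2 * η) := by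
      rw [← Real.exp_add]; ring_nf
    linarith
  have h5 : (Real.exp ((l + 1) * η) - 1) * Y ≤ (Real.exp (2 * η) - 1) + τ := by
    linarith
  have h6 : (l + 1) / 2 * (Real.exp (2 * η) - 1) ≤ Real.exp ((l + 1) * η) - 1 := by
    have h7 := one_add_mul_self_le_rpow_one_add (s := Real.exp (2 * η) - 1)
      (by have := Real.exp_pos (2 * η); linarith) (p := (l + 1) / 2) (by linarith)
    rw [add_sub_cancel, ← Real.exp_mul] at h7
    have h8 : 2 * η * ((l + 1) / 2) = (l + 1) * η := by ring
    rw [h8] at h7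
    linarith
  have h7 : 2 * η ≤ Real.exp (2 * η) - 1 := by
    have := Real.add_one_le_exp (2 * η); linarith
  have h8 : Y ≤ 3 / l := by
    set z := Real.exp (2 * η) - 1 with hz
    have hz0 : 0 < z := by linarith
    have h9 : (l + 1) / 2 * z * Y ≤ (3 / 2) * z :=
      calc _ ≤ (Real.exp ((l + 1) * η) - 1) * Y := mul_le_mul_of_nonneg_right h6 hY0
        _ ≤ z + τ := h5
        _ ≤ _ := by linarith
    have h10 : z * ((l + 1) / 2 * Y) ≤ z * (3 / 2) := by linarith
    have h11 := le_of_mul_le_mul_left h10 hz0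
    rw [le_div_iff₀ (by linarith)]
    nlinarith
  linarith

lemma one_sub_pow_lower {x : ℝ} (hx0 : 0 ≤ x) (hx : x ≤ 1/2) (N M : ℕ) :
    Real.exp (- (N * x) - 2 * x * (N * x)) ≤ (1 - x) ^ (N - M) := by
  have h1 : Real.exp (- x - 2 * x * x) ≤ 1 - x := by
    have h2 : 1 / (1 - x) ≤ Real.exp (x + 2 * x * x) := by
      have h3 := Real.add_one_le_exp (x + 2 * x * x)
      refine le_trans ?_ h3
      rw [div_le_iff₀ (by linarith)]
      nlinarith [mul_nonneg hx0 hx0]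
    have h4 : - x - 2 * x * x = - (x + 2 * x * x) := by ring
    rw [h4, Real.exp_neg]
    rw [div_le_iff₀ (by linarith)] at h2
    rw [inv_le_iff_one_le_mul₀ (Real.exp_pos _)]
    linarith
  calc _ = Real.exp (- x - 2 * x * x) ^ N := by
        rw [← Real.exp_nat_mul]; ring_nf
    _ ≤ (1 - x) ^ N := pow_le_pow_left₀ (Real.exp_pos _).le h1 N
    _ ≤ _ := pow_le_pow_of_le_one (by linarith) (by linarith) (Nat.sub_le _ _)

/-- random part of E1 -/
noncomputable def X1 (n r : ℕ) (p : ℝ) (H : Finset (Finset (Fin n))) : ℝ :=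
  2 * p⁻¹ * (PI r p * ∑ S ∈ rsets n r, triH H S)
    + (2 * p⁻¹ * (PI r p * N3 n r) + (p⁻¹ + yy n r p) * (p⁻¹)^2 * (lam n r p)^2) * ∑ _h ∈ H, 1

noncomputable def x1 (n r : ℕ) (p : ℝ) : ℝ :=
  2 * p⁻¹ * (muR n r p * lam n r p ^ 2 + DD n r p * lam n r p)
    + (2 * p⁻¹ * (PI r p * N3 n r) + (p⁻¹ + yy n r p) * (p⁻¹)^2 * (lam n r p)^2) * muR n r p

noncomputable def det1 (n r : ℕ) (p : ℝ) : ℝ :=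
  (1/2) * yy n r p * muR n r p * lam n r p + (1/2) * (1 + yy n r p) * (p⁻¹)^2 * Del3 n r p

noncomputable def Bd (n r : ℕ) (p : ℝ) : ℝ :=
  Del3 n r p + (p⁻¹)^2 * (muR n r p * lam n r p ^ 2 + DD n r p * lam n r p)

noncomputable def tau1 (n r : ℕ) (p a : ℝ) : ℝ :=
  2 * (((p⁻¹ - 1) * lam n r p) ^ 2 * (muR n r p + DD n r p) / a ^ 2) + x1 n r p / a

noncomputable def eta (n r : ℕ) (p a l : ℝ) : ℝ :=
  2 * a + det1 n r p + 2 * PI r p * muR n r p + (- Real.log (PI r p)) * (l * Bd n r p)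
    + tau1 n r p a + Bd n r p

lemma E1_eq (n r : ℕ) (p : ℝ) (H : Finset (Finset (Fin n))) :
    E1 n r p H = X1 n r p H + det1 n r p := by
  unfold E1 X1 det1
  simp only [Finset.sum_const, nsmul_eq_mul, mul_one]
  ring

section nonnegs
variable {n r : ℕ} {p : ℝ}

lemma lam_nonneg (hp0 : 0 < p) : 0 ≤ lam n r p := by
  have := PI_pos (r := r) hp0
  unfold lam N2; positivity

lemma muR_nonneg (hp0 : 0 < p) : 0 ≤ muR n r p := by
  unfold muR; positivity

lemma Del3_nonneg (hp0 : 0 < p) : 0 ≤ Del3 n r p := by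
  unfold Del3
  exact Finset.sum_nonneg fun _ _ => Finset.sum_nonneg fun _ _ => by split_ifs <;> positivity

lemma N3_nonneg : 0 ≤ N3 n r := by unfold N3; positivity

lemma DD_nonneg (hp0 : 0 < p) : 0 ≤ DD n r p := by
  have := lam_nonneg (n := n) (r := r) hp0
  have := muR_nonneg (n := n) (r := r) hp0
  have := Del3_nonneg (n := n) (r := r) hp0
  unfold DD; positivity

end nonnegs

lemma badT_int {n : ℕ} (H : Finset (Finset (Fin n))) : ∃ m : ℕ, badT H = m := by
  refine ⟨∑ i ∈ H, ((∑ h ∈ H, if h ≠ i ∧ 3 ≤ (i ∩ h).card then 1 else 0) +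
    ∑ h ∈ H, ∑ h' ∈ H, if h ≠ h' ∧ (i ∩ h).card = 2 ∧ (i ∩ h').card = 2 then 1 else 0), ?_⟩
  unfold badT badI triH
  push_cast
  rfl

theorem finite_main {n r : ℕ} {p : ℝ} (hp0 : 0 < p) (hp1 : p < 1) (hr : 3 ≤ r) (a l : ℝ)
    (ha : 0 < a) (hl : 1 ≤ l) (hπ2 : PI r p ≤ 1/2) (hBd : 0 < Bd n r p) :
    ∃ 𝒢 : Finset (Finset (Finset (Fin n))), (∀ H ∈ 𝒢, H ⊆ rsets n r) ∧
      1 - tau1 n r p a - 4 / l ≤ gnpProb n p {G | cliqueHyp n r G ∈ 𝒢} ∧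
      ∀ H ∈ 𝒢, ∃ δ : ℝ, |δ| ≤ l * eta n r p a l ∧ PH n r p H = FF n r p H * Real.exp δ := by
  have hπ := PI_pos (r := r) hp0
  have hu : 1 ≤ p⁻¹ := (one_le_inv₀ hp0).2 hp1.le
  have hlam := lam_nonneg (n := n) (r := r) hp0
  have hmu := muR_nonneg (n := n) (r := r) hp0
  have hD3 := Del3_nonneg (n := n) (r := r) hp0
  have hN3 := N3_nonneg (n := n) (r := r)
  have hDD := DD_nonneg (n := n) (r := r) hp0
  have hyy := yy_nonneg (n := n) (r := r) hp0
  have hL : 0 ≤ - Real.log (PI r p) := by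
    have := Real.log_nonpos hπ.le (by linarith); linarith
  have hu' : 0 ≤ p⁻¹ - 1 := by linarith
  set A := (p⁻¹ - 1) * lam n r p with hA
  have hA0 : 0 ≤ A := mul_nonneg hu' hlam
  have hx1 : 0 ≤ x1 n r p := by unfold x1; positivity
  have hdet : 0 ≤ det1 n r p := by unfold det1; positivity
  have htau1 : 0 ≤ tau1 n r p a := by unfold tau1; positivity
  have hX1 : ∀ H : Finset (Finset (Fin n)), 0 ≤ X1 n r p H := by
    intro H
    have : 0 ≤ ∑ S ∈ rsets n r, triH H S := Finset.sum_nonneg fun S _ => triH_nonneg H S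
    have h2 : (0:ℝ) ≤ ∑ _h ∈ H, 1 := Finset.sum_nonneg fun _ _ => zero_le_one
    unfold X1; positivity
  set T : Finset (Finset (Finset (Fin n))) := (rsets n r).powerset.filter (fun H =>
    A * (muR n r p - H.card) ≤ a ∧ ZZ n r p H - LamP n r p ≤ a ∧ X1 n r p H ≤ a ∧
      badT H ≤ l * Bd n r p) with hT
  have hTsub : ∀ H ∈ T, H ⊆ rsets n r := fun H hH =>
    Finset.mem_powerset.1 (Finset.mem_filter.1 hH).1
  set m4 := min (Bd n r p) (1 / l) with hm4
  have hm40 : 0 ≤ m4 := le_min hBd.le (by positivity)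
  set η := eta n r p a l with hηd
  have hη : η = 2 * a + det1 n r p + 2 * PI r p * muR n r p + (- Real.log (PI r p)) * (l * Bd n r p)
    + tau1 n r p a + Bd n r p := rfl
  have hLB : 0 ≤ (- Real.log (PI r p)) * (l * Bd n r p) := by positivity
  have hpm : 0 ≤ 2 * PI r p * muR n r p := by positivity
  have hη0 : 0 < η := by rw [hη]; linarith
  -- upper
  have hup : ∀ H ∈ T, PH n r p H ≤ FF n r p H * Real.exp η := by
    intro H hH
    have hc := (Finset.mem_filter.1 hH).2
    have h1 := upper hp0 hp1 hr H (hTsub H hH)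
    have h2 := one_sub_pow_lower hπ.le hπ2 (n.choose r) H.card
    have hmm : (n.choose r : ℝ) * PI r p = muR n r p := rfl
    rw [hmm] at h2
    unfold PH FF
    refine h1.trans ?_
    have h3 : Real.exp (- muR n r p - A * H.card + LamP n r p + E1 n r p H)
        ≤ (1 - PI r p) ^ (n.choose r - H.card) * Real.exp (- LamP n r p) * Real.exp η := by
      calc _ ≤ Real.exp (- muR n r p - 2 * PI r p * muR n r p) * Real.exp (- LamP n r p) * Real.exp η := by
            rw [← Real.exp_add, ← Real.exp_add]
            refine Real.exp_le_exp.2 ?_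
            have h4 : 2 * LamP n r p = A * muR n r p := by rw [LamP_eq, hA]; ring
            have h5 := hc.1
            have h6 := hc.2.2.1
            rw [E1_eq, hη]
            linarith
        _ ≤ _ := by gcongr
    calc _ ≤ p ^ (hypGraph n H).card * ((1 - PI r p) ^ (n.choose r - H.card) * Real.exp (- LamP n r p) * Real.exp η) :=
          mul_le_mul_of_nonneg_left h3 (by positivity)
      _ = _ := by ring
  have hsum : ∑ H ∈ T, FF n r p H ≤ Real.exp η := by
    refine lower_sum hp0 hp1 T hTsub η fun H hH => ?_
    have hc := (Finset.mem_filter.1 hH).2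
    have h1 := mul_le_mul_of_nonneg_left hc.2.2.2 hL
    have h2 := hc.2.1
    rw [hη]; linarith
  have hτη : tau1 n r p a + m4 ≤ η := by
    have := min_le_left (Bd n r p) (1 / l)
    rw [hη]; linarith
  -- failure probabilities
  have hV : ∀ (b : Finset (Fin n) → ℝ), (∀ h ∈ rsets n r, 0 ≤ b h) → (∀ h ∈ rsets n r, b h ≤ A) →
      gnpProb n p {G | a ≤ |∑ h ∈ cliqueHyp n r G, b h - PI r p * ∑ h ∈ rsets n r, b h|}
        ≤ A ^ 2 * (muR n r p + DD n r p) / a ^ 2 := by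
    intro b hb0 hb1
    refine (markov hp0 hp1 _ (fun G => (∑ h ∈ cliqueHyp n r G, b h - PI r p * ∑ h ∈ rsets n r, b h)^2)
      (fun G => sq_nonneg _) (a^2) (by positivity) ?_).trans ?_
    · intro G hG
      rw [← sq_abs (∑ h ∈ cliqueHyp n r G, b h - _)]
      exact pow_le_pow_left₀ ha.le hG 2
    · have := second_moment hp0 (by omega) b A hb0 hb1 hA0
      gcongr
  have hf1 := hV (fun _ => A) (fun _ _ => hA0) (fun _ _ => le_rfl)
  have hf2 := hV (aW n r p) (fun h _ => aW_nonneg hp0 hp1 h) (fun h hh => aW_le hp0 hp1 (by omega) h hh)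
  have hf3 : gnpProb n p {G | a ≤ X1 n r p (cliqueHyp n r G)} ≤ x1 n r p / a := by
    refine (markov hp0 hp1 _ (fun G => X1 n r p (cliqueHyp n r G)) (fun G => hX1 _) a ha
      (fun G hG => hG)).trans ?_
    have : EX n p (fun G => X1 n r p (cliqueHyp n r G)) ≤ x1 n r p := by
      unfold X1 x1 EX
      rw [ex_add, ex_mul _ _ (2 * p⁻¹), ex_mul _ _ (2 * p⁻¹ * (PI r p * N3 n r) + (p⁻¹ + yy n r p) * (p⁻¹)^2 * (lam n r p)^2)]
      have h1 := EX_tri (n := n) hp0 (show 2 ≤ r by omega)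
      have h2 := EX_hyp1 n r p (fun _ => 1)
      unfold EX at h1 h2
      rw [h2]
      have h3 : PI r p * ∑ h ∈ rsets n r, (1:ℝ) = muR n r p := by
        simp [card_rsets, muR, PI, mul_comm]
      rw [h3]
      gcongr
    gcongr
  have hf4 : gnpProb n p {G | l * Bd n r p < badT (cliqueHyp n r G)} ≤ m4 := by
    have hE := EX_bad (n := n) hp0 hp1 (show 2 ≤ r by omega)
    change _ ≤ Bd n r p at hE
    have hb0 : ∀ G : Finset (Finset (Fin n)), 0 ≤ badT (cliqueHyp n r G) := fun G =>
      Finset.sum_nonneg fun i _ => badI_nonneg _ _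
    refine le_min ?_ ?_
    · refine (markov hp0 hp1 _ (fun G => badT (cliqueHyp n r G)) hb0 1 one_pos ?_).trans (by simpa using hE)
      intro G hG
      obtain ⟨m, hm⟩ := badT_int (cliqueHyp n r G)
      have h1 : 0 < badT (cliqueHyp n r G) := lt_trans (by positivity) hG
      rw [hm] at h1 ⊢
      exact_mod_cast h1
    · refine (markov hp0 hp1 _ (fun G => badT (cliqueHyp n r G)) hb0 (l * Bd n r p) (by positivity)
        (fun G hG => le_of_lt hG)).trans ?_
      rw [div_le_div_iff₀ (by positivity) (by positivity)]
      have : 0 < l := by linarith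
      nlinarith
  have hτ : 1 - (tau1 n r p a + m4) ≤ gnpProb n p {G | cliqueHyp n r G ∈ T} := by
    rw [gnp_compl]
    have hsub : {G | cliqueHyp n r G ∈ T}ᶜ ⊆
        (({G | a ≤ |∑ h ∈ cliqueHyp n r G, (fun _ => A) h - PI r p * ∑ h ∈ rsets n r, (fun _ => A) h|} ∪
        {G | a ≤ |∑ h ∈ cliqueHyp n r G, aW n r p h - PI r p * ∑ h ∈ rsets n r, aW n r p h|}) ∪
        {G | a ≤ X1 n r p (cliqueHyp n r G)}) ∪ {G | l * Bd n r p < badT (cliqueHyp n r G)} := by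
      intro G hG
      by_contra hcon
      simp only [Set.mem_union, Set.mem_ofPred_eq, not_or, not_le, not_lt] at hcon
      obtain ⟨⟨⟨h1, h2⟩, h3⟩, h4⟩ := hcon
      apply hG
      refine Finset.mem_filter.2 ⟨Finset.mem_powerset.2 (cliqueHyp_sub n r G), ?_, ?_, h3.le, h4⟩
      · have h5 := (abs_lt.1 h1).1
        have h6 : PI r p * ∑ h ∈ rsets n r, A = muR n r p * A := by
          simp [card_rsets, muR, PI]; ring
        rw [h6] at h5
        simp only [Finset.sum_const, nsmul_eq_mul] at h5
        linarith
      · have h5 := (abs_lt.1 h2).2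
        rw [sum_aW hr] at h5
        exact h5.le
    have h1 := gnp_mono hp0 hp1 hsub
    have h2 := gnp_union hp0 hp1 ((({G | a ≤ |∑ h ∈ cliqueHyp n r G, (fun _ => A) h - PI r p * ∑ h ∈ rsets n r, (fun _ => A) h|} ∪
        {G | a ≤ |∑ h ∈ cliqueHyp n r G, aW n r p h - PI r p * ∑ h ∈ rsets n r, aW n r p h|}) ∪
        {G | a ≤ X1 n r p (cliqueHyp n r G)})) {G | l * Bd n r p < badT (cliqueHyp n r G)}
    have h3 := gnp_union hp0 hp1 (({G | a ≤ |∑ h ∈ cliqueHyp n r G, (fun _ => A) h - PI r p * ∑ h ∈ rsets n r, (fun _ => A) h|} ∪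
        {G | a ≤ |∑ h ∈ cliqueHyp n r G, aW n r p h - PI r p * ∑ h ∈ rsets n r, aW n r p h|}))
        {G | a ≤ X1 n r p (cliqueHyp n r G)}
    have h4 := gnp_union hp0 hp1 ({G | a ≤ |∑ h ∈ cliqueHyp n r G, (fun _ => A) h - PI r p * ∑ h ∈ rsets n r, (fun _ => A) h|})
        {G | a ≤ |∑ h ∈ cliqueHyp n r G, aW n r p h - PI r p * ∑ h ∈ rsets n r, aW n r p h|}
    have h5 : tau1 n r p a = 2 * (A ^ 2 * (muR n r p + DD n r p) / a ^ 2) + x1 n r p / a := rfl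
    rw [h5]
    linarith
  have hcomb := combine hp0 hp1 T (tau1 n r p a + m4) η l hη0 hl hup hsum hτ hτη (by linarith)
  refine ⟨T.filter (fun H => FF n r p H * Real.exp (- (l * η)) ≤ PH n r p H), ?_, ?_, ?_⟩
  · intro H hH
    exact hTsub H (Finset.mem_filter.1 hH).1
  · refine le_trans ?_ hcomb
    have h1 : m4 ≤ 1 / l := min_le_right _ _
    have h2 : (4:ℝ) / l = 1 / l + 3 / l := by ring
    rw [h2]; linarith
  · intro H hH
    rw [Finset.mem_filter] at hH
    have hF : 0 < FF n r p H := by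
      have : 0 < 1 - PI r p := by linarith
      unfold FF; positivity
    have hP : 0 < PH n r p H := lt_of_lt_of_le (by positivity) hH.2
    have h1 := hup H hH.1
    refine ⟨Real.log (PH n r p H / FF n r p H), ?_, ?_⟩
    · rw [abs_le]
      constructor
      · rw [Real.le_log_iff_exp_le (by positivity), le_div_iff₀ hF]
        linarith [hH.2]
      · have h2 : Real.log (PH n r p H / FF n r p H) ≤ η := by
          rw [Real.log_le_iff_le_exp (by positivity), div_le_iff₀ hF]
          linarith
        exact h2.trans (le_mul_of_one_le_left hη0.le hl)
    · rw [Real.exp_log (by positivity)]; field_simp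


lemma choose_sub_nat (n r s : ℕ) (hs : s ≤ r) (hr : r ≤ n) :
    (n - s).choose (r - s) * n ^ s ≤ n.choose r * r ^ s := by
  induction s with
  | zero => simp
  | succ s ih =>
    have ih := ih (by omega)
    obtain ⟨b, rfl⟩ : ∃ b, r = s + 1 + b := ⟨r - (s+1), by omega⟩
    obtain ⟨c, rfl⟩ : ∃ c, n = s + 1 + b + c := ⟨n - (s+1+b), by omega⟩
    have e1 : s + 1 + b + c - (s + 1) = b + c := by omega
    have e2 : s + 1 + b - (s + 1) = b := by omega
    have e3 : s + 1 + b + c - s = (b + c) + 1 := by omega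
    have e4 : s + 1 + b - s = b + 1 := by omega
    rw [e1, e2]
    rw [e3, e4] at ih
    have h1 := Nat.add_one_mul_choose_eq (b + c) b
    have h2 : (b + 1) * (s + 1 + b + c) ≤ (s + 1 + b) * (b + c + 1) := by
      nlinarith [Nat.zero_le (s * c)]
    refine le_of_mul_le_mul_left (a := b + c + 1) ?_ (Nat.succ_pos _)
    calc (b + c + 1) * ((b + c).choose b * (s + 1 + b + c) ^ (s + 1))
        = ((b + c + 1) * (b + c).choose b) * ((s + 1 + b + c) ^ s * (s + 1 + b + c)) := by
          rw [pow_succ]; ring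
      _ = ((b + c + 1).choose (b + 1) * (s + 1 + b + c) ^ s) * ((b + 1) * (s + 1 + b + c)) := by
          rw [h1]; ring
      _ ≤ ((s + 1 + b + c).choose (s + 1 + b) * (s + 1 + b) ^ s)
            * ((s + 1 + b) * (b + c + 1)) := Nat.mul_le_mul ih h2
      _ = _ := by rw [pow_succ (s + 1 + b)]; ring

lemma choose_sub_real (n r s : ℕ) (hs : s ≤ r) (hr : r ≤ n) (hn : 0 < n) :
    ((n - s).choose (r - s) : ℝ) ≤ (n.choose r : ℝ) * ((r : ℝ) / n) ^ s := by
  have h := choose_sub_nat n r s hs hr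
  have h' : ((n - s).choose (r - s) : ℝ) * (n : ℝ) ^ s ≤ (n.choose r : ℝ) * (r : ℝ) ^ s := by
    exact_mod_cast h
  have hn' : (0 : ℝ) < n := by exact_mod_cast hn
  rw [div_pow, ← mul_div_assoc, le_div_iff₀ (by positivity)]
  exact h'

lemma choose_lower (n r : ℕ) (hr : r ≤ n) (hr0 : 0 < r) :
    ((n : ℝ) / r) ^ r ≤ (n.choose r : ℝ) := by
  have h := choose_sub_nat n r r le_rfl hr
  simp only [Nat.sub_self, Nat.choose_zero_right, one_mul] at h
  have h' : (n : ℝ) ^ r ≤ (n.choose r : ℝ) * (r : ℝ) ^ r := by exact_mod_cast h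
  have hr' : (0 : ℝ) < r := by exact_mod_cast hr0
  rw [div_pow, div_le_iff₀ (by positivity)]
  exact h'

lemma two_choose_two (r : ℕ) : 2 * r.choose 2 = r * (r - 1) := by
  rw [Nat.choose_two_right, Nat.two_mul_div_two_of_even (Nat.even_mul_pred_self r)]

noncomputable def qq (p : ℝ) : ℝ := Real.sqrt p

noncomputable def ww (r : ℕ) (p : ℝ) : ℝ := qq p ^ (r - 1)

lemma qq_pos {p : ℝ} (hp : 0 < p) : 0 < qq p := Real.sqrt_pos.2 hp

lemma qq_le {p : ℝ} (hp1 : p < 1) : qq p ≤ 1 := by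
  unfold qq; exact Real.sqrt_le_one.2 hp1.le

lemma qq_sq {p : ℝ} (hp : 0 < p) : qq p ^ 2 = p := Real.sq_sqrt hp.le

lemma p_choose {p : ℝ} (hp : 0 < p) (s : ℕ) : p ^ s.choose 2 = (qq p ^ (s - 1)) ^ s := by
  conv_lhs => rw [← qq_sq hp]
  rw [← pow_mul, ← pow_mul, two_choose_two, mul_comm]

lemma PI_ww {r : ℕ} {p : ℝ} (hp : 0 < p) : PI r p = ww r p ^ r := p_choose hp r

lemma pi_high {p : ℝ} (hp : 0 < p) (s k : ℕ) (hs : 1 ≤ s) (hk : 1 ≤ k) :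
    PI (s + k) p * (p⁻¹) ^ s.choose 2
      = (ww (s + k) p ^ 2 * ((qq p)⁻¹) ^ (k - 1)) ^ k := by
  have hq := qq_pos hp
  rw [PI_ww hp, inv_pow, p_choose hp, inv_pow, mul_pow, inv_pow, ← div_eq_mul_inv,
    ← div_eq_mul_inv, div_eq_div_iff (by positivity) (by positivity)]
  unfold ww
  rw [← pow_mul, ← pow_mul, ← pow_mul, ← pow_mul, ← pow_mul, ← pow_add, ← pow_add]
  congr 1
  obtain ⟨a, rfl⟩ : ∃ a, s = a + 1 := ⟨s - 1, by omega⟩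
  obtain ⟨b, rfl⟩ : ∃ b, k = b + 1 := ⟨k - 1, by omega⟩
  have : a + 1 + (b + 1) - 1 = a + b + 1 := by omega
  rw [this]
  simp only [Nat.add_sub_cancel]
  ring

noncomputable def gs (n r : ℕ) (p : ℝ) (s : ℕ) : ℝ :=
  (r.choose s : ℝ) * ((n - r).choose (r - s) : ℝ) * (PI r p * (p⁻¹) ^ s.choose 2)

lemma Del3_le {n r : ℕ} {p : ℝ} (hp : 0 < p) :
    Del3 n r p ≤ muR n r p * ∑ s ∈ Finset.Ico 3 r, gs n r p s := by
  have hin : ∀ S ∈ rsets n r, (∑ T ∈ rsets n r,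
      if T ≠ S ∧ 3 ≤ (S ∩ T).card then p ^ (ed S ∪ ed T).card else 0)
      ≤ PI r p * ∑ s ∈ Finset.Ico 3 r, gs n r p s := by
    intro S hS
    have hSc := mem_rsets.1 hS
    have h1 : ∀ T ∈ rsets n r, (if T ≠ S ∧ 3 ≤ (S ∩ T).card then p ^ (ed S ∪ ed T).card else 0)
        ≤ ∑ s ∈ Finset.Ico 3 r, if (S ∩ T).card = s then PI r p ^ 2 * (p⁻¹) ^ s.choose 2 else 0 := by
      intro T hT
      have hTc := mem_rsets.1 hT
      rw [Finset.sum_ite_eq]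
      by_cases h : T ≠ S ∧ 3 ≤ (S ∩ T).card
      · have hlt : (S ∩ T).card < r := by
          rw [← hSc]
          apply Finset.card_lt_card
          refine ⟨Finset.inter_subset_left, fun hsub => h.1 ?_⟩
          have : S ⊆ T := fun x hx => (Finset.mem_inter.1 (hsub hx)).2
          exact (Finset.eq_of_subset_of_card_le this (by rw [hSc, hTc])).symm
        rw [if_pos h, if_pos (Finset.mem_Ico.2 ⟨h.2, hlt⟩)]
        have hc := card_ed_union S T
        rw [hSc, hTc] at hc
        apply le_of_eq
        unfold PI
        rw [inv_pow, ← div_eq_mul_inv, eq_div_iff (by positivity), ← pow_add, hc, ← pow_mul]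
        congr 1; ring
      · rw [if_neg h]
        split_ifs
        · unfold PI; positivity
        · exact le_rfl
    refine (Finset.sum_le_sum h1).trans ?_
    rw [Finset.sum_comm, Finset.mul_sum]
    apply le_of_eq
    apply Finset.sum_congr rfl
    intro s hs
    rw [← Finset.sum_filter, Finset.sum_const, nsmul_eq_mul,
      card_inter_eq S hS s (Finset.mem_Ico.1 hs).2.le]
    unfold gs
    push_cast
    ring
  unfold Del3
  refine (Finset.sum_le_sum hin).trans ?_
  rw [Finset.sum_const, nsmul_eq_mul, card_rsets]
  unfold muR PI
  rw [mul_assoc]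

structure Good (n r : ℕ) (p a l B : ℝ) : Prop where
  hp0 : 0 < p
  hp1 : p < 1
  hr : 3 ≤ r
  hB : 1 ≤ B
  hu : p⁻¹ ≤ B
  hX : (B * r) ^ 6 ≤ n
  hw1 : ww r p ≤ B * r / n
  hw2 : 1 ≤ ww r p * n
  ha : 0 < a
  ha2 : a ^ 2 ≤ n
  hmu : muR n r p ≤ B * (n * a)
  hl : l ≤ B * r
  hl1 : 1 ≤ l

namespace Good
variable {n r : ℕ} {p a l B : ℝ}

lemma r3 (h : Good n r p a l B) : (3:ℝ) ≤ r := by exact_mod_cast h.hr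

lemma X3 (h : Good n r p a l B) : 3 ≤ B * r := by nlinarith [h.r3, h.hB]

lemma rX (h : Good n r p a l B) : (r:ℝ) ≤ B * r := by nlinarith [h.r3, h.hB]

lemma BX (h : Good n r p a l B) : B ≤ B * r := by nlinarith [h.r3, h.hB]

lemma Xn (h : Good n r p a l B) : 3 * (B * r) ≤ n := by
  have h1 := h.X3
  have h2 : 3 * (B * r) ≤ (B * r) ^ 6 := by
    have : (1:ℝ) ≤ (B * r) ^ 4 := one_le_pow₀ (by linarith)
    calc 3 * (B * r) ≤ (B * r) * (B * r) := by nlinarith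
      _ = (B * r)^2 * 1 := by ring
      _ ≤ (B * r)^2 * (B * r)^4 := by gcongr
      _ = _ := by ring
  linarith [h.hX]

lemma n9 (h : Good n r p a l B) : (9:ℝ) ≤ n := by linarith [h.Xn, h.X3]

lemma n0 (h : Good n r p a l B) : (0:ℝ) < n := by linarith [h.n9]

lemma rn3 (h : Good n r p a l B) : 3 * r ≤ n := by
  have : 3 * (r:ℝ) ≤ n := by linarith [h.Xn, h.rX]
  exact_mod_cast this

lemma a_le (h : Good n r p a l B) : a ≤ n := by
  have := h.ha2; have := h.n9; have := h.ha
  by_contra hc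
  push Not at hc
  nlinarith

/-- `C(n-s,r-s) π ≤ μ (r/n)^s` -/
lemma choose_mu (h : Good n r p a l B) (s : ℕ) (hs : s ≤ r) :
    PI r p * ((n - s).choose (r - s) : ℝ) ≤ muR n r p * ((r : ℝ) / n) ^ s := by
  have h1 := choose_sub_real n r s hs (by have := h.rn3; omega) (by exact_mod_cast h.n0)
  calc PI r p * ((n - s).choose (r - s) : ℝ)
      ≤ PI r p * ((n.choose r : ℝ) * ((r : ℝ) / n) ^ s) :=
        mul_le_mul_of_nonneg_left h1 (PI_pos h.hp0).le
    _ = _ := by unfold muR PI; ring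

lemma choose_mu' (h : Good n r p a l B) (s : ℕ) (hs : s ≤ r) :
    PI r p * ((n - r).choose (r - s) : ℝ) ≤ muR n r p * ((r : ℝ) / n) ^ s := by
  refine le_trans ?_ (h.choose_mu s hs)
  apply mul_le_mul_of_nonneg_left _ (PI_pos h.hp0).le
  exact_mod_cast Nat.choose_le_choose (r - s) (by omega)

lemma choose_le_pow' (r s : ℕ) : (r.choose s : ℝ) ≤ (r:ℝ)^s := by
  exact_mod_cast Nat.choose_le_pow r s

lemma X1 (h : Good n r p a l B) : 1 ≤ B * r := by linarith [h.X3]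

lemma lam_le (h : Good n r p a l B) : lam n r p ≤ (B * r)^5 * (a / n) := by
  have hn := h.n0
  have ha := h.ha
  have hB := h.hB
  have hr3 := h.r3
  have h1 := h.choose_mu' 2 (by have := h.hr; omega)
  have h0 : 0 ≤ PI r p * ((n - r).choose (r - 2) : ℝ) := by
    have := PI_pos (r := r) h.hp0; positivity
  calc lam n r p = (r.choose 2 : ℝ) * (PI r p * ((n - r).choose (r - 2) : ℝ)) := by
        unfold lam N2; ring
    _ ≤ (r:ℝ)^2 * (muR n r p * ((r : ℝ) / n) ^ 2) := by
        gcongr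
        exact choose_le_pow' r 2
    _ ≤ (r:ℝ)^2 * ((B * (n * a)) * ((r : ℝ) / n) ^ 2) := by
        gcongr; exact h.hmu
    _ = B * (r:ℝ)^4 * (a / n) := by field_simp
    _ ≤ (B * r) * (B * r)^4 * (a / n) := by
        gcongr
        · exact h.BX
        · exact h.rX
    _ = _ := by ring

lemma yy_le (h : Good n r p a l B) : yy n r p ≤ (B * r)^5 * (a / n) := by
  have hn := h.n0
  have ha := h.ha
  have hB := h.hB
  have hr3 := h.r3
  have hp0 := h.hp0
  have h1 := h.choose_mu 2 (by have := h.hr; omega)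
  have h0 : 0 ≤ PI r p * ((n - 2).choose (r - 2) : ℝ) := by
    have := PI_pos (r := r) h.hp0; positivity
  calc yy n r p = (p⁻¹)^2 * (PI r p * ((n - 2).choose (r - 2) : ℝ)) := by
        unfold yy; ring
    _ ≤ B^2 * (muR n r p * ((r : ℝ) / n) ^ 2) := by
        gcongr
        exact h.hu
    _ ≤ B^2 * ((B * (n * a)) * ((r : ℝ) / n) ^ 2) := by
        gcongr; exact h.hmu
    _ = B^3 * (r:ℝ)^2 * (a / n) := by field_simp
    _ ≤ (B * r)^3 * (B * r)^2 * (a / n) := by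
        gcongr
        · exact h.BX
        · exact h.rX
    _ = _ := by ring

lemma N3_le (h : Good n r p a l B) : PI r p * N3 n r ≤ (B * r)^7 * (a / n^2) := by
  have hn := h.n0
  have ha := h.ha
  have hB := h.hB
  have hr3 := h.r3
  have hp0 := h.hp0
  have h1 := h.choose_mu 3 h.hr
  have h0 : 0 ≤ PI r p * ((n - 3).choose (r - 3) : ℝ) := by
    have := PI_pos (r := r) h.hp0; positivity
  calc PI r p * N3 n r = (r.choose 3 : ℝ) * (PI r p * ((n - 3).choose (r - 3) : ℝ)) := by
        unfold N3; ring
    _ ≤ (r:ℝ)^3 * (muR n r p * ((r : ℝ) / n) ^ 3) := by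
        gcongr
        exact choose_le_pow' r 3
    _ ≤ (r:ℝ)^3 * ((B * (n * a)) * ((r : ℝ) / n) ^ 3) := by
        gcongr; exact h.hmu
    _ = B * (r:ℝ)^6 * (a / n^2) := by field_simp
    _ ≤ (B * r) * (B * r)^6 * (a / n^2) := by
        gcongr
        · exact h.BX
        · exact h.rX
    _ = _ := by ring

lemma ww_pos (h : Good n r p a l B) : 0 < ww r p := pow_pos (qq_pos h.hp0) _

/-- half powers -/
lemma vhalf (h : Good n r p a l B) (j : ℕ) (hj : 2 * j ≤ r - 1) :
    ((qq p)⁻¹) ^ j ≤ Real.sqrt n := by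
  have hq := qq_pos h.hp0
  have hq1 : 1 ≤ (qq p)⁻¹ := (one_le_inv₀ hq).2 (qq_le h.hp1)
  apply Real.le_sqrt_of_sq_le
  rw [← pow_mul]
  have h1 : ((qq p)⁻¹) ^ (j * 2) ≤ ((qq p)⁻¹) ^ (r - 1) := pow_le_pow_right₀ hq1 (by omega)
  have h2 : ((qq p)⁻¹) ^ (r - 1) ≤ n := by
    rw [inv_pow]
    have := h.hw2
    have hw := h.ww_pos
    unfold ww at this hw
    rw [inv_le_iff_one_le_mul₀ hw]
    linarith [mul_comm (qq p ^ (r - 1)) (n:ℝ)]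
  linarith

lemma gs_low (h : Good n r p a l B) (s : ℕ) (hs3 : 3 ≤ s) (hsr : s ≤ r) (hs : 2 * (s - 1) ≤ r - 1) :
    gs n r p s ≤ (B * r)^13 / n := by
  have hn := h.n0
  have ha := h.ha
  have hB := h.hB
  have hr3 := h.r3
  have hp0 := h.hp0
  have hq := qq_pos h.hp0
  have hX := h.X1
  have hsq : Real.sqrt n ^ 2 = n := Real.sq_sqrt hn.le
  have hs0 : 0 < Real.sqrt n := Real.sqrt_pos.2 hn
  have hq1 : 1 ≤ (qq p)⁻¹ := (one_le_inv₀ hq).2 (qq_le h.hp1)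
  have h1 := h.choose_mu' s hsr
  have hX3 : (B * r)^3 ≤ Real.sqrt n := by
    apply Real.le_sqrt_of_sq_le
    rw [← pow_mul]; exact h.hX
  have h0 : 0 ≤ PI r p * ((n - r).choose (r - s) : ℝ) := by
    have := PI_pos (r := r) h.hp0; positivity
  set x : ℝ := (r:ℝ)^2 / n * ((qq p)⁻¹)^(s-1) with hx
  have hx0 : 0 ≤ x := by positivity
  have hg : gs n r p s ≤ muR n r p * x ^ s := by
    calc gs n r p s = (r.choose s : ℝ) * (PI r p * ((n - r).choose (r - s) : ℝ))
          * (p⁻¹) ^ s.choose 2 := by unfold gs; ring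
      _ ≤ (r:ℝ)^s * (muR n r p * ((r : ℝ) / n) ^ s) * (p⁻¹) ^ s.choose 2 := by
          gcongr
          exact choose_le_pow' r s
      _ = muR n r p * x ^ s := by
          rw [inv_pow, p_choose hp0, hx, mul_pow, inv_pow, inv_pow, div_pow, div_pow]
          ring
  have hxs : x ^ s ≤ (B * r)^12 / n^3 := by
    by_cases h5 : s ≤ 5
    · have hv : ((qq p)⁻¹)^(s-1) ≤ B^2 := by
        calc ((qq p)⁻¹)^(s-1) ≤ ((qq p)⁻¹)^4 := pow_le_pow_right₀ hq1 (by omega)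
          _ = (p⁻¹)^2 := by
            rw [inv_pow, inv_pow, show qq p ^ 4 = (qq p ^ 2) ^ 2 by ring, qq_sq hp0]
          _ ≤ B^2 := by gcongr; exact h.hu
      have hx2 : x ≤ (B * r)^2 / n := by
        calc x ≤ (r:ℝ)^2 / n * B^2 := by rw [hx]; gcongr
          _ = _ := by ring
      have hx1 : x ≤ 1 := by
        refine hx2.trans ?_
        rw [div_le_one hn]
        exact (pow_le_pow_right₀ hX (by norm_num)).trans h.hX
      calc x ^ s ≤ x ^ 3 := pow_le_pow_of_le_one hx0 hx1 hs3
        _ ≤ ((B * r)^2 / n)^3 := by gcongr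
        _ = (B * r)^6 / n^3 := by rw [div_pow]; ring
        _ ≤ (B * r)^12 / n^3 := by
          gcongr
          norm_num
    · have hv := h.vhalf (s-1) hs
      have hx2 : x ≤ (B * r)^2 / Real.sqrt n := by
        calc x ≤ (B * r)^2 / n * Real.sqrt n := by
              rw [hx]; gcongr; exact h.rX
          _ = (B * r)^2 / (Real.sqrt n)^2 * Real.sqrt n := by rw [hsq]
          _ = _ := by field_simp
      have hx1 : x ≤ 1 := by
        refine hx2.trans ?_
        rw [div_le_one hs0]
        exact (pow_le_pow_right₀ hX (by norm_num)).trans hX3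
      calc x ^ s ≤ x ^ 6 := pow_le_pow_of_le_one hx0 hx1 (by omega)
        _ ≤ ((B * r)^2 / Real.sqrt n)^6 := by gcongr
        _ = (B * r)^12 / ((Real.sqrt n)^2)^3 := by rw [div_pow]; ring
        _ = _ := by rw [hsq]
  calc gs n r p s ≤ muR n r p * x ^ s := hg
    _ ≤ (B * (n * a)) * ((B * r)^12 / n^3) := by
        have := muR_nonneg (n := n) (r := r) hp0
        gcongr; exact h.hmu
    _ ≤ ((B * r) * (n * n)) * ((B * r)^12 / n^3) := by
        gcongr
        · exact h.BX
        · exact h.a_le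
    _ = _ := by field_simp

lemma gs_high (h : Good n r p a l B) (s k : ℕ) (hs1 : 1 ≤ s) (hk1 : 1 ≤ k) (hsk : s + k = r)
    (hk : 2 * (k - 1) ≤ r - 1) :
    gs n r p s ≤ (B * r)^13 / n := by
  have hn := h.n0
  have ha := h.ha
  have hB := h.hB
  have hr3 := h.r3
  have hp0 := h.hp0
  have hq := qq_pos h.hp0
  have hX := h.X1
  have hww := h.ww_pos
  have hsq : Real.sqrt n ^ 2 = n := Real.sq_sqrt hn.le
  have hs0 : 0 < Real.sqrt n := Real.sqrt_pos.2 hn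
  have hX3 : (B * r)^3 ≤ Real.sqrt n := by
    apply Real.le_sqrt_of_sq_le
    rw [← pow_mul]; exact h.hX
  set z : ℝ := r * n * (ww r p ^ 2 * ((qq p)⁻¹) ^ (k - 1)) with hz
  have hz0 : 0 ≤ z := by positivity
  have hz2 : z ≤ (B * r)^3 / n * ((qq p)⁻¹) ^ (k - 1) := by
    calc z ≤ (B * r) * n * ((B * r / n) ^ 2 * ((qq p)⁻¹) ^ (k - 1)) := by
          rw [hz]; gcongr
          · exact h.rX
          · exact h.hw1
      _ = _ := by field_simp
  have hg : gs n r p s ≤ z ^ k := by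
    have hch : (r.choose s : ℝ) ≤ (r:ℝ)^k := by
      rw [← Nat.choose_symm (by omega : s ≤ r), show r - s = k by omega]
      exact choose_le_pow' r k
    have hch2 : ((n - r).choose (r - s) : ℝ) ≤ (n:ℝ)^k := by
      rw [show r - s = k by omega]
      refine (choose_le_pow' (n - r) k).trans ?_
      gcongr
      omega
    calc gs n r p s = (r.choose s : ℝ) * ((n - r).choose (r - s) : ℝ)
          * (ww r p ^ 2 * ((qq p)⁻¹) ^ (k - 1)) ^ k := by
          unfold gs
          have := pi_high hp0 s k hs1 hk1
          rw [hsk] at this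
          rw [this]
      _ ≤ (r:ℝ)^k * (n:ℝ)^k * (ww r p ^ 2 * ((qq p)⁻¹) ^ (k - 1)) ^ k := by gcongr
      _ = _ := by rw [hz, mul_pow (r * n : ℝ), mul_pow (r : ℝ)]
  by_cases hk2 : k = 1
  · subst hk2
    simp only [Nat.sub_self, pow_zero, mul_one] at hz2
    simp only [pow_one] at hg
    refine hg.trans (hz2.trans ?_)
    gcongr
    norm_num
  · have hv := h.vhalf (k-1) hk
    have hz3 : z ≤ (B * r)^3 / Real.sqrt n := by
      calc z ≤ (B * r)^3 / n * Real.sqrt n := by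
            refine hz2.trans ?_; gcongr
        _ = (B * r)^3 / (Real.sqrt n)^2 * Real.sqrt n := by rw [hsq]
        _ = _ := by field_simp
    have hz1 : z ≤ 1 := hz3.trans ((div_le_one hs0).2 hX3)
    calc gs n r p s ≤ z ^ k := hg
      _ ≤ z ^ 2 := pow_le_pow_of_le_one hz0 hz1 (by omega)
      _ ≤ ((B * r)^3 / Real.sqrt n) ^ 2 := by gcongr
      _ = (B * r)^6 / n := by rw [div_pow, hsq]; ring
      _ ≤ _ := by
        gcongr
        norm_num

lemma Del3_le' (h : Good n r p a l B) : Del3 n r p ≤ (B * r)^15 * a := by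
  have hn := h.n0
  have ha := h.ha
  have hB := h.hB
  have hr3 := h.r3
  have hmu0 := muR_nonneg (n := n) (r := r) h.hp0
  have hsum : ∑ s ∈ Finset.Ico 3 r, gs n r p s ≤ r * ((B * r)^13 / n) := by
    calc ∑ s ∈ Finset.Ico 3 r, gs n r p s ≤ ∑ s ∈ Finset.Ico 3 r, (B * r)^13 / n := by
          apply Finset.sum_le_sum
          intro s hs
          have hs := Finset.mem_Ico.1 hs
          by_cases hlo : 2 * (s - 1) ≤ r - 1
          · exact h.gs_low s hs.1 hs.2.le hlo
          · exact h.gs_high s (r - s) (by omega) (by omega) (by omega) (by omega)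
      _ = ((r - 3 : ℕ) : ℝ) * ((B * r)^13 / n) := by
          rw [Finset.sum_const, Nat.card_Ico, nsmul_eq_mul]
      _ ≤ _ := by
          gcongr; omega
  calc Del3 n r p ≤ muR n r p * ∑ s ∈ Finset.Ico 3 r, gs n r p s := Del3_le h.hp0
    _ ≤ (B * (n * a)) * (r * ((B * r)^13 / n)) := by
        have : 0 ≤ ∑ s ∈ Finset.Ico 3 r, gs n r p s := by
          apply Finset.sum_nonneg
          intro s _
          unfold gs
          have := PI_pos (r := r) h.hp0
          have := h.hp0
          positivity
        gcongr
        exact h.hmu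
    _ = (B * r)^14 * a := by field_simp
    _ ≤ _ := by
        gcongr
        · exact h.X1
        · norm_num

lemma PI_le (h : Good n r p a l B) : PI r p ≤ (B * r)^2 / n^2 := by
  have hn := h.n0
  have hw := h.ww_pos
  have hw1 : ww r p ≤ 1 := pow_le_one₀ (qq_pos h.hp0).le (qq_le h.hp1)
  rw [PI_ww h.hp0]
  calc ww r p ^ r ≤ ww r p ^ 2 := pow_le_pow_of_le_one hw.le hw1 (by have := h.hr; omega)
    _ ≤ (B * r / n)^2 := by gcongr; exact h.hw1
    _ = _ := by rw [div_pow]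

lemma logPI_le (h : Good n r p a l B) : - Real.log (PI r p) ≤ (B * r)^3 := by
  have hp0 := h.hp0
  have hB := h.hB
  have hr3 := h.r3
  unfold PI
  rw [Real.log_pow, ← mul_neg, ← Real.log_inv]
  have h1 : Real.log p⁻¹ ≤ B := by
    have := Real.log_le_sub_one_of_pos (inv_pos.2 hp0)
    linarith [h.hu]
  have h0 : 0 ≤ Real.log p⁻¹ := Real.log_nonneg ((one_le_inv₀ hp0).2 h.hp1.le)
  calc (r.choose 2 : ℝ) * Real.log p⁻¹ ≤ (r:ℝ)^2 * B := by
        gcongr; exact choose_le_pow' r 2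
    _ ≤ (B * r)^2 * (B * r) := by
        gcongr
        · exact h.rX
        · exact h.BX
    _ = _ := by ring

end Good


namespace Good
variable {n r : ℕ} {p a l B : ℝ}

lemma div_n (h : Good n r p a l B) : a / n ≤ 1 := (div_le_one h.n0).2 h.a_le

lemma sq_div_n (h : Good n r p a l B) : a ^ 2 / n ≤ 1 := (div_le_one h.n0).2 h.ha2

/-- all pieces in terms of one polylog factor -/
lemma pieces (h : Good n r p a l B) : ∃ Q : ℝ, Q = (B * r)^15 ∧ 1 ≤ Q ∧ p⁻¹ ≤ Q ∧ l ≤ Q ∧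
    - Real.log (PI r p) ≤ Q ∧ muR n r p ≤ Q * (n * a) ∧ lam n r p ≤ Q * (a / n) ∧
    yy n r p ≤ Q * (a / n) ∧ PI r p * N3 n r ≤ Q * (a / n^2) ∧ Del3 n r p ≤ Q * a ∧
    PI r p ≤ Q / n := by
  have hX := h.X1
  have hn := h.n0
  have ha := h.ha
  have hXQ : ∀ k : ℕ, k ≤ 15 → (B * r)^k ≤ (B * r)^15 := fun k hk => pow_le_pow_right₀ hX hk
  have h1 := hXQ 1 (by norm_num)
  rw [pow_one] at h1
  have hBQ : B ≤ (B * r)^15 := h.BX.trans h1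
  refine ⟨_, rfl, one_le_pow₀ hX, h.hu.trans hBQ, h.hl.trans h1,
    h.logPI_le.trans (hXQ 3 (by norm_num)), h.hmu.trans ?_, h.lam_le.trans ?_, h.yy_le.trans ?_,
    h.N3_le.trans ?_, h.Del3_le', h.PI_le.trans ?_⟩
  · gcongr
  · gcongr ?_ * _; exact hXQ 5 (by norm_num)
  · gcongr ?_ * _; exact hXQ 5 (by norm_num)
  · gcongr ?_ * _; exact hXQ 7 (by norm_num)
  · have hn9 := h.n9
    gcongr ?_ / ?_
    · exact hXQ 2 (by norm_num)
    · nlinarith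

set_option maxHeartbeats 2000000 in
lemma bounds (h : Good n r p a l B) :
    tau1 n r p a ≤ 100 * ((B * r)^15)^9 * ((a + a^2) / n) ∧
    l * eta n r p a l ≤ 100 * ((B * r)^15)^9 * a + 100 * ((B * r)^15)^9 * ((a + a^2) / n) := by
  obtain ⟨Q, hQe, hQ, hu, hl, hL, hmu, hlam, hyy, hN3, hD3, hPI⟩ := h.pieces
  rw [← hQe]
  have hn := h.n0
  have hn9 := h.n9
  have ha := h.ha
  have hp0 := h.hp0
  have hl1 := h.hl1
  have hu1 : 1 ≤ p⁻¹ := (one_le_inv₀ hp0).2 h.hp1.le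
  have hlam0 := lam_nonneg (n := n) (r := r) hp0
  have hmu0 := muR_nonneg (n := n) (r := r) hp0
  have hD30 := Del3_nonneg (n := n) (r := r) hp0
  have hN30 := N3_nonneg (n := n) (r := r)
  have hDD0 := DD_nonneg (n := n) (r := r) hp0
  have hyy0 := yy_nonneg (n := n) (r := r) hp0
  have hPI0 := (PI_pos (r := r) hp0).le
  have hL0 : 0 ≤ - Real.log (PI r p) := by
    have : Real.log (PI r p) ≤ 0 := Real.log_nonpos hPI0 (pow_le_one₀ hp0.le h.hp1.le)
    linarith
  have hPN0 : 0 ≤ PI r p * N3 n r := by positivity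
  have han := h.div_n
  have ha2n := h.sq_div_n
  have hdf : DD n r p = muR n r p * lam n r p * p⁻¹ + Del3 n r p := rfl
  set D := DD n r p
  set L := - Real.log (PI r p)
  set m := muR n r p
  set y := lam n r p
  set Y := yy n r p
  set d3 := Del3 n r p
  set u := p⁻¹
  have hQk : ∀ j k : ℕ, j ≤ k → Q ^ j ≤ Q ^ k := fun j k hjk => pow_le_pow_right₀ hQ hjk
  have hQ0 : 0 ≤ Q := by linarith
  -- E = (a + a^2)/n
  set E : ℝ := (a + a^2) / n with hE
  have hE0 : 0 ≤ E := by positivity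
  have hE2 : E ≤ 2 := by rw [hE, add_div]; linarith
  have haE : a / n ≤ E := by rw [hE]; gcongr; linarith [sq_nonneg a]
  have ha2E : a^2 / n ≤ E := by rw [hE]; gcongr; linarith
  have hD : D ≤ 2 * Q^3 * (a + a^2) := by
    have e1 : m * y * u ≤ Q^3 * a^2 := by
      calc m * y * u ≤ (Q * (n * a)) * (Q * (a / n)) * Q := by gcongr
        _ = _ := by field_simp
    have e2 : Q * a ≤ Q^3 * a := by
      have := hQk 1 3 (by norm_num); rw [pow_one] at this; gcongr
    have : 0 ≤ Q^3 * a := by positivity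
    have : 0 ≤ Q^3 * a^2 := by positivity
    rw [hdf]; linarith
  have hy2 : m * y^2 ≤ Q^3 * (a * E) := by
    calc m * y^2 ≤ (Q * (n * a)) * (Q * (a / n))^2 := by gcongr
      _ = Q^3 * (a * (a^2 / n)) := by field_simp
      _ ≤ _ := by gcongr
  have hDy : D * y ≤ 2 * Q^4 * (a * E) := by
    calc D * y ≤ (2 * Q^3 * (a + a^2)) * (Q * (a / n)) := by gcongr
      _ = _ := by rw [hE]; field_simp
  have hYQ : Y ≤ Q := hyy.trans (mul_le_of_le_one_right hQ0 han)
  have haE0 : 0 ≤ a * E := by positivity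
  -- Bd
  have hBd : Bd n r p ≤ 7 * Q^6 * a := by
    have e1 : u^2 * (m * y^2 + D * y) ≤ Q^2 * (3 * Q^4 * (a * E)) := by
      gcongr
      have := mul_le_mul_of_nonneg_right (hQk 3 4 (by norm_num)) haE0
      linarith
    have e2 : Q * a ≤ Q^6 * a := by
      have := hQk 1 6 (by norm_num); rw [pow_one] at this; gcongr
    have e3 : Q^2 * (3 * Q^4 * (a * E)) ≤ 6 * Q^6 * a := by
      calc Q^2 * (3 * Q^4 * (a * E)) = 3 * Q^6 * a * E := by ring
        _ ≤ 3 * Q^6 * a * 2 := by gcongr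
        _ = _ := by ring
    change d3 + u^2 * (m * y^2 + D * y) ≤ _
    linarith
  have hBd0 : 0 ≤ Bd n r p := by
    change 0 ≤ d3 + u^2 * (m * y^2 + D * y)
    positivity
  have hdet : det1 n r p ≤ 3 * Q^4 * a := by
    change (1/2) * Y * m * y + (1/2) * (1 + Y) * u^2 * d3 ≤ _
    have e1 : (1/2) * Y * m * y ≤ 1 * Q^4 * a := by
      calc (1/2) * Y * m * y ≤ 1 * (Q * (a / n)) * (Q * (n * a)) * (Q * (a / n)) := by
            gcongr; norm_num
        _ = Q^3 * a * (a^2 / n) := by field_simp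
        _ ≤ Q^3 * a * 1 := by gcongr
        _ ≤ 1 * Q^4 * a := by
          have := mul_le_mul_of_nonneg_right (hQk 3 4 (by norm_num)) ha.le
          linarith
    have e2 : (1/2) * (1 + Y) * u^2 * d3 ≤ 1 * Q^4 * a := by
      calc (1/2) * (1 + Y) * u^2 * d3 ≤ (1/2) * (Q + Q) * Q^2 * (Q * a) := by gcongr
        _ = _ := by ring
    have : 0 ≤ Q^4 * a := by positivity
    linarith
  have hx1 : x1 n r p ≤ 16 * Q^6 * (a * E) := by
    change 2 * u * (m * y^2 + D * y) + (2 * u * (PI r p * N3 n r) + (u + Y) * u^2 * y^2) * m ≤ _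
    have e1 : 2 * u * (m * y^2 + D * y) ≤ 6 * Q^6 * (a * E) := by
      calc 2 * u * (m * y^2 + D * y) ≤ 2 * Q * (3 * Q^4 * (a * E)) := by
            gcongr
            have := mul_le_mul_of_nonneg_right (hQk 3 4 (by norm_num)) haE0
            linarith
        _ = 6 * (Q^5 * (a * E)) := by ring
        _ ≤ 6 * (Q^6 * (a * E)) := by
            gcongr
            norm_num
        _ = _ := by ring
    have e2 : 2 * u * (PI r p * N3 n r) * m ≤ 2 * Q^6 * (a * E) := by
      calc 2 * u * (PI r p * N3 n r) * m ≤ 2 * Q * (Q * (a / n^2)) * (Q * (n * a)) := by gcongr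
        _ = 2 * Q^3 * (a * (a / n)) := by field_simp
        _ ≤ 2 * Q^6 * (a * E) := by
            gcongr
            norm_num
    have e3 : (u + Y) * u^2 * y^2 * m ≤ 2 * Q^6 * (a * E) := by
      calc (u + Y) * u^2 * y^2 * m ≤ (Q + Q) * Q^2 * (Q * (a / n))^2 * (Q * (n * a)) := by gcongr
        _ = 2 * Q^6 * (a * (a^2 / n)) := by field_simp; ring
        _ ≤ 2 * Q^6 * (a * E) := by gcongr
    have : 0 ≤ Q^6 * (a * E) := by positivity
    linarith
  have htau : tau1 n r p a ≤ 26 * Q^7 * E := by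
    change 2 * (((u - 1) * y)^2 * (m + D) / a^2) + x1 n r p / a ≤ _
    have e1 : ((u - 1) * y)^2 * (m + D) / a^2 ≤ 5 * Q^7 * E := by
      rw [div_le_iff₀ (by positivity)]
      calc ((u - 1) * y)^2 * (m + D)
          ≤ (Q * (Q * (a / n)))^2 * (Q * (n * a) + 2 * Q^3 * (a + a^2)) := by
            have : 0 ≤ u - 1 := by linarith
            have : u - 1 ≤ Q := by linarith
            gcongr
        _ ≤ (Q * (Q * (a / n)))^2 * (Q^3 * (n * (a + a^2)) + 2 * Q^3 * (n * (a + a^2))) := by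
            have i1 : Q * (n * a) ≤ Q^3 * (n * (a + a^2)) := by
              have := hQk 1 3 (by norm_num); rw [pow_one] at this
              gcongr; linarith [sq_nonneg a]
            have i2 : 2 * Q^3 * (a + a^2) ≤ 2 * Q^3 * (n * (a + a^2)) := by
              gcongr
              exact le_mul_of_one_le_left (by positivity) (by linarith)
            gcongr
        _ = 3 * Q^7 * E * a^2 := by rw [hE]; field_simp; ring
        _ ≤ _ := by gcongr; norm_num
    have e2 : x1 n r p / a ≤ 16 * Q^7 * E := by
      rw [div_le_iff₀ ha]
      refine hx1.trans ?_
      calc 16 * Q^6 * (a * E) ≤ 16 * Q^7 * (a * E) := by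
            gcongr
            norm_num
        _ = _ := by ring
    linarith
  have ht0 : 0 ≤ Q^7 * E := by positivity
  refine ⟨htau.trans ?_, ?_⟩
  · have := mul_le_mul_of_nonneg_right (hQk 7 9 (by norm_num)) hE0
    have : 0 ≤ Q^9 * E := by positivity
    linarith
  have hPm : 2 * PI r p * m ≤ 2 * Q^8 * a := by
    calc 2 * PI r p * m ≤ 2 * (Q / n) * (Q * (n * a)) := by gcongr
      _ = 2 * Q^2 * a := by field_simp
      _ ≤ _ := by
        gcongr
        norm_num
  have hLB : L * (l * Bd n r p) ≤ 7 * Q^8 * a := by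
    calc L * (l * Bd n r p) ≤ Q * (Q * (7 * Q^6 * a)) := by gcongr
      _ = _ := by ring
  have hQ8 : 1 ≤ Q^8 := one_le_pow₀ hQ
  have heta : eta n r p a l ≤ 21 * Q^8 * a + 26 * Q^8 * E := by
    change 2 * a + det1 n r p + 2 * PI r p * m + L * (l * Bd n r p) + tau1 n r p a + Bd n r p ≤ _
    have i1 := mul_le_mul_of_nonneg_right (hQk 4 8 (by norm_num)) ha.le
    have i2 := mul_le_mul_of_nonneg_right (hQk 6 8 (by norm_num)) ha.le
    have i3 := mul_le_mul_of_nonneg_right (hQk 7 8 (by norm_num)) hE0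
    have i4 := mul_le_mul_of_nonneg_right hQ8 ha.le
    linarith
  calc l * eta n r p a l ≤ l * (21 * Q^8 * a + 26 * Q^8 * E) := by gcongr
    _ ≤ Q * (21 * Q^8 * a + 26 * Q^8 * E) := by gcongr
    _ = 21 * (Q^9 * a) + 26 * (Q^9 * E) := by ring
    _ ≤ _ := by
      have : 0 ≤ Q^9 * E := by positivity
      have : 0 ≤ Q^9 * a := by positivity
      linarith

lemma PI_half (h : Good n r p a l B) : PI r p ≤ 1/2 := by
  have h1 := h.PI_le
  have hn := h.n0
  have h2 := h.Xn
  have h3 := h.X3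
  refine h1.trans ?_
  rw [div_le_iff₀ (by positivity)]
  nlinarith

lemma Bd_pos (h : Good n r p a l B) : 0 < Bd n r p := by
  have hp0 := h.hp0
  have hD30 := Del3_nonneg (n := n) (r := r) hp0
  have hDD0 := DD_nonneg (n := n) (r := r) hp0
  have hr3 := h.hr
  have hrn := h.rn3
  have hlam : 0 < lam n r p := by
    unfold lam N2
    have := PI_pos (r := r) hp0
    have h1 : 0 < r.choose 2 := Nat.choose_pos (by omega)
    have h2 : 0 < (n - r).choose (r - 2) := Nat.choose_pos (by omega)
    positivity
  have hmu : 0 < muR n r p := by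
    unfold muR
    have h1 : 0 < n.choose r := Nat.choose_pos (by omega)
    positivity
  unfold Bd
  positivity

end Good


lemma polylog_le (K : ℝ) (k : ℕ) (δ : ℝ) (hδ : 0 < δ) :
    ∀ᶠ n : ℕ in Filter.atTop, K * (Real.log n) ^ k ≤ (n : ℝ) ^ δ := by
  have h := isLittleO_log_rpow_rpow_atTop (k : ℝ) hδ
  have hK : 0 < (|K| + 1)⁻¹ := by positivity
  have h1 := (h.bound hK)
  have h2 := tendsto_natCast_atTop_atTop (R := ℝ) |>.eventually h1
  filter_upwards [h2, Filter.eventually_ge_atTop 1] with n hn hn1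
  have hn1' : (1:ℝ) ≤ n := by exact_mod_cast hn1
  have hl : 0 ≤ Real.log n := Real.log_nonneg hn1'
  rw [Real.rpow_natCast, Real.norm_of_nonneg (by positivity),
    Real.norm_of_nonneg (by positivity)] at hn
  rw [inv_mul_eq_div, le_div_iff₀ (by positivity)] at hn
  calc K * (Real.log n) ^ k ≤ (Real.log n) ^ k * (|K| + 1) := by
        rw [mul_comm]; gcongr
        linarith [le_abs_self K]
    _ ≤ _ := hn

set_option maxHeartbeats 2000000 in
lemma good_eventually (ε : ℝ) (hε : 0 < ε)
    (p : ℕ → ℝ) (θ : ℕ → ℝ) (r : ℕ → ℕ)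
    (hp : ∀ n, ε < p n ∧ p n < 1 - ε)
    (hθ : ∀ n, -1 + ε ≤ θ n ∧ θ n ≤ 1/2 - ε)
    (hr : Filter.Tendsto (fun n => (r n : ℝ) * Real.log (1 / p n) / (2 * Real.log n))
      Filter.atTop (nhds 1))
    (c₁ c₂ : ℝ) (hc₁ : 0 < c₁) (hc₁₂ : c₁ ≤ c₂)
    (hμ : ∀ n : ℕ, c₁ * (n : ℝ) ^ (1 + θ n) ≤ muR n (r n) (p n) ∧
      muR n (r n) (p n) ≤ c₂ * (n : ℝ) ^ (1 + θ n)) :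
    ∃ A B : ℝ, 0 < A ∧ 1 ≤ B ∧ ∀ᶠ n : ℕ in Filter.atTop,
      Good n (r n) (p n) ((n:ℝ) ^ θ n) (Real.log n) B ∧ (r n : ℝ) ≤ A * Real.log n := by
  have hε2 : ε < 1/2 := by linarith [(hp 0).1, (hp 0).2]
  set D := Real.log (1 / ε) with hD
  have hD0 : 0 < D := Real.log_pos (by rw [lt_div_iff₀ hε]; linarith)
  set D' := Real.log (1 / (1 - ε)) with hD'
  have hD'0 : 0 < D' := Real.log_pos (by rw [lt_div_iff₀ (by linarith)]; linarith)
  set c := max c₂ 1 with hc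
  have hc1 : 1 ≤ c := le_max_right _ _
  have hcc : c₂ ≤ c := le_max_left _ _
  set B := c * Real.exp (3/2 * D) + 1 / ε + D with hB
  have hexp : 1 ≤ Real.exp (3/2 * D) := Real.one_le_exp (by positivity)
  have hε1 : 0 < 1 / ε := by positivity
  have hce : c ≤ c * Real.exp (3/2 * D) := by nlinarith
  have hB1 : 1 ≤ B := by linarith
  refine ⟨4 / D', B, by positivity, hB1, ?_⟩
  have hlog : Filter.Tendsto (fun n : ℕ => Real.log n) Filter.atTop Filter.atTop :=
    Real.tendsto_log_atTop.comp tendsto_natCast_atTop_atTop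
  filter_upwards [hr.eventually (lt_mem_nhds (show (1/2:ℝ) < 1 by norm_num)),
    hr.eventually (gt_mem_nhds (show (1:ℝ) < 2 by norm_num)),
    hlog.eventually_ge_atTop 1, hlog.eventually_ge_atTop (3 * D),
    polylog_le ((B * (4 / D'))^6) 6 1 one_pos, polylog_le (1 / c₁) 0 ε hε,
    Filter.eventually_ge_atTop 1] with n h1 h2 hl1 hl3 hpl hc1n hn1
  have hpn := hp n
  have hp0 : 0 < p n := hε.trans hpn.1
  have hp1 : p n < 1 := by linarith
  have hn1' : (1:ℝ) ≤ n := by exact_mod_cast hn1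
  have hn0 : (0:ℝ) < n := by linarith
  have hlp1 : Real.log (1 / p n) ≤ D :=
    Real.log_le_log (by positivity) (one_div_le_one_div_of_le hε hpn.1.le)
  have hlp2 : D' ≤ Real.log (1 / p n) :=
    Real.log_le_log (one_div_pos.2 (by linarith)) (one_div_le_one_div_of_le hp0 hpn.2.le)
  rw [lt_div_iff₀ (by positivity)] at h1
  rw [div_lt_iff₀ (by positivity)] at h2
  have hr0 : (0:ℝ) ≤ r n := Nat.cast_nonneg _
  have hlD : Real.log n ≤ D * r n := by nlinarith
  have hrA : (r n : ℝ) ≤ 4 / D' * Real.log n := by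
    rw [div_mul_eq_mul_div, le_div_iff₀ hD'0]; nlinarith
  have hr3' : (3:ℝ) ≤ r n := by
    by_contra hcon; push Not at hcon; nlinarith
  have hr3 : 3 ≤ r n := by exact_mod_cast hr3'
  have hX : (B * r n) ^ 6 ≤ n := by
    rw [Real.rpow_one] at hpl
    calc (B * r n) ^ 6 ≤ (B * (4 / D' * Real.log n)) ^ 6 := by gcongr
      _ = (B * (4 / D'))^6 * Real.log n ^ 6 := by ring
      _ ≤ n := hpl
  have hBr : (1:ℝ) ≤ B * r n := by nlinarith
  have hrn : r n ≤ n := by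
    have h1 : (B * r n) ≤ (B * r n) ^ 6 := le_self_pow₀ hBr (by norm_num)
    have : (r n : ℝ) ≤ n := by linarith [le_mul_of_one_le_left hr0 hB1]
    exact_mod_cast this
  have hww : 0 < ww (r n) (p n) := pow_pos (qq_pos hp0) _
  have hmuw : muR n (r n) (p n) = (n.choose (r n) : ℝ) * ww (r n) (p n) ^ (r n) := by
    rw [← PI_ww hp0]; rfl
  have hnθ : (n:ℝ) ^ (1 + θ n) = n * (n:ℝ) ^ θ n := by
    rw [Real.rpow_add hn0, Real.rpow_one]
  refine ⟨⟨hp0, hp1, hr3, hB1, ?_, hX, ?_, ?_, by positivity, ?_, ?_, ?_, hl1⟩, hrA⟩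
  · have : (p n)⁻¹ ≤ 1 / ε := by
      rw [← one_div]; exact one_div_le_one_div_of_le hε hpn.1.le
    linarith
  · -- upper bound on w
    have hrpos : (0:ℝ) < r n := by linarith
    have key : ww (r n) (p n) * (n / r n) ≤ B := by
      by_contra hcon
      push Not at hcon
      have e1 : B ^ (r n) < (ww (r n) (p n) * (n / r n)) ^ (r n) :=
        pow_lt_pow_left₀ hcon (by linarith) (by omega)
      have e2 : (ww (r n) (p n) * (n / r n)) ^ (r n) ≤ muR n (r n) (p n) := by
        rw [mul_pow, hmuw, mul_comm]
        gcongr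
        exact choose_lower n (r n) hrn (by omega)
      have e3 : muR n (r n) (p n) ≤ c * (n:ℝ) ^ (3/2 : ℝ) := by
        refine (hμ n).2.trans ?_
        have := (hθ n).2
        gcongr
        linarith
      have e4 : (n:ℝ) ^ (3/2 : ℝ) ≤ Real.exp (3/2 * D) ^ (r n) := by
        rw [Real.rpow_def_of_pos hn0, ← Real.exp_nat_mul]
        apply Real.exp_le_exp.2
        nlinarith
      have e5 : c * Real.exp (3/2 * D) ^ (r n) ≤ B ^ (r n) := by
        calc c * Real.exp (3/2 * D) ^ (r n) ≤ c ^ (r n) * Real.exp (3/2 * D) ^ (r n) := by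
              gcongr
              exact le_self_pow₀ hc1 (by omega)
          _ = (c * Real.exp (3/2 * D)) ^ (r n) := by rw [mul_pow]
          _ ≤ _ := by gcongr; linarith
      have e6 : c * (n:ℝ) ^ (3/2 : ℝ) ≤ c * Real.exp (3/2 * D) ^ (r n) := by gcongr
      linarith
    rw [le_div_iff₀ hn0]
    rw [← mul_div_assoc, div_le_iff₀ hrpos] at key
    exact key
  · -- lower bound on w
    have e1 : 1 ≤ muR n (r n) (p n) := by
      refine le_trans ?_ (hμ n).1
      have e2 : (n:ℝ) ^ ε ≤ (n:ℝ) ^ (1 + θ n) :=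
        Real.rpow_le_rpow_of_exponent_le hn1' (by linarith [(hθ n).1])
      rw [pow_zero, mul_one, div_le_iff₀ hc₁] at hc1n
      nlinarith
    by_contra hcon
    push Not at hcon
    have e2 : (ww (r n) (p n) * n) ^ (r n) < 1 :=
      pow_lt_one₀ (by positivity) hcon (by omega)
    have e3 : muR n (r n) (p n) ≤ (ww (r n) (p n) * n) ^ (r n) := by
      rw [hmuw, mul_pow, mul_comm]
      gcongr
      exact Good.choose_le_pow' n (r n)
    linarith
  · rw [← Real.rpow_natCast, ← Real.rpow_mul hn0.le]
    calc (n:ℝ) ^ (θ n * ((2:ℕ):ℝ)) ≤ (n:ℝ) ^ (1:ℝ) :=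
          Real.rpow_le_rpow_of_exponent_le hn1' (by push_cast; linarith [(hθ n).2])
      _ = n := Real.rpow_one _
  · refine (hμ n).2.trans ?_
    rw [hnθ]
    gcongr
    linarith
  · refine hlD.trans ?_
    gcongr
    have : 0 < c * Real.exp (3/2 * D) := by positivity
    linarith

lemma gnp_le_one {n : ℕ} {p : ℝ} (hp0 : 0 < p) (hp1 : p < 1)
    (A : Set (Finset (Finset (Fin n)))) : gnpProb n p A ≤ 1 := by
  rw [gnp_compl]
  have := gnp_nonneg (n := n) hp0 hp1 Aᶜ
  linarith

theorem clique_distribution_constant_p (ε : ℝ) (hε : 0 < ε)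
    (p : ℕ → ℝ) (θ : ℕ → ℝ) (r : ℕ → ℕ)
    (hp : ∀ n, ε < p n ∧ p n < 1 - ε)
    (hθ : ∀ n, -1 + ε ≤ θ n ∧ θ n ≤ 1/2 - ε)
    (hr : Filter.Tendsto (fun n => (r n : ℝ) * Real.log (1 / p n) / (2 * Real.log n))
      Filter.atTop (nhds 1))
    (c₁ c₂ : ℝ) (hc₁ : 0 < c₁) (hc₁₂ : c₁ ≤ c₂)
    (hμ : ∀ n : ℕ, c₁ * (n : ℝ) ^ (1 + θ n) ≤ muR n (r n) (p n) ∧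
      muR n (r n) (p n) ≤ c₂ * (n : ℝ) ^ (1 + θ n)) :
    ∃ K C c : ℝ, 0 < K ∧ 0 < C ∧ 0 < c ∧
    ∃ 𝒢 : (n : ℕ) → Set (Finset (Finset (Fin n))),
      (∀ n, ∀ H ∈ 𝒢 n, ∀ e ∈ H, e.card = r n) ∧
      Filter.Tendsto (fun n => gnpProb n (p n) {G | cliqueHyp n (r n) G ∈ 𝒢 n})
        Filter.atTop (nhds 1) ∧
      ∀ᶠ n in Filter.atTop, ∀ H ∈ 𝒢 n,
        ∃ δ : ℝ, |δ| ≤ K * ((Real.log n) ^ (C : ℝ) * (n : ℝ) ^ (θ n) + (n : ℝ) ^ (-c)) ∧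
          gnpProb n (p n) {G | cliqueHyp n (r n) G = H} =
            (p n ^ (r n).choose 2) ^ H.card *
              (1 - p n ^ (r n).choose 2) ^ (n.choose (r n) - H.card) *
              p n ^ (-(tHyp n (r n) H)) *
              Real.exp (-(LamP n (r n) (p n)) + δ) := by

  obtain ⟨A, B, hA, hB, hgood⟩ := good_eventually ε hε p θ r hp hθ hr c₁ c₂ hc₁ hc₁₂ hμ
  have hε2 : ε < 1/2 := by linarith [(hp 0).1, (hp 0).2]
  have hp0 : ∀ n, 0 < p n := fun n => hε.trans (hp n).1
  have hp1 : ∀ n, p n < 1 := fun n => by linarith [(hp n).2]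
  set Z : ℝ := (B * A) ^ 135 with hZ
  have hZ0 : 0 < Z := by positivity
  have hex : ∀ n : ℕ, ∃ 𝒢 : Set (Finset (Finset (Fin n))),
      (∀ H ∈ 𝒢, ∀ e ∈ H, e.card = r n) ∧
      (Good n (r n) (p n) ((n:ℝ) ^ θ n) (Real.log n) B →
        1 - tau1 n (r n) (p n) ((n:ℝ) ^ θ n) - 4 / Real.log n
          ≤ gnpProb n (p n) {G | cliqueHyp n (r n) G ∈ 𝒢} ∧
        ∀ H ∈ 𝒢, ∃ δ : ℝ,
          |δ| ≤ Real.log n * eta n (r n) (p n) ((n:ℝ) ^ θ n) (Real.log n) ∧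
          PH n (r n) (p n) H = FF n (r n) (p n) H * Real.exp δ) := by
    intro n
    by_cases hg : Good n (r n) (p n) ((n:ℝ) ^ θ n) (Real.log n) B
    · obtain ⟨𝒢, h1, h2, h3⟩ := finite_main hg.hp0 hg.hp1 hg.hr _ _ hg.ha hg.hl1 hg.PI_half hg.Bd_pos
      refine ⟨(𝒢 : Set _), ?_, fun _ => ⟨?_, ?_⟩⟩
      · intro H hH e he
        exact mem_rsets.1 (h1 H (Finset.mem_coe.1 hH) he)
      · simpa only [Finset.mem_coe] using h2
      · intro H hH
        exact h3 H (Finset.mem_coe.1 hH)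
    · exact ⟨∅, by simp, fun h => absurd h hg⟩
  choose 𝒢 h𝒢u h𝒢 using hex
  -- eventual numeric bounds
  have hnum : ∀ᶠ n : ℕ in Filter.atTop,
      Good n (r n) (p n) ((n:ℝ) ^ θ n) (Real.log n) B ∧
      tau1 n (r n) (p n) ((n:ℝ) ^ θ n) ≤ (n:ℝ) ^ (-ε) ∧
      Real.log n * eta n (r n) (p n) ((n:ℝ) ^ θ n) (Real.log n)
        ≤ 100 * (Z * Real.log n ^ 135) * (n:ℝ) ^ θ n + (n:ℝ) ^ (-ε) := by
    filter_upwards [hgood, polylog_le (200 * Z) 135 ε hε] with n hg hpl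
    obtain ⟨hg, hrA⟩ := hg
    obtain ⟨b1, b2⟩ := hg.bounds
    have hn0 := hg.n0
    have hn1 : (1:ℝ) ≤ n := by linarith [hg.n9]
    have hl1 := hg.hl1
    have hθn := (hθ n).2
    have hQ : ((B * r n) ^ 15) ^ 9 ≤ Z * Real.log n ^ 135 := by
      rw [← pow_mul]
      calc (B * r n) ^ (15 * 9) ≤ (B * (A * Real.log n)) ^ (15 * 9) := by gcongr
        _ = Z * Real.log n ^ 135 := by rw [hZ, ← mul_assoc, mul_pow]
    have hE : ((n:ℝ) ^ θ n + ((n:ℝ) ^ θ n) ^ 2) / n ≤ 2 * (n:ℝ) ^ (-(2 * ε)) := by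
      have e1 : (n:ℝ) ^ θ n / n ≤ (n:ℝ) ^ (-(2 * ε)) := by
        have : (n:ℝ) ^ θ n / n = (n:ℝ) ^ (θ n - 1) := by
          rw [Real.rpow_sub hn0, Real.rpow_one]
        rw [this]
        exact Real.rpow_le_rpow_of_exponent_le hn1 (by linarith)
      have e2 : ((n:ℝ) ^ θ n) ^ 2 / n ≤ (n:ℝ) ^ (-(2 * ε)) := by
        have : ((n:ℝ) ^ θ n) ^ 2 / n = (n:ℝ) ^ (θ n * 2 - 1) := by
          rw [Real.rpow_sub hn0, Real.rpow_one, Real.rpow_mul hn0.le, Real.rpow_two]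
        rw [this]
        exact Real.rpow_le_rpow_of_exponent_le hn1 (by linarith)
      rw [add_div]; linarith
    have hE0 : 0 ≤ ((n:ℝ) ^ θ n + ((n:ℝ) ^ θ n) ^ 2) / n := by positivity
    have hfin : 100 * ((B * r n) ^ 15) ^ 9 * (((n:ℝ) ^ θ n + ((n:ℝ) ^ θ n) ^ 2) / n)
        ≤ (n:ℝ) ^ (-ε) := by
      calc 100 * ((B * r n) ^ 15) ^ 9 * (((n:ℝ) ^ θ n + ((n:ℝ) ^ θ n) ^ 2) / n)
          ≤ 100 * (Z * Real.log n ^ 135) * (2 * (n:ℝ) ^ (-(2 * ε))) := by gcongr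
        _ = (200 * Z * Real.log n ^ 135) * (n:ℝ) ^ (-(2 * ε)) := by ring
        _ ≤ (n:ℝ) ^ ε * (n:ℝ) ^ (-(2 * ε)) := by gcongr
        _ = (n:ℝ) ^ (-ε) := by
          rw [← Real.rpow_add hn0]; congr 1; ring
    refine ⟨hg, b1.trans hfin, b2.trans ?_⟩
    have ha := hg.ha
    gcongr
  clear_value Z
  refine ⟨100 * Z + 1, ((135 : ℕ) : ℝ), ε, by positivity, Nat.cast_pos.2 (by norm_num), hε, 𝒢, h𝒢u, ?_, ?_⟩
  · have hlow : Filter.Tendsto (fun n : ℕ => 1 - (n:ℝ) ^ (-ε) - 4 / Real.log n)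
        Filter.atTop (nhds 1) := by
      have t1 : Filter.Tendsto (fun n : ℕ => (n:ℝ) ^ (-ε)) Filter.atTop (nhds 0) :=
        (tendsto_rpow_neg_atTop hε).comp tendsto_natCast_atTop_atTop
      have t2 : Filter.Tendsto (fun n : ℕ => 4 / Real.log n) Filter.atTop (nhds 0) :=
        Filter.Tendsto.div_atTop tendsto_const_nhds
          (Real.tendsto_log_atTop.comp tendsto_natCast_atTop_atTop)
      have := ((tendsto_const_nhds (x := (1:ℝ))).sub t1).sub t2
      simpa using this
    refine tendsto_of_tendsto_of_tendsto_of_le_of_le' hlow tendsto_const_nhds ?_ ?_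
    · filter_upwards [hnum] with n hn
      have := (h𝒢 n hn.1).1
      linarith [hn.2.1]
    · exact Filter.Eventually.of_forall fun n => gnp_le_one (hp0 n) (hp1 n) _
  · filter_upwards [hnum] with n hn H hH
    obtain ⟨δ, hδ, hPH⟩ := (h𝒢 n hn.1).2 H hH
    refine ⟨δ, hδ.trans (hn.2.2.trans ?_), ?_⟩
    · rw [Real.rpow_natCast]
      have hl1 := hn.1.hl1
      have ha := hn.1.ha
      have e1 : 0 ≤ Real.log n ^ 135 * (n:ℝ) ^ θ n :=
        mul_nonneg (pow_nonneg (by linarith) _) ha.le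
      have e2 : 0 ≤ (n:ℝ) ^ (-ε) := by positivity
      have e3 : 0 ≤ Z * (n:ℝ) ^ (-ε) := mul_nonneg hZ0.le e2
      linarith
    · rw [FF_eq (hp0 n)]
      exact hPH
end

section
/- Let X be a finite set, 0 < p < 1, and let P be the p-biased product measure on the power set of X (each element of X included independently with probability p). Let D be a down-set (decreasing family) of subsets of X with P(D) > 0, and for an event A set d(A) = P(A) − P(A | D). Then for any up-sets (increasing families) U_1, …, U_k of subsets of X: 0 ≤ d(U_1 ∪ ⋯ ∪ U_k) ≤ d(U_1) + ⋯ + d(U_k). -/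
open Finset
open scoped Classical

/-- The probability that a `p`-biased random subset of the finite set `α`
(each element included independently with probability `p`) lies in the family `A`. -/
noncomputable def biasedProb (α : Type*) [DecidableEq α] [Fintype α] (p : ℝ)
    (A : Set (Finset α)) : ℝ :=
  ∑ S ∈ (Finset.univ : Finset (Finset α)).filter (· ∈ A),
    p ^ S.card * (1 - p) ^ (Fintype.card α - S.card)

theorem biasedProb_eq (α : Type*) [DecidableEq α] [Fintype α] (p : ℝ) (A : Set (Finset α)) :
    biasedProb α p A =
      ∑ S : Finset α, if S ∈ A then p ^ S.card * (1 - p) ^ (Fintype.card α - S.card) else 0 := by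
  unfold biasedProb
  rw [Finset.sum_filter]

theorem biasedProb_univ (α : Type*) [DecidableEq α] [Fintype α] (p : ℝ) :
    biasedProb α p Set.univ = 1 := by
  rw [biasedProb_eq]
  simp only [Set.mem_univ, if_true]
  rw [Fintype.sum_pow_mul_eq_add_pow]
  simp

theorem biasedProb_union (α : Type*) [DecidableEq α] [Fintype α] (p : ℝ) (A B : Set (Finset α)) :
    biasedProb α p (A ∪ B) + biasedProb α p (A ∩ B) = biasedProb α p A + biasedProb α p B := by
  simp only [biasedProb_eq]
  rw [← Finset.sum_add_distrib, ← Finset.sum_add_distrib]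
  refine Finset.sum_congr rfl fun S _ => ?_
  by_cases h1 : S ∈ A <;> by_cases h2 : S ∈ B <;> simp [h1, h2]

theorem biasedProb_fkg {α : Type*} [DecidableEq α] [Fintype α]
    (p : ℝ) (hp0 : 0 < p) (hp1 : p < 1)
    (D : Set (Finset α)) (hD : ∀ A ∈ D, ∀ B ⊆ A, B ∈ D)
    (U : Set (Finset α)) (hU : ∀ A ∈ U, ∀ B, A ⊆ B → B ∈ U) :
    biasedProb α p (U ∩ D) ≤ biasedProb α p D * biasedProb α p U := by
  have hw : ∀ S : Finset α, 0 ≤ p ^ S.card * (1 - p) ^ (Fintype.card α - S.card) := fun S =>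
    mul_nonneg (pow_nonneg hp0.le _) (pow_nonneg (sub_pos.2 hp1).le _)
  have hn : ∀ A : Set (Finset α), (0 : Finset α → ℝ) ≤
      fun S => if S ∈ A then p ^ S.card * (1 - p) ^ (Fintype.card α - S.card) else 0 := by
    intro A S
    dsimp only [Pi.zero_apply]
    split_ifs
    · exact hw S
    · exact le_rfl
  have key := four_functions_theorem_univ _ _ _ _ (hn (U ∩ D)) (hn Set.univ) (hn D) (hn U) (by
    intro a b
    by_cases ha : a ∈ U ∩ D
    · have h1 : a ⊓ b ∈ D := hD a ha.2 _ Finset.inter_subset_left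
      have h2 : a ⊔ b ∈ U := hU a ha.1 _ Finset.subset_union_left
      simp only [ha, h1, h2, Set.mem_univ, if_true]
      apply le_of_eq
      have hc : (a ⊓ b).card + (a ⊔ b).card = a.card + b.card :=
        Finset.card_inter_add_card_union a b
      have c1 := Finset.card_le_univ a
      have c2 := Finset.card_le_univ b
      have c3 := Finset.card_le_univ (a ⊓ b)
      have c4 := Finset.card_le_univ (a ⊔ b)
      rw [mul_mul_mul_comm, ← pow_add, ← pow_add, mul_mul_mul_comm, ← pow_add, ← pow_add, hc]
      congr 2
      omega
    · simp only [ha, if_false, zero_mul]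
      exact mul_nonneg (hn D _) (hn U _))
  rw [← biasedProb_eq, ← biasedProb_eq, ← biasedProb_eq, ← biasedProb_eq, biasedProb_univ,
    mul_one] at key
  exact key

theorem down_set_conditioning {α : Type*} [DecidableEq α] [Fintype α]
    (p : ℝ) (hp0 : 0 < p) (hp1 : p < 1)
    (D : Set (Finset α)) (hD : ∀ A ∈ D, ∀ B ⊆ A, B ∈ D)
    (hDpos : 0 < biasedProb α p D)
    (k : ℕ) (U : Fin k → Set (Finset α))
    (hU : ∀ i, ∀ A ∈ U i, ∀ B, A ⊆ B → B ∈ U i) :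
    0 ≤ biasedProb α p (⋃ i, U i) - biasedProb α p ((⋃ i, U i) ∩ D) / biasedProb α p D ∧
    biasedProb α p (⋃ i, U i) - biasedProb α p ((⋃ i, U i) ∩ D) / biasedProb α p D ≤
      ∑ i, (biasedProb α p (U i) - biasedProb α p (U i ∩ D) / biasedProb α p D) := by
  have nonneg : ∀ V : Set (Finset α), (∀ A ∈ V, ∀ B, A ⊆ B → B ∈ V) →
      0 ≤ biasedProb α p V - biasedProb α p (V ∩ D) / biasedProb α p D := by
    intro V hV
    rw [sub_nonneg, div_le_iff₀ hDpos, mul_comm]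
    exact biasedProb_fkg p hp0 hp1 D hD V hV
  have upU : ∀ s : Finset (Fin k), ∀ A ∈ ⋃ i ∈ s, U i, ∀ B, A ⊆ B → B ∈ ⋃ i ∈ s, U i := by
    intro s A hA B hAB
    simp only [Set.mem_iUnion] at hA ⊢
    obtain ⟨i, hi, h⟩ := hA
    exact ⟨i, hi, hU i A h B hAB⟩
  have main : ∀ s : Finset (Fin k),
      biasedProb α p (⋃ i ∈ s, U i) - biasedProb α p ((⋃ i ∈ s, U i) ∩ D) / biasedProb α p D ≤
      ∑ i ∈ s, (biasedProb α p (U i) - biasedProb α p (U i ∩ D) / biasedProb α p D) := by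
    intro s
    induction s using Finset.induction_on with
    | empty => simp [biasedProb]
    | insert a s ha ih =>
      rw [Finset.sum_insert ha, Finset.set_biUnion_insert]
      have hup := upU s
      generalize (⋃ i ∈ s, U i) = V at ih hup ⊢
      have h1 := biasedProb_union α p (U a) V
      have h2 := biasedProb_union α p (U a ∩ D) (V ∩ D)
      rw [← Set.union_inter_distrib_right, ← Set.inter_inter_distrib_right] at h2
      have h3 := nonneg (U a ∩ V) fun A hA B hAB =>
        ⟨hU a A hA.1 B hAB, hup A hA.2 B hAB⟩
      have h4 : biasedProb α p ((U a ∪ V) ∩ D) / biasedProb α p D +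
          biasedProb α p (U a ∩ V ∩ D) / biasedProb α p D =
          biasedProb α p (U a ∩ D) / biasedProb α p D +
          biasedProb α p (V ∩ D) / biasedProb α p D := by
        rw [← add_div, ← add_div, h2]
      linarith
  have e : (⋃ i, U i) = ⋃ i ∈ (Finset.univ : Finset (Fin k)), U i := by simp
  rw [e]
  exact ⟨nonneg _ (upU _), main _⟩
end
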